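/- arXiv:2407.01830 — 4 statements merged into one kernel-verified Lean document; each statement's English description precedes it below -/
import Mathlib

section
/- Let ν ∈ ℕ, let ω ∈ ℝ^ν be non-resonant, let b = ν − 1, and let s > b/4. Then there exists a constant K = K(ω, s) > 0 such that for every T ∈ (0,1] and every finitely supported a : ℤ^ν → ℂ one has limsup_{L→∞} (1/(2L)) ∫_0^T ∫_{−L}^{L} | ∑_{n ∈ ℤ^ν} a_n e^{i(⟨n⟩_ω x − t ⟨n⟩_ω²)} |^4 dx dt ≤ K^4 · T^{1/2} · ( ∑_{n ∈ ℤ^ν} (1+|n|)^{2s} |a_n|^2 )^2. (Fixed-time L^4 Strichartz estimate for the Schrödinger evolution of quasi-periodic data, Theorem 1.1, estimate (1.6).) -/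
open MeasureTheory Filter

/-- The frequency `⟨n⟩_ω = n · ω` of a lattice point `n ∈ ℤ^ν`. -/
noncomputable def freqQP {ν : ℕ} (ω : Fin ν → ℝ) (n : Fin ν → ℤ) : ℝ :=
  ∑ i, (n i : ℝ) * ω i

/-- The height `|n|` (Euclidean norm) of a lattice point `n ∈ ℤ^ν`. -/
noncomputable def heightQP {ν : ℕ} (n : Fin ν → ℤ) : ℝ :=
  Real.sqrt (∑ i, ((n i : ℝ)) ^ 2)

lemma heightQP_nonneg {ν : ℕ} (n : Fin ν → ℤ) : 0 ≤ heightQP n := Real.sqrt_nonneg _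

lemma abs_le_heightQP {ν : ℕ} (n : Fin ν → ℤ) (i : Fin ν) : |(n i : ℝ)| ≤ heightQP n := by
  unfold heightQP
  rw [← Real.sqrt_sq_eq_abs]
  apply Real.sqrt_le_sqrt
  exact Finset.single_le_sum (f := fun i => ((n i : ℝ)) ^ 2) (fun _ _ => sq_nonneg _) (Finset.mem_univ i)

lemma heightQP_tail_le {d : ℕ} (n : Fin (d + 1) → ℤ) :
    heightQP (fun i : Fin d => n i.succ) ≤ heightQP n := by
  unfold heightQP
  apply Real.sqrt_le_sqrt
  rw [Fin.sum_univ_succ (fun i => ((n i : ℝ)) ^ 2)]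
  linarith [sq_nonneg ((n 0 : ℝ))]

lemma qp_summable_int (p : ℝ) (hp : 1 < p) : Summable (fun m : ℤ => (1 + |(m : ℝ)|) ^ (-p)) := by
  have h := Real.summable_abs_int_rpow hp
  have h0 : Summable (fun m : ℤ => |(m : ℝ)| ^ (-p) + if m = 0 then (1:ℝ) else 0) :=
    h.add (summable_of_ne_finset_zero (s := {0}) (by intro b hb; simp at hb; simp [hb]))
  refine Summable.of_nonneg_of_le (fun m => by positivity) (fun m => ?_) h0
  by_cases hm : m = 0
  · subst hm
    simp
    positivity
  · simp only [hm, if_false, add_zero]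
    have : 0 < |(m : ℝ)| := by positivity
    exact Real.rpow_le_rpow_of_nonpos this (by linarith) (by linarith)

lemma qp_lattice_sum (d : ℕ) (r : ℝ) (hr : (d : ℝ) < r) :
    ∃ C : ℝ, 0 < C ∧ ∀ S : Finset (Fin d → ℤ), ∑ n ∈ S, (1 + heightQP n) ^ (-r) ≤ C := by
  classical
  obtain ⟨p, hp1, hpd⟩ : ∃ p : ℝ, 1 < p ∧ p * d ≤ r := by
    rcases Nat.eq_zero_or_pos d with rfl | hd
    · exact ⟨2, by norm_num, by simpa using hr.le⟩
    · have hd' : (0:ℝ) < d := by exact_mod_cast hd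
      exact ⟨r / d, by rwa [one_lt_div hd'], by field_simp; exact le_refl _⟩
  have hsum := qp_summable_int p hp1
  set A := ∑' m : ℤ, (1 + |(m : ℝ)|) ^ (-p) with hA
  have hA0 : 0 ≤ A := tsum_nonneg (fun m => by positivity)
  refine ⟨A ^ d + 1, by positivity, fun S => ?_⟩
  have h1 : ∀ n : Fin d → ℤ, (1 + heightQP n) ^ (-r) ≤ ∏ i, (1 + |(n i : ℝ)|) ^ (-p) := by
    intro n
    have hh := heightQP_nonneg n
    calc (1 + heightQP n) ^ (-r) ≤ (1 + heightQP n) ^ (-p * d) :=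
          Real.rpow_le_rpow_of_exponent_le (by linarith) (by linarith)
      _ = ∏ i : Fin d, (1 + heightQP n) ^ (-p) := by
          rw [Finset.prod_const, Finset.card_univ, Fintype.card_fin, Real.rpow_mul_natCast (by linarith)]
      _ ≤ _ := by
          apply Finset.prod_le_prod
          · intros; positivity
          · intro i _
            exact Real.rpow_le_rpow_of_nonpos (by positivity)
              (by linarith [abs_le_heightQP n i]) (by linarith)
  calc ∑ n ∈ S, (1 + heightQP n) ^ (-r) ≤ ∑ n ∈ S, ∏ i, (1 + |(n i : ℝ)|) ^ (-p) :=
        Finset.sum_le_sum (fun n _ => h1 n)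
    _ ≤ ∑ n ∈ Fintype.piFinset (fun i : Fin d => S.image (fun n : Fin d → ℤ => (n i : ℤ))), ∏ i, (1 + |((n i : ℤ) : ℝ)|) ^ (-p) := by
        apply Finset.sum_le_sum_of_subset_of_nonneg
        · intro n hn
          simp only [Fintype.mem_piFinset, Finset.mem_image]
          exact fun i => ⟨n, hn, rfl⟩
        · intros; exact Finset.prod_nonneg (fun _ _ => by positivity)
    _ = ∏ i : Fin d, ∑ m ∈ S.image (fun n : Fin d → ℤ => (n i : ℤ)), (1 + |((m : ℤ) : ℝ)|) ^ (-p) := by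
        rw [Finset.prod_univ_sum]
    _ ≤ ∏ i : Fin d, A := by
        apply Finset.prod_le_prod
        · intros; exact Finset.sum_nonneg (fun _ _ => by positivity)
        · intro i _
          exact hsum.sum_le_tsum _ (fun _ _ => by positivity)
    _ ≤ _ := by simp

lemma qp_arctan_step (α ε y : ℝ) (hε : 0 < ε) (hεα : ε ≤ α) :
    1 / (1 + y ^ 2) ≤ (2 + 2 * α ^ 2) / ε * (Real.arctan (y + ε) - Real.arctan y) := by
  obtain ⟨c, hc, hc'⟩ := exists_deriv_eq_slope Real.arctan (show y < y + ε by linarith)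
    Real.continuous_arctan.continuousOn Real.differentiable_arctan.differentiableOn
  have h2 : Real.arctan (y + ε) - Real.arctan y = ε * (1 / (1 + c ^ 2)) := by
    rw [Real.deriv_arctan] at hc'
    replace hc' : 1 / (1 + c ^ 2) = (Real.arctan (y + ε) - Real.arctan y) / (y + ε - y) := hc'
    rw [hc', show y + ε - y = ε by ring]; field_simp
  rw [h2]
  have : (2 + 2 * α ^ 2) / ε * (ε * (1 / (1 + c ^ 2))) = (2 + 2 * α ^ 2) / (1 + c ^ 2) := by
    field_simp
  rw [this, div_le_div_iff₀ (by positivity) (by positivity)]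
  have h3 : (c - y) ^ 2 ≤ α ^ 2 := by
    have := hc.1; have := hc.2
    apply sq_le_sq' <;> linarith
  nlinarith [sq_nonneg (c - 2 * y), sq_nonneg y, mul_nonneg (sq_nonneg y) (sq_nonneg α)]

lemma qp_sum_int (α ε β : ℝ) (hε : 0 < ε) (hεα : ε ≤ α) (S : Finset ℤ) :
    ∑ m ∈ S, 1 / (1 + (ε * m + β) ^ 2) ≤ (2 + 2 * α ^ 2) * Real.pi / ε := by
  obtain ⟨N, hN⟩ : ∃ N : ℕ, ∀ m ∈ S, -(N : ℤ) ≤ m ∧ m < N := by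
    refine ⟨(∑ m ∈ S, m.natAbs) + 1, fun m hm => ?_⟩
    have := Finset.single_le_sum (f := fun m : ℤ => m.natAbs) (fun _ _ => Nat.zero_le _) hm
    omega
  set g : ℤ → ℝ := fun m => Real.arctan (ε * m + β)
  have hg : ∀ m : ℤ, 1 / (1 + (ε * m + β) ^ 2) ≤ (2 + 2 * α ^ 2) / ε * (g (m + 1) - g m) := by
    intro m
    have := qp_arctan_step α ε (ε * m + β) hε hεα
    simp only [g]
    push_cast
    rwa [show ε * ((m : ℝ) + 1) + β = ε * m + β + ε by ring]
  have htel : ∀ M : ℕ, ∑ j ∈ Finset.range M, (g ((j : ℤ) - N + 1) - g ((j : ℤ) - N)) = g (M - N) - g (-N) := by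
    intro M
    induction M with
    | zero => simp
    | succ k ih =>
      rw [Finset.sum_range_succ, ih]; push_cast
      rw [show (k : ℤ) - N + 1 = k + 1 - N by ring]; ring
  calc ∑ m ∈ S, 1 / (1 + (ε * m + β) ^ 2)
      ≤ ∑ m ∈ (Finset.range (2 * N)).image (fun j : ℕ => (j : ℤ) - N), 1 / (1 + (ε * m + β) ^ 2) := by
        apply Finset.sum_le_sum_of_subset_of_nonneg
        · intro m hm
          have := hN m hm
          simp only [Finset.mem_image, Finset.mem_range]
          exact ⟨(m + N).toNat, by omega, by omega⟩
        · intros; positivity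
    _ ≤ ∑ m ∈ (Finset.range (2 * N)).image (fun j : ℕ => (j : ℤ) - N), (2 + 2 * α ^ 2) / ε * (g (m + 1) - g m) :=
        Finset.sum_le_sum (fun m _ => hg m)
    _ = (2 + 2 * α ^ 2) / ε * ∑ j ∈ Finset.range (2 * N), (g ((j : ℤ) - N + 1) - g ((j : ℤ) - N)) := by
        rw [Finset.sum_image (by intro a _ b _ h; simpa using h), Finset.mul_sum]
    _ ≤ (2 + 2 * α ^ 2) / ε * Real.pi := by
        rw [htel]
        apply mul_le_mul_of_nonneg_left _ (by positivity)
        have h1 := Real.arctan_lt_pi_div_two (ε * (((2 * N : ℕ) : ℤ) - N : ℤ) + β)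
        have h2 := Real.neg_pi_div_two_lt_arctan (ε * ((-N : ℤ) : ℝ) + β)
        simp only [g]
        linarith
    _ = _ := by ring

lemma qp_quartic_le (θ x σ : ℝ) :
    1 / (1 + (θ ^ 2) ^ 2 * (x ^ 2 - σ ^ 2) ^ 2) ≤
      2 * (1 / (1 + (θ * (x - σ)) ^ 2)) + 2 * (1 / (1 + (θ * (x + σ)) ^ 2)) := by
  have key : ∀ y z : ℝ, y ^ 2 ≤ z ^ 2 → 1 / (1 + (y * z) ^ 2) ≤ 2 * (1 / (1 + y ^ 2)) := by
    intro y z h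
    have h1 : (y ^ 2) ^ 2 ≤ (y * z) ^ 2 := by
      rw [mul_pow, sq (y ^ 2)]; exact mul_le_mul_of_nonneg_left h (sq_nonneg _)
    rw [mul_one_div, div_le_div_iff₀ (by positivity) (by positivity)]
    nlinarith [sq_nonneg (y ^ 2 - 1)]
  have e : (θ ^ 2) ^ 2 * (x ^ 2 - σ ^ 2) ^ 2 = ((θ * (x - σ)) * (θ * (x + σ))) ^ 2 := by ring
  rw [e]
  have p1 : 0 ≤ 2 * (1 / (1 + (θ * (x - σ)) ^ 2)) := by positivity
  have p2 : 0 ≤ 2 * (1 / (1 + (θ * (x + σ)) ^ 2)) := by positivity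
  rcases le_total ((θ * (x - σ)) ^ 2) ((θ * (x + σ)) ^ 2) with h | h
  · have := key _ _ h; linarith
  · have := key _ _ h; rw [mul_comm (θ * (x + σ))] at this; linarith

lemma qp_sum_int' (α : ℝ) (hα : 0 < α) (θ : ℝ) (hθ : 0 < θ) (hθ1 : θ ≤ 1) (β σ : ℝ) (S : Finset ℤ) :
    ∑ m ∈ S, 1 / (1 + (θ ^ 2) ^ 2 * ((α * m + β) ^ 2 - σ ^ 2) ^ 2) ≤
      (4 * (2 + 2 * α ^ 2) * Real.pi / α) / θ := by
  calc _ ≤ ∑ m ∈ S, (2 * (1 / (1 + (θ * (α * m + β - σ)) ^ 2)) + 2 * (1 / (1 + (θ * (α * m + β + σ)) ^ 2))) :=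
        Finset.sum_le_sum (fun m _ => qp_quartic_le θ _ σ)
    _ = 2 * ∑ m ∈ S, 1 / (1 + (θ * α * m + θ * (β - σ)) ^ 2) + 2 * ∑ m ∈ S, 1 / (1 + (θ * α * m + θ * (β + σ)) ^ 2) := by
        rw [Finset.sum_add_distrib, Finset.mul_sum, Finset.mul_sum]
        congr 1 <;> refine Finset.sum_congr rfl (fun m _ => ?_) <;> ring_nf
    _ ≤ 2 * ((2 + 2 * α ^ 2) * Real.pi / (θ * α)) + 2 * ((2 + 2 * α ^ 2) * Real.pi / (θ * α)) := by
        have hle : θ * α ≤ α := by nlinarith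
        gcongr <;> exact qp_sum_int α (θ * α) _ (by positivity) hle S
    _ = _ := by field_simp; ring

/-- the weighted counting estimate -/
lemma qp_weighted (d : ℕ) (ω : Fin (d + 1) → ℝ) (h0 : 0 < ω 0) (s : ℝ) (hs : (d : ℝ) / 4 < s) :
    ∃ C : ℝ, 0 < C ∧ ∀ θ : ℝ, 0 < θ → θ ≤ 1 → ∀ (q σ : ℝ) (S : Finset (Fin (d + 1) → ℤ)),
      ∑ n ∈ S, (1 + heightQP n) ^ (-(4 * s)) *
        (1 / (1 + (θ ^ 2) ^ 2 * ((freqQP ω n - q) ^ 2 - σ ^ 2) ^ 2)) ≤ C / θ := by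
  classical
  obtain ⟨C, hC, hCS⟩ := qp_lattice_sum d (4 * s) (by linarith)
  have hd : (0:ℝ) ≤ d := Nat.cast_nonneg d
  refine ⟨C * (4 * (2 + 2 * ω 0 ^ 2) * Real.pi / ω 0), by positivity, fun θ hθ hθ1 q σ S => ?_⟩
  set B := 4 * (2 + 2 * ω 0 ^ 2) * Real.pi / ω 0 with hB
  set F : (Fin d → ℤ) → ℤ → ℝ := fun n' m =>
    1 / (1 + (θ ^ 2) ^ 2 * ((ω 0 * m + (∑ i : Fin d, (n' i : ℝ) * ω i.succ - q)) ^ 2 - σ ^ 2) ^ 2) with hF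
  have hFpos : ∀ n' m, 0 ≤ F n' m := fun n' m => by simp only [hF]; positivity
  have hterm : ∀ n : Fin (d + 1) → ℤ, (1 + heightQP n) ^ (-(4 * s)) *
        (1 / (1 + (θ ^ 2) ^ 2 * ((freqQP ω n - q) ^ 2 - σ ^ 2) ^ 2)) ≤
        (1 + heightQP (fun i : Fin d => n i.succ)) ^ (-(4 * s)) * F (fun i : Fin d => n i.succ) (n 0) := by
    intro n
    have e : F (fun i : Fin d => n i.succ) (n 0) =
        1 / (1 + (θ ^ 2) ^ 2 * ((freqQP ω n - q) ^ 2 - σ ^ 2) ^ 2) := by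
      simp only [hF, freqQP]
      rw [Fin.sum_univ_succ (fun i => (n i : ℝ) * ω i)]
      ring_nf
    rw [e]
    apply mul_le_mul_of_nonneg_right _ (by positivity)
    exact Real.rpow_le_rpow_of_nonpos (by linarith [heightQP_nonneg (fun i : Fin d => n i.succ)])
      (by linarith [heightQP_tail_le n]) (by linarith)
  have hinj : Function.Injective (fun n : Fin (d + 1) → ℤ => ((fun i : Fin d => n i.succ), n 0)) := by
    intro a b h
    simp only [Prod.mk.injEq] at h
    funext i
    refine Fin.cases h.2 (fun j => congrFun h.1 j) i
  set S1 := S.image (fun n => fun i : Fin d => n i.succ)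
  set S2 := S.image (fun n => n 0)
  calc _ ≤ ∑ n ∈ S, (1 + heightQP (fun i : Fin d => n i.succ)) ^ (-(4 * s)) * F (fun i : Fin d => n i.succ) (n 0) :=
        Finset.sum_le_sum (fun n _ => hterm n)
    _ = ∑ x ∈ S.image (fun n : Fin (d + 1) → ℤ => ((fun i : Fin d => n i.succ), n 0)),
          (1 + heightQP x.1) ^ (-(4 * s)) * F x.1 x.2 := by
        rw [Finset.sum_image (fun a _ b _ h => hinj h)]
    _ ≤ ∑ x ∈ S1 ×ˢ S2, (1 + heightQP x.1) ^ (-(4 * s)) * F x.1 x.2 := by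
        apply Finset.sum_le_sum_of_subset_of_nonneg
        · intro x hx
          obtain ⟨n, hn, rfl⟩ := Finset.mem_image.1 hx
          exact Finset.mem_product.2 ⟨Finset.mem_image_of_mem _ hn, Finset.mem_image_of_mem _ hn⟩
        · intro x _ _
          have := heightQP_nonneg x.1
          exact mul_nonneg (by positivity) (hFpos _ _)
    _ = ∑ n' ∈ S1, (1 + heightQP n') ^ (-(4 * s)) * ∑ m ∈ S2, F n' m := by
        rw [Finset.sum_product]
        simp_rw [Finset.mul_sum]
    _ ≤ ∑ n' ∈ S1, (1 + heightQP n') ^ (-(4 * s)) * (B / θ) := by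
        apply Finset.sum_le_sum
        intro n' _
        have := heightQP_nonneg n'
        apply mul_le_mul_of_nonneg_left _ (by positivity)
        exact qp_sum_int' (ω 0) h0 θ hθ hθ1 _ σ S2
    _ = (∑ n' ∈ S1, (1 + heightQP n') ^ (-(4 * s))) * (B / θ) := by rw [Finset.sum_mul]
    _ ≤ C * (B / θ) := by
        apply mul_le_mul_of_nonneg_right (hCS S1); positivity
    _ = _ := by ring

lemma qp_normsq {ι : Type*} (S : Finset ι) (z : ι → ℂ) :
    ((‖∑ n ∈ S, z n‖ ^ 2 : ℝ) : ℂ) = ∑ n ∈ S, ∑ m ∈ S, z n * (starRingEnd ℂ) (z m) := by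
  rw [Complex.ofReal_pow, ← Complex.mul_conj', map_sum, Finset.sum_mul_sum]

lemma qp_gauss (T : ℝ) (hT : 0 < T) (μ : ℝ) :
    ‖∫ t : ℝ, Complex.exp (Complex.I * (μ : ℂ) * t) * Complex.exp (-((1 / T ^ 2 : ℝ) : ℂ) * t ^ 2)‖
      ≤ T * Real.sqrt Real.pi * (1 / (1 + T ^ 2 * (μ / 2) ^ 2)) := by
  have hb : 0 < (((1 / T ^ 2 : ℝ) : ℂ)).re := by
    rw [Complex.ofReal_re]; positivity
  rw [fourierIntegral_gaussian hb]
  have e1 : ((Real.pi : ℂ) / ((1 / T ^ 2 : ℝ) : ℂ)) ^ (1 / 2 : ℂ) = ((T * Real.sqrt Real.pi : ℝ) : ℂ) := by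
    have : ((Real.pi : ℂ) / ((1 / T ^ 2 : ℝ) : ℂ)) = ((T ^ 2 * Real.pi : ℝ) : ℂ) := by
      push_cast; field_simp
    rw [this]
    have h2 : (1 / 2 : ℂ) = ((1 / 2 : ℝ) : ℂ) := by push_cast; rfl
    rw [h2, ← Complex.ofReal_cpow (by positivity), ← Real.sqrt_eq_rpow,
      Real.sqrt_mul (by positivity), Real.sqrt_sq hT.le]
  have e2 : Complex.exp (-(μ : ℂ) ^ 2 / (4 * ((1 / T ^ 2 : ℝ) : ℂ))) =
      ((Real.exp (-(T ^ 2 * (μ / 2) ^ 2)) : ℝ) : ℂ) := by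
    rw [Complex.ofReal_exp]; congr 1; push_cast; field_simp; ring
  rw [e1, e2, ← Complex.ofReal_mul, Complex.norm_real, Real.norm_eq_abs, abs_of_nonneg (by positivity)]
  apply mul_le_mul_of_nonneg_left _ (by positivity)
  rw [Real.exp_neg, ← one_div]
  apply one_div_le_one_div_of_le (by positivity)
  linarith [Real.add_one_le_exp (T ^ 2 * (μ / 2) ^ 2)]

lemma qp_quad {ι : Type*} (S : Finset ι) (c : ι → ℂ) (μ : ι → ℝ) (T : ℝ) (hT : 0 < T) :
    ∫ t in Set.Icc (0:ℝ) T, ‖∑ n ∈ S, c n * Complex.exp (Complex.I * ((-(t * μ n) : ℝ) : ℂ))‖ ^ 2 ≤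
      Real.exp 1 * (T * Real.sqrt Real.pi) *
        ∑ n ∈ S, ∑ m ∈ S, ‖c n‖ * ‖c m‖ * (1 / (1 + T ^ 2 * ((μ m - μ n) / 2) ^ 2)) := by
  set f : ℝ → ℝ := fun t => ‖∑ n ∈ S, c n * Complex.exp (Complex.I * ((-(t * μ n) : ℝ) : ℂ))‖ ^ 2 with hf
  have hfc : Continuous f := by simp only [hf]; fun_prop
  set g : ℝ → ℝ := fun t => Real.exp (-(1 / T ^ 2) * t ^ 2) * f t with hg
  have hb : 0 < (((1 / T ^ 2 : ℝ) : ℂ)).re := by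
    rw [Complex.ofReal_re]; positivity
  have hgc : ∀ t : ℝ, ((g t : ℝ) : ℂ) = ∑ n ∈ S, ∑ m ∈ S, (c n * (starRingEnd ℂ) (c m)) *
      (Complex.exp (Complex.I * ((μ m - μ n : ℝ) : ℂ) * t) * Complex.exp (-((1 / T ^ 2 : ℝ) : ℂ) * t ^ 2)) := by
    intro t
    simp only [hg, hf]
    rw [Complex.ofReal_mul, qp_normsq, Finset.mul_sum]
    refine Finset.sum_congr rfl (fun n _ => ?_)
    rw [Finset.mul_sum]
    refine Finset.sum_congr rfl (fun m _ => ?_)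
    rw [map_mul, ← Complex.exp_conj, map_mul, Complex.conj_I, Complex.conj_ofReal, Complex.ofReal_exp]
    have : Complex.exp (Complex.I * ((μ m - μ n : ℝ) : ℂ) * t) =
        Complex.exp (Complex.I * ((-(t * μ n) : ℝ) : ℂ)) * Complex.exp (-Complex.I * ((-(t * μ m) : ℝ) : ℂ)) := by
      rw [← Complex.exp_add]; congr 1; push_cast; ring
    rw [this]
    push_cast
    ring
  have hint : ∀ ξ : ℝ, Integrable (fun t : ℝ => Complex.exp (Complex.I * (ξ : ℂ) * t) *
      Complex.exp (-((1 / T ^ 2 : ℝ) : ℂ) * t ^ 2)) := by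
    intro ξ
    have := integrable_cexp_quadratic hb (Complex.I * (ξ : ℂ)) 0
    refine this.congr (Eventually.of_forall fun t => ?_)
    simp only [← Complex.exp_add]
    congr 1; ring
  have hgint : Integrable g := by
    have : Integrable (fun t : ℝ => ((g t : ℝ) : ℂ)) := by
      simp_rw [hgc]
      exact integrable_finsetSum _ (fun n _ => integrable_finsetSum _ (fun m _ => (hint _).const_mul _))
    simpa using this.re
  have hg0 : ∀ t, 0 ≤ g t := fun t => by simp only [hg, hf]; positivity
  have hle : ∫ t, g t ≤ (T * Real.sqrt Real.pi) *
        ∑ n ∈ S, ∑ m ∈ S, ‖c n‖ * ‖c m‖ * (1 / (1 + T ^ 2 * ((μ m - μ n) / 2) ^ 2)) := by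
    have h1 : ∫ t, g t = ‖((∫ t, g t : ℝ) : ℂ)‖ := by
      rw [Complex.norm_real, Real.norm_eq_abs, abs_of_nonneg (integral_nonneg hg0)]
    rw [h1, ← integral_complex_ofReal]
    simp_rw [hgc]
    rw [integral_finsetSum _ (fun n _ => integrable_finsetSum _ (fun m _ => (hint _).const_mul _)), Finset.mul_sum]
    refine norm_sum_le_of_le _ (fun n _ => ?_)
    rw [integral_finsetSum _ (fun m _ => (hint _).const_mul _), Finset.mul_sum]
    refine norm_sum_le_of_le _ (fun m _ => ?_)
    rw [integral_const_mul, norm_mul, norm_mul, RCLike.norm_conj]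
    have := qp_gauss T hT (μ m - μ n)
    calc _ ≤ ‖c n‖ * ‖c m‖ * (T * Real.sqrt Real.pi * (1 / (1 + T ^ 2 * ((μ m - μ n) / 2) ^ 2))) :=
          mul_le_mul_of_nonneg_left this (by positivity)
      _ = _ := by ring
  calc ∫ t in Set.Icc (0:ℝ) T, f t ≤ ∫ t in Set.Icc (0:ℝ) T, Real.exp 1 * g t := by
        apply setIntegral_mono_on hfc.integrableOn_Icc (hgint.integrableOn.const_mul _) measurableSet_Icc
        intro t ht
        have hf0 : 0 ≤ f t := by simp only [hf]; positivity
        have : 1 ≤ Real.exp 1 * Real.exp (-(1 / T ^ 2) * t ^ 2) := by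
          rw [← Real.exp_add]
          apply Real.one_le_exp
          have : t ^ 2 ≤ T ^ 2 := pow_le_pow_left₀ ht.1 ht.2 2
          have h2 : (1 / T ^ 2) * t ^ 2 ≤ 1 := by
            rw [one_div_mul_eq_div]; exact div_le_one_of_le₀ this (by positivity)
          linarith
        simp only [hg]
        rw [← mul_assoc]
        exact le_mul_of_one_le_left hf0 this
    _ = Real.exp 1 * ∫ t in Set.Icc (0:ℝ) T, g t := integral_const_mul _ _
    _ ≤ Real.exp 1 * ∫ t, g t := by
        apply mul_le_mul_of_nonneg_left _ (by positivity)
        exact setIntegral_le_integral hgint (Eventually.of_forall hg0)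
    _ ≤ _ := by
        rw [mul_assoc]
        exact mul_le_mul_of_nonneg_left hle (by positivity)

lemma qp_mean_exp (ξ : ℝ) :
    Tendsto (fun L : ℝ => ((1 / (2 * L) : ℝ) : ℂ) * ∫ x in Set.Icc (-L) L, Complex.exp (Complex.I * ((ξ * x : ℝ) : ℂ)))
      atTop (nhds (if ξ = 0 then 1 else 0)) := by
  split_ifs with h
  · subst h
    refine tendsto_const_nhds.congr' ?_
    filter_upwards [eventually_gt_atTop 0] with L hL
    simp
    rw [max_eq_left (by linarith)]
    have : (L : ℂ) ≠ 0 := by exact_mod_cast hL.ne'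
    push_cast
    field_simp
    norm_num
  · rw [tendsto_zero_iff_norm_tendsto_zero]
    have hlim : Tendsto (fun L : ℝ => (1 / |ξ|) * L⁻¹) atTop (nhds 0) := by
      simpa using tendsto_inv_atTop_zero.const_mul (1 / |ξ|)
    refine squeeze_zero' (Eventually.of_forall fun _ => norm_nonneg _) ?_ hlim
    filter_upwards [eventually_gt_atTop 0] with L hL
    rw [integral_Icc_eq_integral_Ioc, ← intervalIntegral.integral_of_le (by linarith)]
    have hc : Complex.I * (ξ : ℂ) ≠ 0 := mul_ne_zero Complex.I_ne_zero (by exact_mod_cast h)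
    have e : (fun x : ℝ => Complex.exp (Complex.I * ((ξ * x : ℝ) : ℂ))) =
        fun x : ℝ => Complex.exp (Complex.I * (ξ : ℂ) * x) := by
      funext x; push_cast; rw [mul_assoc]
    rw [e, integral_exp_mul_complex hc, norm_mul, norm_div, Complex.norm_real, norm_mul, Complex.norm_I,
      Complex.norm_real, one_mul, Real.norm_eq_abs, Real.norm_eq_abs, abs_of_pos (by positivity : 0 < 1 / (2 * L))]
    have hn : ∀ y : ℝ, ‖Complex.exp (Complex.I * (ξ : ℂ) * y)‖ = 1 := by
      intro y
      rw [mul_assoc, ← Complex.ofReal_mul, mul_comm, Complex.norm_exp_ofReal_mul_I]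
    have h2 : ‖Complex.exp (Complex.I * (ξ : ℂ) * (L : ℝ)) - Complex.exp (Complex.I * (ξ : ℂ) * ((-L : ℝ) : ℂ))‖ ≤ 2 := by
      refine (norm_sub_le _ _).trans ?_
      rw [hn, hn]; norm_num
    have hξ : 0 < |ξ| := abs_pos.2 h
    calc _ ≤ 1 / (2 * L) * (2 / |ξ|) := by gcongr
      _ = _ := by field_simp

lemma qp_limit {ι : Type*} (P : Finset ι) (lam : ι → ℝ)
    (hinj : ∀ k ∈ P, ∀ l ∈ P, lam k - lam l = 0 → k = l) (C : ι → ℝ → ℂ) (hC : ∀ k, Continuous (C k)) (T : ℝ) :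
    Tendsto (fun L : ℝ => (1 / (2 * L)) * ∫ t in Set.Icc (0:ℝ) T, ∫ x in Set.Icc (-L) L,
        ‖∑ k ∈ P, C k t * Complex.exp (Complex.I * ((lam k * x : ℝ) : ℂ))‖ ^ 2) atTop
      (nhds (∑ k ∈ P, ∫ t in Set.Icc (0:ℝ) T, ‖C k t‖ ^ 2)) := by
  classical
  set D : ι → ι → ℂ := fun k l => ∫ t in Set.Icc (0:ℝ) T, C k t * (starRingEnd ℂ) (C l t) with hD
  set J : ι → ι → ℝ → ℂ := fun k l L => ∫ x in Set.Icc (-L) L, Complex.exp (Complex.I * (((lam k - lam l) * x : ℝ) : ℂ)) with hJ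
  have hcj : ∀ l, Continuous (fun t => (starRingEnd ℂ) (C l t)) := fun l => Complex.continuous_conj.comp (hC l)
  have hval : ∀ L : ℝ, (((1 / (2 * L)) * ∫ t in Set.Icc (0:ℝ) T, ∫ x in Set.Icc (-L) L,
        ‖∑ k ∈ P, C k t * Complex.exp (Complex.I * ((lam k * x : ℝ) : ℂ))‖ ^ 2 : ℝ) : ℂ) =
        ∑ k ∈ P, ∑ l ∈ P, D k l * (((1 / (2 * L) : ℝ) : ℂ) * J k l L) := by
    intro L
    rw [Complex.ofReal_mul, ← integral_complex_ofReal]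
    have hin : ∀ t : ℝ, ((∫ x in Set.Icc (-L) L,
        ‖∑ k ∈ P, C k t * Complex.exp (Complex.I * ((lam k * x : ℝ) : ℂ))‖ ^ 2 : ℝ) : ℂ) =
        ∑ k ∈ P, ∑ l ∈ P, (C k t * (starRingEnd ℂ) (C l t)) * J k l L := by
      intro t
      rw [← integral_complex_ofReal]
      have : ∀ x : ℝ, ((‖∑ k ∈ P, C k t * Complex.exp (Complex.I * ((lam k * x : ℝ) : ℂ))‖ ^ 2 : ℝ) : ℂ) =
          ∑ k ∈ P, ∑ l ∈ P, (C k t * (starRingEnd ℂ) (C l t)) * Complex.exp (Complex.I * (((lam k - lam l) * x : ℝ) : ℂ)) := by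
        intro x
        rw [qp_normsq]
        refine Finset.sum_congr rfl (fun k _ => Finset.sum_congr rfl (fun l _ => ?_))
        rw [map_mul, ← Complex.exp_conj, map_mul, Complex.conj_I, Complex.conj_ofReal]
        have : Complex.exp (Complex.I * (((lam k - lam l) * x : ℝ) : ℂ)) =
          Complex.exp (Complex.I * ((lam k * x : ℝ) : ℂ)) * Complex.exp (-Complex.I * ((lam l * x : ℝ) : ℂ)) := by
          rw [← Complex.exp_add]; congr 1; push_cast; ring
        rw [this]; ring
      simp_rw [this]
      have hi : ∀ k l, IntegrableOn (fun x : ℝ => (C k t * (starRingEnd ℂ) (C l t)) *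
          Complex.exp (Complex.I * (((lam k - lam l) * x : ℝ) : ℂ))) (Set.Icc (-L) L) := by
        intro k l
        apply Continuous.integrableOn_Icc
        fun_prop
      rw [integral_finsetSum _ (fun k _ => integrable_finsetSum _ (fun l _ => hi k l))]
      refine Finset.sum_congr rfl (fun k _ => ?_)
      rw [integral_finsetSum _ (fun l _ => hi k l)]
      refine Finset.sum_congr rfl (fun l _ => ?_)
      rw [integral_const_mul]
    simp_rw [hin]
    have hi : ∀ k l, IntegrableOn (fun t : ℝ => (C k t * (starRingEnd ℂ) (C l t)) * J k l L) (Set.Icc 0 T) := by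
      intro k l
      apply Continuous.integrableOn_Icc
      exact ((hC k).mul (hcj l)).mul continuous_const
    rw [integral_finsetSum _ (fun k _ => integrable_finsetSum _ (fun l _ => hi k l)), Finset.mul_sum]
    refine Finset.sum_congr rfl (fun k _ => ?_)
    rw [integral_finsetSum _ (fun l _ => hi k l), Finset.mul_sum]
    refine Finset.sum_congr rfl (fun l _ => ?_)
    rw [integral_mul_const]
    simp only [hD]
    ring
  have hlimC : Tendsto (fun L : ℝ => ∑ k ∈ P, ∑ l ∈ P, D k l * (((1 / (2 * L) : ℝ) : ℂ) * J k l L)) atTop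
      (nhds (∑ k ∈ P, ∑ l ∈ P, D k l * (if lam k - lam l = 0 then 1 else 0))) :=
    tendsto_finsetSum _ (fun k _ => tendsto_finsetSum _ (fun l _ => (qp_mean_exp _).const_mul _))
  have hre := (Complex.continuous_re.tendsto _).comp hlimC
  have hfin : (∑ k ∈ P, ∑ l ∈ P, D k l * (if lam k - lam l = 0 then 1 else 0)).re =
      ∑ k ∈ P, ∫ t in Set.Icc (0:ℝ) T, ‖C k t‖ ^ 2 := by
    rw [Complex.re_sum]
    refine Finset.sum_congr rfl (fun k hk => ?_)
    rw [Finset.sum_eq_single k]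
    · simp only [sub_self, if_true, mul_one, hD]
      have : ∀ t, C k t * (starRingEnd ℂ) (C k t) = ((‖C k t‖ ^ 2 : ℝ) : ℂ) := by
        intro t; rw [Complex.mul_conj']; push_cast; rfl
      simp_rw [this]
      rw [integral_complex_ofReal, Complex.ofReal_re]
    · intro l hl hne
      rw [if_neg, mul_zero]
      intro h0; exact hne (hinj k hk l hl h0).symm
    · intro h; exact absurd hk h
  rw [hfin] at hre
  refine hre.congr (fun L => ?_)
  simp only [Function.comp]
  rw [← hval, Complex.ofReal_re]

lemma freqQP_sub {ν : ℕ} (ω : Fin ν → ℝ) (n m : Fin ν → ℤ) :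
    freqQP ω (n - m) = freqQP ω n - freqQP ω m := by
  unfold freqQP
  rw [← Finset.sum_sub_distrib]
  refine Finset.sum_congr rfl (fun i _ => ?_)
  simp only [Pi.sub_apply]; push_cast; ring

/-- Abstract Schur test with symmetric kernel. -/
lemma qp_schur {ι : Type*} (S : Finset ι) (x B u : ι → ℝ) (G : ι → ι → ℝ) (M : ℝ)
    (hG : ∀ n m, 0 ≤ G n m) (hsymm : ∀ n m, G n m = G m n)
    (hx : ∀ n, x n = B n * u n) (hM : ∀ n ∈ S, ∑ m ∈ S, u m ^ 2 * G n m ≤ M) :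
    ∑ n ∈ S, ∑ m ∈ S, x n * x m * G n m ≤ M * ∑ n ∈ S, B n ^ 2 := by
  have h1 : ∑ n ∈ S, ∑ m ∈ S, x n * x m * G n m ≤
      ∑ n ∈ S, ∑ m ∈ S, ((1 / 2) * (B n ^ 2 * (u m ^ 2 * G n m)) + (1 / 2) * (B m ^ 2 * (u n ^ 2 * G m n))) := by
    refine Finset.sum_le_sum (fun n _ => Finset.sum_le_sum (fun m _ => ?_))
    rw [hsymm m n, hx n, hx m]
    have := mul_nonneg (sq_nonneg (B n * u m - B m * u n)) (hG n m)
    nlinarith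
  have h2 : ∑ n ∈ S, ∑ m ∈ S, ((1 / 2) * (B n ^ 2 * (u m ^ 2 * G n m)) + (1 / 2) * (B m ^ 2 * (u n ^ 2 * G m n)))
      = ∑ n ∈ S, B n ^ 2 * ∑ m ∈ S, u m ^ 2 * G n m := by
    simp_rw [Finset.sum_add_distrib]
    rw [Finset.sum_comm (f := fun n m => (1 / 2) * (B m ^ 2 * (u n ^ 2 * G m n))), ← Finset.sum_add_distrib]
    refine Finset.sum_congr rfl (fun n _ => ?_)
    rw [← Finset.sum_add_distrib, Finset.mul_sum]
    refine Finset.sum_congr rfl (fun m _ => ?_)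
    ring
  rw [h2] at h1
  refine h1.trans ?_
  rw [Finset.mul_sum]
  refine Finset.sum_le_sum (fun n hn => ?_)
  rw [mul_comm]
  exact mul_le_mul_of_nonneg_right (hM n hn) (sq_nonneg _)

lemma qp_block {ν : ℕ} (ω : Fin ν → ℝ) (s C θ : ℝ) (hθ : 0 < θ)
    (hw : ∀ (q σ : ℝ) (S : Finset (Fin ν → ℤ)),
      ∑ n ∈ S, (1 + heightQP n) ^ (-(4 * s)) *
        (1 / (1 + (θ ^ 2) ^ 2 * ((freqQP ω n - q) ^ 2 - σ ^ 2) ^ 2)) ≤ C / θ)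
    (S : Finset (Fin ν → ℤ)) (a : (Fin ν → ℤ) → ℂ) (k : Fin ν → ℤ) :
    ∫ t in Set.Icc (0:ℝ) (θ ^ 2), ‖∑ n ∈ S, a n * a (k - n) *
        Complex.exp (Complex.I * ((-(t * (freqQP ω n ^ 2 + freqQP ω (k - n) ^ 2)) : ℝ) : ℂ))‖ ^ 2 ≤
      Real.exp 1 * (θ ^ 2 * Real.sqrt Real.pi) * ((C / θ) *
        ∑ n ∈ S, ((1 + heightQP n) ^ (2 * s) * ‖a n‖ ^ 2) *
          ((1 + heightQP (k - n)) ^ (2 * s) * ‖a (k - n)‖ ^ 2)) := by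
  classical
  refine (qp_quad S (fun n => a n * a (k - n)) (fun n => freqQP ω n ^ 2 + freqQP ω (k - n) ^ 2)
    (θ ^ 2) (by positivity)).trans ?_
  apply mul_le_mul_of_nonneg_left _ (by positivity)
  set p : (Fin ν → ℤ) → ℝ := fun n => (1 + heightQP n) ^ s with hp
  have hh : ∀ n : Fin ν → ℤ, 0 < 1 + heightQP n := fun n => by linarith [heightQP_nonneg n]
  have hp0 : ∀ n, 0 < p n := fun n => Real.rpow_pos_of_pos (hh n) _
  have hp2 : ∀ n : Fin ν → ℤ, (1 + heightQP n) ^ (2 * s) = p n ^ 2 := by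
    intro n; simp only [hp]; rw [mul_comm, Real.rpow_mul (hh n).le]; norm_num
  have hp4 : ∀ n : Fin ν → ℤ, (1 + heightQP n) ^ (-(4 * s)) = (p n ^ 4)⁻¹ := by
    intro n; simp only [hp]; rw [Real.rpow_neg (hh n).le, mul_comm, Real.rpow_mul (hh n).le]; norm_num
  set q := freqQP ω k / 2 with hq
  set y : (Fin ν → ℤ) → ℝ := fun n => freqQP ω n - q with hy
  set G : (Fin ν → ℤ) → (Fin ν → ℤ) → ℝ := fun n m => 1 / (1 + (θ ^ 2) ^ 2 * (y m ^ 2 - y n ^ 2) ^ 2) with hG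
  have hker : ∀ n m : Fin ν → ℤ, 1 / (1 + (θ ^ 2) ^ 2 * (((freqQP ω m ^ 2 + freqQP ω (k - m) ^ 2) -
      (freqQP ω n ^ 2 + freqQP ω (k - n) ^ 2)) / 2) ^ 2) = G n m := by
    intro n m
    simp only [hG, hy, hq, freqQP_sub]
    congr 4; ring
  simp_rw [hker]
  have hsch := qp_schur S (fun n => ‖a n * a (k - n)‖)
    (fun n => ‖a n * a (k - n)‖ * (p n * p (k - n))) (fun n => (p n * p (k - n))⁻¹) G (C / θ)
    (fun n m => by simp only [hG]; positivity)
    (fun n m => by simp only [hG]; congr 3; ring)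
    (fun n => by
      have := hp0 n; have := hp0 (k - n); field_simp)
    (fun n _ => ?_)
  · refine hsch.trans (le_of_eq ?_)
    congr 1
    refine Finset.sum_congr rfl (fun n _ => ?_)
    rw [hp2, hp2, norm_mul]; ring
  · have hA := hw q (y n) S
    have hB := hw q (y n) (S.image (fun m => k - m))
    rw [Finset.sum_image (by intro a _ b _ h; simpa using h)] at hB
    have : ∑ m ∈ S, ((p m * p (k - m))⁻¹) ^ 2 * G n m ≤
        ∑ m ∈ S, ((1 / 2) * ((1 + heightQP m) ^ (-(4 * s)) *
          (1 / (1 + (θ ^ 2) ^ 2 * ((freqQP ω m - q) ^ 2 - y n ^ 2) ^ 2))) +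
          (1 / 2) * ((1 + heightQP (k - m)) ^ (-(4 * s)) *
          (1 / (1 + (θ ^ 2) ^ 2 * ((freqQP ω (k - m) - q) ^ 2 - y n ^ 2) ^ 2)))) := by
      refine Finset.sum_le_sum (fun m _ => ?_)
      have e1 : (freqQP ω (k - m) - q) ^ 2 = y m ^ 2 := by
        simp only [hy, hq, freqQP_sub]; ring
      have e2 : (freqQP ω m - q) ^ 2 = y m ^ 2 := rfl
      rw [e1, e2, hp4, hp4]
      have hg : 0 ≤ G n m := by simp only [hG]; positivity
      change _ ≤ 1 / 2 * ((p m ^ 4)⁻¹ * G n m) + 1 / 2 * ((p (k - m) ^ 4)⁻¹ * G n m)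
      have h3 := mul_nonneg (sq_nonneg ((p m)⁻¹ ^ 2 - (p (k - m))⁻¹ ^ 2)) hg
      rw [mul_inv, ← inv_pow, ← inv_pow]
      nlinarith
    rw [Finset.sum_add_distrib, ← Finset.mul_sum, ← Finset.mul_sum] at this
    linarith

lemma qp_conv {ν : ℕ} (S P : Finset (Fin ν → ℤ)) (β : (Fin ν → ℤ) → ℝ) (hβ : ∀ n, 0 ≤ β n)
    (h0 : ∀ n, n ∉ S → β n = 0) :
    ∑ k ∈ P, ∑ n ∈ S, β n * β (k - n) ≤ (∑ n ∈ S, β n) ^ 2 := by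
  classical
  rw [Finset.sum_comm, sq, Finset.sum_mul]
  refine Finset.sum_le_sum (fun n _ => ?_)
  rw [← Finset.mul_sum]
  apply mul_le_mul_of_nonneg_left _ (hβ n)
  have e : ∑ k ∈ P, β (k - n) = ∑ m ∈ P.image (fun k => k - n), β m := by
    rw [Finset.sum_image (by intro a _ b _ h; simpa using h)]
  rw [e]
  calc _ = ∑ m ∈ (P.image (fun k => k - n)).filter (fun m => m ∈ S), β m := by
        symm
        apply Finset.sum_filter_of_ne
        intro m _ hne
        by_contra hm
        exact hne (h0 m hm)
    _ ≤ _ := by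
        apply Finset.sum_le_sum_of_subset_of_nonneg
        · intro m hm; exact (Finset.mem_filter.1 hm).2
        · intros; exact hβ _

open scoped Pointwise in
lemma qp_square {ν : ℕ} (ω : Fin ν → ℝ) (S : Finset (Fin ν → ℤ)) (a : (Fin ν → ℤ) → ℂ)
    (h0 : ∀ n, n ∉ S → a n = 0) (t x : ℝ) :
    (∑ n ∈ S, a n * Complex.exp (Complex.I * ((freqQP ω n * x - t * freqQP ω n ^ 2 : ℝ) : ℂ))) ^ 2 =
    ∑ k ∈ S + S, (∑ n ∈ S, a n * a (k - n) *
        Complex.exp (Complex.I * ((-(t * (freqQP ω n ^ 2 + freqQP ω (k - n) ^ 2)) : ℝ) : ℂ))) *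
      Complex.exp (Complex.I * ((freqQP ω k * x : ℝ) : ℂ)) := by
  classical
  set E : (Fin ν → ℤ) → ℂ := fun n => a n * Complex.exp (Complex.I * ((freqQP ω n * x - t * freqQP ω n ^ 2 : ℝ) : ℂ)) with hE
  have h1 : ∀ k, (∑ n ∈ S, a n * a (k - n) *
        Complex.exp (Complex.I * ((-(t * (freqQP ω n ^ 2 + freqQP ω (k - n) ^ 2)) : ℝ) : ℂ))) *
      Complex.exp (Complex.I * ((freqQP ω k * x : ℝ) : ℂ)) = ∑ n ∈ S, E n * E (k - n) := by
    intro k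
    rw [Finset.sum_mul]
    refine Finset.sum_congr rfl (fun n _ => ?_)
    simp only [hE]
    have : Complex.exp (Complex.I * ((-(t * (freqQP ω n ^ 2 + freqQP ω (k - n) ^ 2)) : ℝ) : ℂ)) *
        Complex.exp (Complex.I * ((freqQP ω k * x : ℝ) : ℂ)) =
        Complex.exp (Complex.I * ((freqQP ω n * x - t * freqQP ω n ^ 2 : ℝ) : ℂ)) *
        Complex.exp (Complex.I * ((freqQP ω (k - n) * x - t * freqQP ω (k - n) ^ 2 : ℝ) : ℂ)) := by
      rw [← Complex.exp_add, ← Complex.exp_add]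
      congr 1
      rw [freqQP_sub]
      push_cast; ring
    rw [mul_assoc, this]; ring
  simp_rw [h1]
  rw [Finset.sum_comm, sq, Finset.sum_mul]
  refine Finset.sum_congr rfl (fun n hn => ?_)
  rw [← Finset.mul_sum]
  congr 1
  have hE0 : ∀ n, n ∉ S → E n = 0 := fun n hn => by simp only [hE]; rw [h0 n hn, zero_mul]
  have e : ∑ k ∈ S + S, E (k - n) = ∑ m ∈ (S + S).image (fun k => k - n), E m := by
    rw [Finset.sum_image (by intro a _ b _ h; simpa using h)]
  rw [e]
  apply Finset.sum_subset
  · intro m hm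
    exact Finset.mem_image.2 ⟨m + n, Finset.add_mem_add hm hn, by simp⟩
  · intro m _ hm; exact hE0 m hm

lemma qp_square_exists {ν : ℕ} (ω : Fin ν → ℝ) (S : Finset (Fin ν → ℤ)) (a : (Fin ν → ℤ) → ℂ)
    (h0 : ∀ n, n ∉ S → a n = 0) : ∃ P : Finset (Fin ν → ℤ), ∀ t x : ℝ,
    (∑ n ∈ S, a n * Complex.exp (Complex.I * ((freqQP ω n * x - t * freqQP ω n ^ 2 : ℝ) : ℂ))) ^ 2 =
    ∑ k ∈ P, (∑ n ∈ S, a n * a (k - n) *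
        Complex.exp (Complex.I * ((-(t * (freqQP ω n ^ 2 + freqQP ω (k - n) ^ 2)) : ℝ) : ℂ))) *
      Complex.exp (Complex.I * ((freqQP ω k * x : ℝ) : ℂ)) :=
  ⟨_, fun t x => qp_square ω S a h0 t x⟩

/-- Fixed-time `L⁴` Strichartz estimate for the Schrödinger evolution of
quasi-periodic data (Theorem 1.1, estimate (1.6)). -/
theorem fixed_time_L4_strichartz_schrodinger
    (ν : ℕ) (hν : 1 ≤ ν) (ω : Fin ν → ℝ)
    (hpos : ∀ i, 0 < ω i)
    (hnr : ∀ n : Fin ν → ℤ, freqQP ω n = 0 → n = 0)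
    (s : ℝ) (hs : ((ν : ℝ) - 1) / 4 < s) :
    ∃ K : ℝ, 0 < K ∧ ∀ T : ℝ, T ∈ Set.Ioc (0 : ℝ) 1 →
      ∀ a : (Fin ν → ℤ) → ℂ, (Function.support a).Finite →
      limsup (fun L : ℝ =>
          (1 / (2 * L)) * ∫ t in Set.Icc (0 : ℝ) T, ∫ x in Set.Icc (-L) L,
            ‖∑' n : Fin ν → ℤ, a n *
              Complex.exp (Complex.I *
                ((freqQP ω n * x - t * freqQP ω n ^ 2 : ℝ) : ℂ))‖ ^ 4) atTop
        ≤ K ^ 4 * T ^ ((1 : ℝ) / 2) *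
            (∑' n : Fin ν → ℤ, (1 + heightQP n) ^ (2 * s) * ‖a n‖ ^ 2) ^ 2 := by
  classical
  obtain ⟨d, rfl⟩ : ∃ d, ν = d + 1 := ⟨ν - 1, by omega⟩
  obtain ⟨C, hC, hw⟩ := qp_weighted d ω (hpos 0) s (by push_cast at hs; linarith)
  set Q := Real.exp 1 * Real.sqrt Real.pi * C with hQ
  have hQ0 : 0 < Q := by positivity
  refine ⟨Q ^ ((1 : ℝ) / 4), by positivity, fun T hT a ha => ?_⟩
  have hK : (Q ^ ((1 : ℝ) / 4)) ^ 4 = Q := by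
    rw [← Real.rpow_mul_natCast hQ0.le]; norm_num
  rw [hK, ← Real.sqrt_eq_rpow]
  set θ := Real.sqrt T with hθ
  have hθ0 : 0 < θ := Real.sqrt_pos.2 hT.1
  have hθ1 : θ ≤ 1 := by rw [hθ]; exact Real.sqrt_le_one.2 hT.2
  have hTθ : T = θ ^ 2 := (Real.sq_sqrt hT.1.le).symm
  set S : Finset (Fin (d + 1) → ℤ) := ha.toFinset with hS
  have h0 : ∀ n, n ∉ S → a n = 0 := fun n hn => by simpa [hS] using hn
  obtain ⟨P, hP⟩ := qp_square_exists ω S a h0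
  have hts : ∀ t x : ℝ, ∑' n : Fin (d + 1) → ℤ, a n * Complex.exp (Complex.I *
                ((freqQP ω n * x - t * freqQP ω n ^ 2 : ℝ) : ℂ)) =
      ∑ n ∈ S, a n * Complex.exp (Complex.I * ((freqQP ω n * x - t * freqQP ω n ^ 2 : ℝ) : ℂ)) :=
    fun t x => tsum_eq_sum (fun n hn => by rw [h0 n hn, zero_mul])
  have hts2 : ∑' n : Fin (d + 1) → ℤ, (1 + heightQP n) ^ (2 * s) * ‖a n‖ ^ 2 =
      ∑ n ∈ S, (1 + heightQP n) ^ (2 * s) * ‖a n‖ ^ 2 :=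
    tsum_eq_sum (fun n hn => by rw [h0 n hn]; simp)
  have hsq : ∀ t x : ℝ, ‖∑' n : Fin (d + 1) → ℤ, a n * Complex.exp (Complex.I *
                ((freqQP ω n * x - t * freqQP ω n ^ 2 : ℝ) : ℂ))‖ ^ 4 =
      ‖∑ k ∈ P, (∑ n ∈ S, a n * a (k - n) *
        Complex.exp (Complex.I * ((-(t * (freqQP ω n ^ 2 + freqQP ω (k - n) ^ 2)) : ℝ) : ℂ))) *
      Complex.exp (Complex.I * ((freqQP ω k * x : ℝ) : ℂ))‖ ^ 2 := by
    intro t x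
    rw [hts, ← hP t x, norm_pow]; ring
  simp_rw [hsq]
  rw [hts2]
  have hlim := qp_limit P (freqQP ω)
    (fun k _ l _ h => sub_eq_zero.1 (hnr _ (by rw [freqQP_sub]; exact h)))
    (fun k t => ∑ n ∈ S, a n * a (k - n) *
        Complex.exp (Complex.I * ((-(t * (freqQP ω n ^ 2 + freqQP ω (k - n) ^ 2)) : ℝ) : ℂ)))
    (fun k => by fun_prop) T
  rw [hlim.limsup_eq]
  have hpos' : ∀ n : Fin (d + 1) → ℤ, 0 ≤ (1 + heightQP n) ^ (2 * s) * ‖a n‖ ^ 2 := by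
    intro n
    have := heightQP_nonneg n
    positivity
  have hconv := qp_conv S P (fun n => (1 + heightQP n) ^ (2 * s) * ‖a n‖ ^ 2) hpos'
    (fun n hn => by simp [h0 n hn])
  calc _ ≤ ∑ k ∈ P, Real.exp 1 * (θ ^ 2 * Real.sqrt Real.pi) * ((C / θ) *
        ∑ n ∈ S, ((1 + heightQP n) ^ (2 * s) * ‖a n‖ ^ 2) *
          ((1 + heightQP (k - n)) ^ (2 * s) * ‖a (k - n)‖ ^ 2)) := by
        refine Finset.sum_le_sum (fun k _ => ?_)
        rw [hTθ]
        exact qp_block ω s C θ hθ0 (hw θ hθ0 hθ1) S a k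
    _ = Q * θ * ∑ k ∈ P, ∑ n ∈ S, ((1 + heightQP n) ^ (2 * s) * ‖a n‖ ^ 2) *
          ((1 + heightQP (k - n)) ^ (2 * s) * ‖a (k - n)‖ ^ 2) := by
        rw [Finset.mul_sum]
        refine Finset.sum_congr rfl (fun k _ => ?_)
        rw [hQ]; field_simp
    _ ≤ _ := mul_le_mul_of_nonneg_left hconv (by positivity)
end

section
/- Let ν ∈ ℕ, let ω ∈ ℝ^ν be non-resonant, and let b = ν − 1. There exists a constant K = K(ω) > 0 such that for every T ∈ (0,1], every C ≥ 1, every N with 1 ≤ N ≤ C, and every a : ℤ^ν → ℂ finitely supported in {n ∈ ℤ^ν : |n| ≤ C and N/2 ≤ |⟨n⟩_ω| ≤ 2N}, one has limsup_{L→∞} (1/(2L)) ∫_0^T ∫_{−L}^{L} | ∑_{n ∈ ℤ^ν} a_n e^{i(⟨n⟩_ω x + t ⟨n⟩_ω³)} |^4 dx dt ≤ K^4 · T · (1 + T^{−1/2} N^{−1/2}) · C^{b} · ( ∑_{n ∈ ℤ^ν} |a_n|^2 )^2. (Fixed-time L^4 Strichartz estimate for the Airy evolution of quasi-periodic data localized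 in frequency size N and height C, Theorem 1.1, estimate (1.7).) -/
open MeasureTheory Filter

theorem aux_count {k : ℕ} (ω : Fin (k+1) → ℝ) (h0 : 0 < ω 0) (C : ℝ) (hC : 1 ≤ C)
    (S : Finset (Fin (k+1) → ℤ)) (hS : ∀ n ∈ S, ∀ i, |(n i : ℝ)| ≤ C) (y l : ℝ) (hl : 0 ≤ l)
    (hy : ∀ n ∈ S, y ≤ ∑ i, (n i : ℝ) * ω i ∧ ∑ i, (n i : ℝ) * ω i ≤ y + l) :
    (S.card : ℝ) ≤ (l / ω 0 + 1) * (3 * C) ^ k := by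
  classical
  let Q : Finset (Fin k → ℤ) := Fintype.piFinset (fun _ => Finset.Icc (-⌊C⌋) ⌊C⌋)
  have h1 : S.card ≤ (⌊l / ω 0⌋₊ + 1) * Q.card := by
    apply Finset.card_le_mul_card_image_of_maps_to (f := fun n => Fin.tail n)
    · intro n hn
      simp only [Q, Fintype.mem_piFinset, Finset.mem_Icc]
      intro i
      have := abs_le.1 (hS n hn i.succ)
      simp only [Fin.tail]
      constructor
      · rw [neg_le]; apply Int.le_floor.2; push_cast; linarith
      · exact Int.le_floor.2 this.2
    · intro m _
      -- fiber
      set z := ∑ i, (m i : ℝ) * ω i.succ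
      have : ((S.filter (fun n => Fin.tail n = m)).card) ≤
          (Finset.Icc (⌈(y - z) / ω 0⌉) (⌊(y - z) / ω 0 + l / ω 0⌋)).card := by
        apply Finset.card_le_card_of_injOn (fun n => n 0)
        · intro n hn
          simp only [Finset.coe_filter, Set.mem_ofPred_eq] at hn
          obtain ⟨hn, hm⟩ := hn
          have := hy n hn
          rw [Fin.sum_univ_succ] at this
          have hz : ∑ i : Fin k, (n i.succ : ℝ) * ω i.succ = z := by
            simp only [z, ← hm, Fin.tail]
          rw [hz] at this
          simp only [Finset.coe_Icc, Set.mem_Icc]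
          constructor
          · apply Int.ceil_le.2
            rw [div_le_iff₀ h0]; linarith
          · apply Int.le_floor.2
            rw [← add_div, le_div_iff₀ h0]; linarith
        · intro n hn n' hn' h
          simp only [Finset.coe_filter, Set.mem_ofPred_eq] at hn hn'
          rw [← Fin.cons_self_tail n, ← Fin.cons_self_tail n', hn.2, hn'.2]
          simp only at h
          rw [h]
      refine this.trans ?_
      rw [Int.card_Icc]
      have h2 : ⌊(y - z) / ω 0 + l / ω 0⌋ ≤ ⌈(y - z) / ω 0⌉ + ⌊l / ω 0⌋ := by
        rw [← Int.floor_intCast_add]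
        apply Int.floor_le_floor
        gcongr
        exact Int.le_ceil _
      have h3 : (⌊l / ω 0⌋₊ : ℤ) = ⌊l / ω 0⌋ := Int.natCast_floor_eq_floor (by positivity)
      omega
  have h2 : (Q.card : ℝ) ≤ (3 * C) ^ k := by
    simp only [Q, Fintype.card_piFinset, Int.card_Icc, Finset.prod_const, Finset.card_univ, Fintype.card_fin]
    push_cast
    have hf : (0:ℤ) ≤ ⌊C⌋ := Int.floor_nonneg.2 (by linarith)
    have : (((⌊C⌋ + 1 - -⌊C⌋).toNat : ℕ) : ℝ) = 2 * ⌊C⌋ + 1 := by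
      have : (((⌊C⌋ + 1 - -⌊C⌋).toNat : ℕ) : ℤ) = 2 * ⌊C⌋ + 1 := by omega
      exact_mod_cast this
    rw [this]
    have hff : (0:ℝ) ≤ ⌊C⌋ := by exact_mod_cast hf
    gcongr
    linarith [Int.floor_le C]
  have h3 : ((⌊l / ω 0⌋₊ : ℕ) : ℝ) ≤ l / ω 0 := Nat.floor_le (by positivity)
  calc (S.card : ℝ) ≤ ((⌊l / ω 0⌋₊ : ℝ) + 1) * Q.card := by exact_mod_cast h1
    _ ≤ _ := by gcongr

theorem aux_gauss (T : ℝ) (hT : 0 < T) (ξ : ℝ) :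
    ‖∫ t : ℝ, (Real.exp (1 - t^2/T^2) : ℂ) * Complex.exp (Complex.I * ((t * ξ : ℝ):ℂ))‖
      = Real.exp 1 * Real.sqrt Real.pi * T * Real.exp (-(T * ξ)^2/4) := by
  have hb : 0 < ((1/T^2 : ℝ) : ℂ).re := by rw [Complex.ofReal_re]; positivity
  have := fourierIntegral_gaussian hb (ξ:ℂ)
  have e1 : ∀ t : ℝ, (Real.exp (1 - t^2/T^2) : ℂ) * Complex.exp (Complex.I * ((t * ξ : ℝ):ℂ))
     = Complex.exp 1 * (Complex.exp (Complex.I * ξ * t) * Complex.exp (- ((1/T^2 : ℝ) : ℂ) * t^2)) := by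
    intro t
    push_cast
    rw [← Complex.exp_add, ← Complex.exp_add, ← Complex.exp_add]
    congr 1
    ring
  simp_rw [e1]
  rw [integral_const_mul, this]
  have e2 : (Real.pi : ℂ) / ((1/T^2 : ℝ) : ℂ) = ((Real.pi * T^2 : ℝ) : ℂ) := by
    push_cast
    field_simp
  have e3 : ((Real.pi * T^2 : ℝ) : ℂ) ^ (1/2 : ℂ) = ((Real.sqrt Real.pi * T : ℝ) : ℂ) := by
    have : Real.sqrt Real.pi * T = (Real.pi * T^2) ^ (1/2 : ℝ) := by
      rw [← Real.sqrt_eq_rpow, Real.sqrt_mul Real.pi_pos.le, Real.sqrt_sq hT.le]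
    rw [this, Complex.ofReal_cpow (by positivity)]
    norm_num
  have e4 : Complex.exp (-(ξ:ℂ)^2 / (4 * ((1/T^2 : ℝ) : ℂ))) = ((Real.exp (-(T * ξ)^2/4) : ℝ) : ℂ) := by
    push_cast
    congr 1
    field_simp
  rw [e2, e3, e4, show Complex.exp 1 = ((Real.exp 1 : ℝ) : ℂ) by push_cast; rfl, ← Complex.ofReal_mul,
    ← Complex.ofReal_mul, Complex.norm_real, Real.norm_of_nonneg (by positivity)]
  ring

theorem aux_gauss_int (T : ℝ) (hT : 0 < T) (ξ : ℝ) :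
    Integrable (fun t : ℝ => (Real.exp (1 - t^2/T^2) : ℂ) * Complex.exp (Complex.I * ((t * ξ : ℝ):ℂ))) := by
  have h := (integrable_exp_neg_mul_sq (b := 1/T^2) (by positivity)).const_mul (Real.exp 1)
  refine h.mono' ?_ ?_
  · apply Continuous.aestronglyMeasurable
    fun_prop
  · refine Eventually.of_forall fun t => ?_
    rw [norm_mul, Complex.norm_real, mul_comm Complex.I, Complex.norm_exp_ofReal_mul_I, mul_one,
      Real.norm_of_nonneg (by positivity), ← Real.exp_add]
    apply le_of_eq; congr 1; ring

theorem aux_energy {κ : Type*} (P : Finset κ) (A : κ → ℂ) (μ φ : κ → ℝ) (T : ℝ) (hT : 0 < T) (L : ℝ) :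
    ∫ t in Set.Icc (0:ℝ) T, ∫ x in Set.Icc (-L) L,
      ‖∑ p ∈ P, A p * Complex.exp (Complex.I * ((μ p * x + t * φ p : ℝ) : ℂ))‖ ^ 2 ≤
    ∑ p ∈ P, ∑ q ∈ P, ‖A p‖ * ‖A q‖ *
      ‖∫ x in Set.Icc (-L) L, Complex.exp (Complex.I * (((μ p - μ q) * x : ℝ) : ℂ))‖ *
      (Real.exp 1 * Real.sqrt Real.pi * T * Real.exp (-(T * (φ p - φ q))^2/4)) := by
  set D : ℝ → ℂ := fun m => ∫ x in Set.Icc (-L) L, Complex.exp (Complex.I * ((m * x : ℝ) : ℂ)) with hD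
  set J : ℝ → ℝ := fun t => ∫ x in Set.Icc (-L) L,
      ‖∑ p ∈ P, A p * Complex.exp (Complex.I * ((μ p * x + t * φ p : ℝ) : ℂ))‖ ^ 2 with hJ
  have hsq : ∀ t x : ℝ, ((‖∑ p ∈ P, A p * Complex.exp (Complex.I * ((μ p * x + t * φ p : ℝ) : ℂ))‖ ^ 2 : ℝ) : ℂ)
     = ∑ p ∈ P, ∑ q ∈ P, (A p * (starRingEnd ℂ) (A q) * Complex.exp (Complex.I * ((t * (φ p - φ q) : ℝ):ℂ))) *
        Complex.exp (Complex.I * (((μ p - μ q) * x : ℝ) : ℂ)) := by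
    intro t x
    rw [Complex.ofReal_pow, ← Complex.mul_conj', map_sum, Finset.sum_mul_sum]
    refine Finset.sum_congr rfl fun p _ => Finset.sum_congr rfl fun q _ => ?_
    rw [map_mul, ← Complex.exp_conj, map_mul, Complex.conj_I, Complex.conj_ofReal]
    rw [mul_mul_mul_comm, ← Complex.exp_add, mul_assoc (A p * _), ← Complex.exp_add]
    congr 2
    push_cast; ring
  have hJc : ∀ t, (J t : ℂ) = ∑ p ∈ P, ∑ q ∈ P,
      (A p * (starRingEnd ℂ) (A q) * D (μ p - μ q)) * Complex.exp (Complex.I * ((t * (φ p - φ q) : ℝ):ℂ)) := by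
    intro t
    rw [hJ]
    simp only
    rw [← integral_complex_ofReal]
    simp_rw [hsq]
    have hi : ∀ p q, IntegrableOn (fun x : ℝ => (A p * (starRingEnd ℂ) (A q) * Complex.exp (Complex.I * ((t * (φ p - φ q) : ℝ):ℂ))) *
        Complex.exp (Complex.I * (((μ p - μ q) * x : ℝ) : ℂ))) (Set.Icc (-L) L) := by
      intro p q
      apply Continuous.integrableOn_Icc
      fun_prop
    rw [integral_finsetSum _ (fun p _ => integrable_finsetSum _ fun q _ => hi p q)]
    refine Finset.sum_congr rfl fun p _ => ?_
    rw [integral_finsetSum _ (fun q _ => hi p q)]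
    refine Finset.sum_congr rfl fun q _ => ?_
    rw [integral_const_mul]
    simp only [hD]
    ring
  have hJ0 : ∀ t, 0 ≤ J t := fun t => integral_nonneg fun x => by positivity
  have hprod : ∀ t, ((Real.exp (1 - t^2/T^2) * J t : ℝ) : ℂ) = ∑ p ∈ P, ∑ q ∈ P,
      (A p * (starRingEnd ℂ) (A q) * D (μ p - μ q)) *
       ((Real.exp (1 - t^2/T^2) : ℂ) * Complex.exp (Complex.I * ((t * (φ p - φ q) : ℝ):ℂ))) := by
    intro t
    rw [Complex.ofReal_mul, hJc, Finset.mul_sum]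
    refine Finset.sum_congr rfl fun p _ => ?_
    rw [Finset.mul_sum]
    refine Finset.sum_congr rfl fun q _ => ?_
    ring
  have hii : ∀ p q, Integrable (fun t : ℝ => (A p * (starRingEnd ℂ) (A q) * D (μ p - μ q)) *
       ((Real.exp (1 - t^2/T^2) : ℂ) * Complex.exp (Complex.I * ((t * (φ p - φ q) : ℝ):ℂ)))) :=
    fun p q => (aux_gauss_int T hT _).const_mul _
  have hint : Integrable (fun t => ((Real.exp (1 - t^2/T^2) * J t : ℝ) : ℂ)) := by
    simp_rw [hprod]
    exact integrable_finsetSum _ fun p _ => integrable_finsetSum _ fun q _ => hii p q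
  have hintR : Integrable (fun t => Real.exp (1 - t^2/T^2) * J t) := by
    exact hint.re
  have hJcont : Continuous J := by
    have : J = fun t => (∑ p ∈ P, ∑ q ∈ P,
      (A p * (starRingEnd ℂ) (A q) * D (μ p - μ q)) * Complex.exp (Complex.I * ((t * (φ p - φ q) : ℝ):ℂ))).re := by
      ext t
      rw [← hJc, Complex.ofReal_re]
    rw [this]
    fun_prop
  have step1 : ∫ t in Set.Icc (0:ℝ) T, J t ≤ ∫ t, Real.exp (1 - t^2/T^2) * J t := by
    refine le_trans (setIntegral_mono_on hJcont.integrableOn_Icc hintR.integrableOn measurableSet_Icc ?_)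
      (setIntegral_le_integral hintR (Eventually.of_forall fun t => by have := hJ0 t; positivity))
    intro t ht
    have : 1 ≤ Real.exp (1 - t^2/T^2) := by
      apply Real.one_le_exp
      rw [sub_nonneg, div_le_one (by positivity)]
      exact pow_le_pow_left₀ ht.1 ht.2 2
    nlinarith [hJ0 t]
  refine step1.trans ?_
  have : ((∫ t, Real.exp (1 - t^2/T^2) * J t : ℝ) : ℂ) = ∑ p ∈ P, ∑ q ∈ P,
      (A p * (starRingEnd ℂ) (A q) * D (μ p - μ q)) *
       ∫ t : ℝ, ((Real.exp (1 - t^2/T^2) : ℂ) * Complex.exp (Complex.I * ((t * (φ p - φ q) : ℝ):ℂ))) := by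
    rw [← integral_complex_ofReal]
    simp_rw [hprod]
    rw [integral_finsetSum _ (fun p _ => integrable_finsetSum _ fun q _ => hii p q)]
    refine Finset.sum_congr rfl fun p _ => ?_
    rw [integral_finsetSum _ (fun q _ => hii p q)]
    refine Finset.sum_congr rfl fun q _ => ?_
    rw [integral_const_mul]
  calc (∫ t, Real.exp (1 - t^2/T^2) * J t) ≤ ‖((∫ t, Real.exp (1 - t^2/T^2) * J t : ℝ) : ℂ)‖ := by
        rw [Complex.norm_real]; exact le_abs_self _
    _ ≤ _ := by
      rw [this]
      refine (norm_sum_le _ _).trans (Finset.sum_le_sum fun p _ => (norm_sum_le _ _).trans (Finset.sum_le_sum fun q _ => ?_))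
      rw [norm_mul, aux_gauss T hT, norm_mul, norm_mul, RCLike.norm_conj]

theorem aux_D (m : ℝ) : Tendsto (fun L : ℝ => 1 / (2 * L) *
    ‖∫ x in Set.Icc (-L) L, Complex.exp (Complex.I * ((m * x : ℝ) : ℂ))‖) atTop
    (nhds (if m = 0 then 1 else 0)) := by
  split_ifs with h
  · apply tendsto_const_nhds.congr'
    filter_upwards [eventually_gt_atTop 0] with L hL
    simp [h]
    rw [max_eq_left (by linarith)]
    field_simp; norm_num
    exact (abs_of_pos hL).symm
  · have : Tendsto (fun L : ℝ => (1 / |m|) * L⁻¹) atTop (nhds 0) := by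
      simpa using tendsto_inv_atTop_zero.const_mul (1/|m|)
    refine tendsto_of_tendsto_of_tendsto_of_le_of_le' tendsto_const_nhds this ?_ ?_
    · filter_upwards [eventually_gt_atTop 0] with L hL
      positivity
    · filter_upwards [eventually_gt_atTop 0] with L hL
      have hc : (Complex.I * m) ≠ 0 := by simp [h]
      have : ∫ x in Set.Icc (-L) L, Complex.exp (Complex.I * ((m * x : ℝ) : ℂ)) =
         (Complex.exp (Complex.I * m * L) - Complex.exp (Complex.I * m * (-L : ℝ))) / (Complex.I * m) := by
        rw [integral_Icc_eq_integral_Ioc, ← intervalIntegral.integral_of_le (by linarith),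
          ← integral_exp_mul_complex hc]
        congr 1; ext x; push_cast; ring_nf
      rw [this, norm_div]
      have h1 : ∀ y : ℝ, ‖Complex.exp (Complex.I * m * y)‖ = 1 := by
        intro y
        rw [show Complex.I * m * y = ((m * y : ℝ) : ℂ) * Complex.I by push_cast; ring, Complex.norm_exp_ofReal_mul_I]
      have h2 : ‖Complex.exp (Complex.I * m * L) - Complex.exp (Complex.I * m * (-L : ℝ))‖ ≤ 2 := by
        refine (norm_sub_le _ _).trans ?_
        rw [h1, h1]; norm_num
      have h3 : ‖Complex.I * m‖ = |m| := by simp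
      rw [h3]
      have hm : 0 < |m| := abs_pos.2 h
      calc _ ≤ 1 / (2 * L) * (2 / |m|) := by gcongr
        _ = _ := by field_simp

theorem aux_two {ι : Type*} (S : Finset ι) (u : ι → ℝ) (M : ℝ) (s : ℝ) (hs : 0 ≤ s)
    (hc : ∀ y, ((S.filter (fun n => y ≤ u n ∧ u n ≤ y + s)).card : ℝ) ≤ M) (α δ : ℝ) (hδ : δ ≤ s ^ 2) :
    ((S.filter (fun n => α ≤ u n ^ 2 ∧ u n ^ 2 ≤ α + δ)).card : ℝ) ≤ 2 * M := by
  classical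
  have hsub : S.filter (fun n => α ≤ u n ^ 2 ∧ u n ^ 2 ≤ α + δ) ⊆
      S.filter (fun n => √α ≤ u n ∧ u n ≤ √α + s) ∪
      S.filter (fun n => -√α - s ≤ u n ∧ u n ≤ (-√α - s) + s) := by
    intro n hn
    simp only [Finset.mem_filter, Finset.mem_union] at hn ⊢
    obtain ⟨hn, h1, h2⟩ := hn
    have k1 : √α ≤ |u n| := by
      rw [← Real.sqrt_sq_eq_abs]; exact Real.sqrt_le_sqrt h1
    have k2 : |u n| ≤ √α + s := by
      apply abs_le_of_sq_le_sq ?_ (by positivity)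
      have : α ≤ √α ^ 2 := by
        rcases le_total 0 α with h | h
        · rw [Real.sq_sqrt h]
        · exact h.trans (sq_nonneg _)
      nlinarith [mul_nonneg (Real.sqrt_nonneg α) hs]
    rcases le_total 0 (u n) with h | h
    · rw [abs_of_nonneg h] at k1 k2
      exact Or.inl ⟨hn, k1, k2⟩
    · rw [abs_of_nonpos h] at k1 k2
      exact Or.inr ⟨hn, by linarith, by linarith⟩
  have h1 := (Finset.card_le_card hsub).trans (Finset.card_union_le _ _)
  have h2 : ((S.filter (fun n => α ≤ u n ^ 2 ∧ u n ^ 2 ≤ α + δ)).card : ℝ) ≤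
     (S.filter (fun n => √α ≤ u n ∧ u n ≤ √α + s)).card +
      (S.filter (fun n => -√α - s ≤ u n ∧ u n ≤ (-√α - s) + s)).card := by exact_mod_cast h1
  linarith [hc (√α), hc (-√α - s)]

theorem aux_layer {ι : Type*} (S : Finset ι) (u : ι → ℝ) (M : ℝ) (s : ℝ) (hs : 0 ≤ s)
    (hc : ∀ y, ((S.filter (fun n => y ≤ u n ∧ u n ≤ y + s)).card : ℝ) ≤ M) (β c : ℝ) (hβ : 0 < β)
    (hβs : 1 ≤ β * s ^ 2) :
    ∑ n ∈ S, Real.exp (-(β * (u n ^ 2 - c)) ^ 2 / 4) ≤ 8 * Real.exp 1 * M := by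
  classical
  have hM : 0 ≤ M := le_trans (by positivity) (hc 0)
  set v : ι → ℝ := fun n => β * (u n ^ 2 - c) with hv
  have hδ : 1 / β ≤ s ^ 2 := by rw [div_le_iff₀ hβ]; linarith
  have hk : ∀ k : ℕ, ((S.filter (fun n => ⌊|v n|⌋₊ = k)).card : ℝ) ≤ 4 * M := by
    intro k
    have hsub : S.filter (fun n => ⌊|v n|⌋₊ = k) ⊆
        S.filter (fun n => c + k / β ≤ u n ^ 2 ∧ u n ^ 2 ≤ (c + k / β) + 1 / β) ∪
        S.filter (fun n => c - (k + 1) / β ≤ u n ^ 2 ∧ u n ^ 2 ≤ (c - (k + 1) / β) + 1 / β) := by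
      intro n hn
      simp only [Finset.mem_filter, Finset.mem_union] at hn ⊢
      obtain ⟨hn, h1⟩ := hn
      rw [Nat.floor_eq_iff (abs_nonneg _)] at h1
      have e : u n ^ 2 = c + v n / β := by simp only [hv]; field_simp; ring
      rcases le_total 0 (v n) with h | h
      · rw [abs_of_nonneg h] at h1
        refine Or.inl ⟨hn, ?_, ?_⟩
        · rw [e]; gcongr; exact h1.1
        · rw [e, add_assoc, ← add_div]; gcongr; exact h1.2.le
      · rw [abs_of_nonpos h] at h1
        refine Or.inr ⟨hn, ?_, ?_⟩
        · rw [e, sub_eq_add_neg, ← neg_div]; gcongr; linarith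
        · rw [e, show c - (k + 1) / β + 1 / β = c + (-k : ℝ) / β by ring]; gcongr; linarith
    have h1 := (Finset.card_le_card hsub).trans (Finset.card_union_le _ _)
    have h2 : ((S.filter (fun n => ⌊|v n|⌋₊ = k)).card : ℝ) ≤
        (S.filter (fun n => c + k / β ≤ u n ^ 2 ∧ u n ^ 2 ≤ (c + k / β) + 1 / β)).card +
        (S.filter (fun n => c - (k + 1) / β ≤ u n ^ 2 ∧ u n ^ 2 ≤ (c - (k + 1) / β) + 1 / β)).card := by
      exact_mod_cast h1
    linarith [aux_two S u M s hs hc (c + k / β) (1 / β) hδ, aux_two S u M s hs hc (c - (k + 1) / β) (1 / β) hδ]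
  have hw : ∀ n, Real.exp (-(v n) ^ 2 / 4) ≤ Real.exp 1 * (1 / 2 : ℝ) ^ ⌊|v n|⌋₊ := by
    intro n
    set k := ⌊|v n|⌋₊
    have h1 : (k : ℝ) ≤ |v n| := Nat.floor_le (abs_nonneg _)
    have h2 : Real.exp (-(v n) ^ 2 / 4) ≤ Real.exp 1 * Real.exp (-(k : ℝ)) := by
      rw [← Real.exp_add]
      apply Real.exp_le_exp.2
      have := sq_abs (v n)
      nlinarith [sq_nonneg (|v n| - 2)]
    have h3 : Real.exp (-(k : ℝ)) ≤ (1 / 2 : ℝ) ^ k := by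
      have : Real.exp (-(k : ℝ)) = (Real.exp (-1)) ^ k := by rw [← Real.exp_nat_mul]; ring_nf
      rw [this]
      gcongr
      rw [Real.exp_neg, one_div]
      apply inv_anti₀ (by norm_num)
      linarith [Real.add_one_le_exp (1 : ℝ)]
    refine h2.trans ?_
    gcongr
  calc ∑ n ∈ S, Real.exp (-(v n) ^ 2 / 4) ≤ ∑ n ∈ S, Real.exp 1 * (1 / 2 : ℝ) ^ ⌊|v n|⌋₊ :=
        Finset.sum_le_sum fun n _ => hw n
    _ = Real.exp 1 * ∑ k ∈ S.image (fun n => ⌊|v n|⌋₊),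
          ((S.filter (fun n => ⌊|v n|⌋₊ = k)).card) • (1 / 2 : ℝ) ^ k := by
        rw [← Finset.mul_sum, Finset.sum_comp (fun k : ℕ => (1 / 2 : ℝ) ^ k)]
    _ ≤ Real.exp 1 * ∑ k ∈ S.image (fun n => ⌊|v n|⌋₊), 4 * M * (1 / 2 : ℝ) ^ k := by
        gcongr with k hk'
        rw [nsmul_eq_mul]
        gcongr
        exact hk k
    _ ≤ Real.exp 1 * (4 * M * 2) := by
        rw [← Finset.mul_sum]
        gcongr
        exact (summable_geometric_two.sum_le_tsum _ (fun _ _ => by positivity)).trans_eq tsum_geometric_two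
    _ = _ := by ring

theorem aux_main {ι : Type*} (S : Finset ι) (lam : ι → ℝ) (hinj : Function.Injective lam) (a : ι → ℂ)
    (T N M l : ℝ) (hT : 0 < T) (hN : 0 < N) (hl : 0 ≤ l) (hl2 : 1 ≤ l ^ 2 * (T * N))
    (hS : ∀ n ∈ S, ∀ n' ∈ S, N ≤ |lam n + lam n'|)
    (hc : ∀ y, ((S.filter (fun n => y ≤ lam n ∧ lam n ≤ y + l)).card : ℝ) ≤ M) :
    ∃ U : ℝ → ℝ, ∃ V : ℝ, Tendsto U atTop (nhds V) ∧
      V ≤ (8 * Real.exp 1 ^ 2 * √Real.pi) * T * M * (∑ n ∈ S, ‖a n‖ ^ 2) ^ 2 ∧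
      ∀ L : ℝ, 0 < L → 1 / (2 * L) * ∫ t in Set.Icc (0 : ℝ) T, ∫ x in Set.Icc (-L) L,
            ‖∑ n ∈ S, a n * Complex.exp (Complex.I * ((lam n * x + t * lam n ^ 3 : ℝ) : ℂ))‖ ^ 4 ≤ U L := by
  classical
  set P := S ×ˢ S with hP
  set A : ι × ι → ℂ := fun p => a p.1 * a p.2 with hA
  set μ : ι × ι → ℝ := fun p => lam p.1 + lam p.2 with hμ
  set φ : ι × ι → ℝ := fun p => lam p.1 ^ 3 + lam p.2 ^ 3 with hφ
  set H : ι × ι → ι × ι → ℝ := fun p q =>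
    Real.exp 1 * Real.sqrt Real.pi * T * Real.exp (-(T * (φ p - φ q))^2/4) with hH
  have hH0 : ∀ p q, 0 ≤ H p q := fun p q => by positivity
  refine ⟨fun L => ∑ p ∈ P, ∑ q ∈ P, ‖A p‖ * ‖A q‖ *
      (1 / (2 * L) * ‖∫ x in Set.Icc (-L) L, Complex.exp (Complex.I * (((μ p - μ q) * x : ℝ) : ℂ))‖) * H p q,
    ∑ p ∈ P, ∑ q ∈ P, ‖A p‖ * ‖A q‖ * (if μ p - μ q = 0 then 1 else 0) * H p q, ?_, ?_, ?_⟩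
  · refine tendsto_finsetSum _ fun p _ => tendsto_finsetSum _ fun q _ => ?_
    exact ((aux_D _).const_mul _).mul_const _
  · set G : ι × ι → ι × ι → ℝ := fun p q => (if μ p - μ q = 0 then 1 else 0) * H p q with hG
    have hG0 : ∀ p q, 0 ≤ G p q := fun p q => by
      simp only [hG]; split_ifs <;> simp [hH0]
    have hGs : ∀ p q, G p q = G q p := by
      intro p q
      simp only [hG, hH]
      rw [show (T * (φ p - φ q)) ^ 2 = (T * (φ q - φ p)) ^ 2 by ring]
      congr 1
      simp only [sub_eq_zero, eq_comm]
    have hrow : ∀ p ∈ P, ∑ q ∈ P, G p q ≤ (8 * Real.exp 1 ^ 2 * √Real.pi) * T * M := by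
      intro p hp
      rw [hP, Finset.mem_product] at hp
      have hm : N ≤ |μ p| := hS _ hp.1 _ hp.2
      set β := T * (3 / 4) * |μ p| with hβ
      have hβ0 : 0 < β := by
        have : 0 < |μ p| := hN.trans_le hm
        positivity
      have key := aux_layer S (fun n => 2 * lam n - μ p) M (2 * l) (by positivity) (by
        intro y
        refine le_trans (le_of_eq ?_) (hc ((y + μ p) / 2))
        congr 2
        apply Finset.filter_congr
        intro n _
        constructor <;> rintro ⟨h1, h2⟩ <;> constructor <;> linarith) β ((lam p.1 - lam p.2) ^ 2) hβ0 (by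
        have : l ^ 2 * (T * N) ≤ l ^ 2 * (T * |μ p|) := by gcongr
        simp only [hβ]
        nlinarith)
      calc ∑ q ∈ P, G p q = ∑ n ∈ S, ∑ n' ∈ S, G p (n, n') := by rw [hP, Finset.sum_product]
        _ ≤ ∑ n ∈ S, (Real.exp 1 * Real.sqrt Real.pi * T) *
              Real.exp (-(β * ((2 * lam n - μ p) ^ 2 - (lam p.1 - lam p.2) ^ 2)) ^ 2 / 4) := by
            refine Finset.sum_le_sum fun n hn => ?_
            by_cases hex : ∃ n' ∈ S, μ p - μ (n, n') = 0
            · obtain ⟨n', hn', h0⟩ := hex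
              rw [Finset.sum_eq_single n']
              · apply le_of_eq
                simp only [hG, if_pos h0, one_mul, hH]
                congr 4
                have hsq : |μ p| ^ 2 = μ p ^ 2 := sq_abs _
                have e2 : lam n' = μ p - lam n := by simp only [hμ] at h0 ⊢; linarith
                have e3 : φ p - φ (n, n') = - (3 / 4) * μ p * ((2 * lam n - μ p) ^ 2 - (lam p.1 - lam p.2) ^ 2) := by
                  simp only [hφ]
                  rw [e2]
                  simp only [hμ]
                  ring
                rw [e3, hβ]
                calc _ = T ^ 2 * (3/4) ^ 2 * (μ p ^ 2) * ((2 * lam n - μ p) ^ 2 - (lam p.1 - lam p.2) ^ 2) ^ 2 := by ring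
                  _ = _ := by rw [← hsq]; ring
              · intro n'' _ hne
                have : μ p - μ (n, n'') ≠ 0 := by
                  intro h
                  apply hne
                  apply hinj
                  simp only [hμ] at h h0
                  linarith
                simp only [hG, if_neg this, zero_mul]
              · exact fun h => absurd hn' h
            · push Not at hex
              rw [Finset.sum_eq_zero]
              · positivity
              · intro n' hn'
                simp only [hG, if_neg (hex n' hn'), zero_mul]
        _ ≤ (Real.exp 1 * Real.sqrt Real.pi * T) * (8 * Real.exp 1 * M) := by
            rw [← Finset.mul_sum]
            gcongr
        _ = _ := by ring
    calc ∑ p ∈ P, ∑ q ∈ P, ‖A p‖ * ‖A q‖ * (if μ p - μ q = 0 then 1 else 0) * H p q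
        ≤ ∑ p ∈ P, ∑ q ∈ P, ((1 / 2) * (‖A p‖ ^ 2 * G p q) + (1 / 2) * (‖A q‖ ^ 2 * G p q)) := by
          refine Finset.sum_le_sum fun p _ => Finset.sum_le_sum fun q _ => ?_
          rw [mul_assoc]
          change ‖A p‖ * ‖A q‖ * G p q ≤ _
          nlinarith [mul_nonneg (sq_nonneg (‖A p‖ - ‖A q‖)) (hG0 p q)]
      _ = ∑ p ∈ P, ‖A p‖ ^ 2 * ∑ q ∈ P, G p q := by
          simp_rw [Finset.sum_add_distrib, ← Finset.mul_sum]
          have : ∑ p ∈ P, ∑ q ∈ P, ‖A q‖ ^ 2 * G p q = ∑ p ∈ P, ‖A p‖ ^ 2 * ∑ q ∈ P, G p q := by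
            rw [Finset.sum_comm]
            refine Finset.sum_congr rfl fun p _ => ?_
            rw [Finset.mul_sum]
            exact Finset.sum_congr rfl fun q _ => by rw [hGs]
          rw [this]; ring
      _ ≤ ∑ p ∈ P, ‖A p‖ ^ 2 * ((8 * Real.exp 1 ^ 2 * √Real.pi) * T * M) := by
          gcongr with p hp
          exact hrow p hp
      _ = _ := by
          rw [← Finset.sum_mul, mul_comm]
          congr 1
          rw [hP, sq, Finset.sum_mul_sum, Finset.sum_product]
          simp only [hA, norm_mul, mul_pow]
  · intro L hL
    have h := aux_energy P A μ φ T hT L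
    have e : ∀ t x : ℝ, ‖∑ n ∈ S, a n * Complex.exp (Complex.I * ((lam n * x + t * lam n ^ 3 : ℝ) : ℂ))‖ ^ 4 =
        ‖∑ p ∈ P, A p * Complex.exp (Complex.I * ((μ p * x + t * φ p : ℝ) : ℂ))‖ ^ 2 := by
      intro t x
      rw [show (4 : ℕ) = 2 * 2 from rfl, pow_mul, ← norm_pow]
      congr 2
      rw [sq, Finset.sum_mul_sum, hP, Finset.sum_product]
      refine Finset.sum_congr rfl fun n _ => Finset.sum_congr rfl fun n' _ => ?_
      rw [mul_mul_mul_comm, ← Complex.exp_add]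
      simp only [hA, hμ, hφ]
      congr 2
      push_cast; ring
    simp_rw [e]
    calc _ ≤ 1 / (2 * L) * _ := mul_le_mul_of_nonneg_left h (by positivity)
      _ = _ := by
        simp_rw [Finset.mul_sum]
        refine Finset.sum_congr rfl fun p _ => Finset.sum_congr rfl fun q _ => ?_
        ring

theorem aux_split {ι : Type*} (S S' : Finset ι) (lam : ι → ℝ) (a : ι → ℂ) (T L : ℝ)
    (f : Finset ι → ℝ → ℝ → ℂ) (hf : f = fun R t x =>
      ∑ n ∈ R, a n * Complex.exp (Complex.I * ((lam n * x + t * lam n ^ 3 : ℝ) : ℂ)))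
    (R : Finset ι) (hR : ∀ t x, f R t x = f S t x + f S' t x) :
    ∫ t in Set.Icc (0 : ℝ) T, ∫ x in Set.Icc (-L) L, ‖f R t x‖ ^ 4 ≤
     8 * (∫ t in Set.Icc (0 : ℝ) T, ∫ x in Set.Icc (-L) L, ‖f S t x‖ ^ 4) +
     8 * (∫ t in Set.Icc (0 : ℝ) T, ∫ x in Set.Icc (-L) L, ‖f S' t x‖ ^ 4) := by
  have hcont : ∀ Q, Continuous (Function.uncurry fun t x => ‖f Q t x‖ ^ 4) := by
    intro Q
    rw [hf]
    simp only [Function.uncurry_def]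
    fun_prop
  have hcx : ∀ Q t, Continuous (fun x => ‖f Q t x‖ ^ 4) := fun Q t =>
    (hcont Q).comp (by fun_prop : Continuous fun x : ℝ => (t, x))
  have hct : ∀ Q, Continuous (fun t => ∫ x in Set.Icc (-L) L, ‖f Q t x‖ ^ 4) := fun Q =>
    continuous_parametric_integral_of_continuous (hcont Q) isCompact_Icc
  rw [← integral_const_mul, ← integral_const_mul, ← integral_add]
  · refine setIntegral_mono_on (hct R).integrableOn_Icc ?_ measurableSet_Icc ?_
    · exact (((hct S).const_mul 8).add ((hct S').const_mul 8)).integrableOn_Icc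
    · intro t _
      rw [← integral_const_mul, ← integral_const_mul, ← integral_add]
      · refine setIntegral_mono_on (hcx R t).integrableOn_Icc ?_ measurableSet_Icc ?_
        · exact (((hcx S t).const_mul 8).add ((hcx S' t).const_mul 8)).integrableOn_Icc
        · intro x _
          rw [hR]
          have h1 : ‖f S t x + f S' t x‖ ^ 4 ≤ (‖f S t x‖ + ‖f S' t x‖) ^ 4 := by
            gcongr; exact norm_add_le _ _
          have h2 := add_pow_le (norm_nonneg (f S t x)) (norm_nonneg (f S' t x)) 4
          norm_num at h2
          linarith
      · exact ((hcx S t).const_mul 8).integrableOn_Icc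
      · exact ((hcx S' t).const_mul 8).integrableOn_Icc
  · exact ((hct S).const_mul 8).integrableOn_Icc
  · exact ((hct S').const_mul 8).integrableOn_Icc

/-- Fixed-time `L⁴` Strichartz estimate for the Airy evolution of quasi-periodic
data localized in frequency size `N` and height `C`
(Theorem 1.1, estimate (1.7)). -/
theorem fixed_time_L4_strichartz_airy
    (ν : ℕ) (hν : 1 ≤ ν) (ω : Fin ν → ℝ)
    (hpos : ∀ i, 0 < ω i)
    (hnr : ∀ n : Fin ν → ℤ, freqQP ω n = 0 → n = 0) :
    ∃ K : ℝ, 0 < K ∧ ∀ T : ℝ, T ∈ Set.Ioc (0 : ℝ) 1 →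
      ∀ C : ℝ, 1 ≤ C → ∀ N : ℝ, 1 ≤ N → N ≤ C →
      ∀ a : (Fin ν → ℤ) → ℂ, (Function.support a).Finite →
      Function.support a ⊆
        {n : Fin ν → ℤ | heightQP n ≤ C ∧
          N / 2 ≤ |freqQP ω n| ∧ |freqQP ω n| ≤ 2 * N} →
      limsup (fun L : ℝ =>
          (1 / (2 * L)) * ∫ t in Set.Icc (0 : ℝ) T, ∫ x in Set.Icc (-L) L,
            ‖∑' n : Fin ν → ℤ, a n *
              Complex.exp (Complex.I *
                ((freqQP ω n * x + t * freqQP ω n ^ 3 : ℝ) : ℂ))‖ ^ 4) atTop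
        ≤ K ^ 4 * T * (1 + T ^ (-(1 : ℝ) / 2) * N ^ (-(1 : ℝ) / 2)) *
            C ^ ((ν : ℝ) - 1) *
            (∑' n : Fin ν → ℤ, ‖a n‖ ^ 2) ^ 2 := by
  classical
  obtain ⟨k, rfl⟩ : ∃ k, ν = k + 1 := ⟨ν - 1, by omega⟩
  have h0 := hpos 0
  set c0 : ℝ := 128 * Real.exp 1 ^ 2 * √Real.pi * (1 / ω 0 + 1) * 3 ^ k with hc0
  have hc0pos : 0 ≤ c0 := by positivity
  have hinj : Function.Injective (freqQP ω) := by
    intro n n' h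
    rw [← sub_eq_zero]
    apply hnr
    simp only [freqQP] at h ⊢
    simp only [Pi.sub_apply, Int.cast_sub, sub_mul, Finset.sum_sub_distrib, h, sub_self]
  refine ⟨1 + c0, by positivity, ?_⟩
  intro T hT C hC N hN hNC a hfin hsupp
  have hT0 : 0 < T := hT.1
  have hN0 : 0 < N := by linarith
  set r : ℝ := T ^ (-(1 : ℝ) / 2) * N ^ (-(1 : ℝ) / 2) with hr
  have hr0 : 0 < r := by positivity
  have hr2 : r ^ 2 * (T * N) = 1 := by
    have e : ∀ y : ℝ, 0 < y → (y ^ (-(1 : ℝ) / 2)) ^ 2 = y⁻¹ := by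
      intro y hy
      rw [← Real.rpow_natCast, ← Real.rpow_mul hy.le]
      norm_num
      exact Real.rpow_neg_one y
    rw [hr, mul_pow, e T hT0, e N hN0]
    field_simp
  set S := hfin.toFinset with hSdef
  have hmem : ∀ n ∈ S, heightQP n ≤ C ∧ N / 2 ≤ |freqQP ω n| ∧ |freqQP ω n| ≤ 2 * N := by
    intro n hn
    exact hsupp (by simpa [hSdef] using hn)
  have hout : ∀ n, n ∉ S → a n = 0 := by
    intro n hn
    simpa [hSdef] using hn
  set f : Finset (Fin (k+1) → ℤ) → ℝ → ℝ → ℂ := fun R t x =>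
      ∑ n ∈ R, a n * Complex.exp (Complex.I * ((freqQP ω n * x + t * freqQP ω n ^ 3 : ℝ) : ℂ)) with hf
  have htsum : ∀ t x : ℝ, ∑' n : Fin (k+1) → ℤ, a n *
              Complex.exp (Complex.I * ((freqQP ω n * x + t * freqQP ω n ^ 3 : ℝ) : ℂ)) = f S t x := by
    intro t x
    exact tsum_eq_sum fun n hn => by rw [hout n hn, zero_mul]
  have htsum2 : ∑' n : Fin (k+1) → ℤ, ‖a n‖ ^ 2 = ∑ n ∈ S, ‖a n‖ ^ 2 :=
    tsum_eq_sum fun n hn => by rw [hout n hn]; simp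
  simp_rw [htsum]
  rw [htsum2]
  set E := ∑ n ∈ S, ‖a n‖ ^ 2 with hE
  set M : ℝ := (r / ω 0 + 1) * (3 * C) ^ k with hM
  have hM0 : 0 ≤ M := by positivity
  have hcount : ∀ R ⊆ S, ∀ y, ((R.filter (fun n => y ≤ freqQP ω n ∧ freqQP ω n ≤ y + r)).card : ℝ) ≤ M := by
    intro R hRS y
    apply aux_count ω h0 C hC _ _ y r hr0.le
    · intro n hn
      exact (Finset.mem_filter.1 hn).2
    · intro n hn i
      refine le_trans ?_ (hmem n (hRS (Finset.mem_filter.1 hn).1)).1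
      rw [heightQP]
      apply Real.abs_le_sqrt
      exact Finset.single_le_sum (f := fun i => (n i : ℝ) ^ 2) (fun i _ => sq_nonneg _) (Finset.mem_univ i)
  obtain ⟨U1, V1, hU1, hV1, hb1⟩ := aux_main (S.filter (fun n => 0 ≤ freqQP ω n)) (freqQP ω) hinj a T N M r hT0 hN0
    hr0.le hr2.ge (by
      intro n hn n' hn'
      rw [Finset.mem_filter] at hn hn'
      have h1 := (hmem n hn.1).2.1
      have h2 := (hmem n' hn'.1).2.1
      rw [abs_of_nonneg hn.2] at h1
      rw [abs_of_nonneg hn'.2] at h2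
      exact le_trans (by linarith) (le_abs_self _)) (hcount _ (Finset.filter_subset _ _))
  obtain ⟨U2, V2, hU2, hV2, hb2⟩ := aux_main (S.filter (fun n => ¬ 0 ≤ freqQP ω n)) (freqQP ω) hinj a T N M r hT0 hN0
    hr0.le hr2.ge (by
      intro n hn n' hn'
      rw [Finset.mem_filter, not_le] at hn hn'
      have h1 := (hmem n hn.1).2.1
      have h2 := (hmem n' hn'.1).2.1
      rw [abs_of_neg hn.2] at h1
      rw [abs_of_neg hn'.2] at h2
      exact le_trans (by linarith) (neg_le_abs _)) (hcount _ (Finset.filter_subset _ _))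
  have hlim : Tendsto (fun L => 8 * U1 L + 8 * U2 L) atTop (nhds (8 * V1 + 8 * V2)) :=
    (hU1.const_mul 8).add (hU2.const_mul 8)
  have hle : ∀ᶠ L : ℝ in atTop, (1 / (2 * L)) * (∫ t in Set.Icc (0 : ℝ) T, ∫ x in Set.Icc (-L) L, ‖f S t x‖ ^ 4)
      ≤ 8 * U1 L + 8 * U2 L := by
    filter_upwards [eventually_gt_atTop 0] with L hL
    have h := aux_split (S.filter (fun n => 0 ≤ freqQP ω n)) (S.filter (fun n => ¬ 0 ≤ freqQP ω n)) (freqQP ω) a T L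
      f hf S (fun t x => (Finset.sum_filter_add_sum_filter_not S _ _).symm)
    have h' := mul_le_mul_of_nonneg_left h (by positivity : 0 ≤ 1 / (2 * L))
    have h1 := hb1 L hL
    have h2 := hb2 L hL
    simp only [hf] at h' ⊢
    linarith
  have hge : ∀ᶠ L : ℝ in atTop, 0 ≤ (1 / (2 * L)) * (∫ t in Set.Icc (0 : ℝ) T, ∫ x in Set.Icc (-L) L, ‖f S t x‖ ^ 4) := by
    filter_upwards [eventually_gt_atTop 0] with L hL
    apply mul_nonneg (by positivity)
    exact integral_nonneg fun t => integral_nonneg fun x => by positivity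
  have hls := limsup_le_limsup hle (IsBoundedUnder.isCoboundedUnder_le ⟨0, by simpa using hge⟩) hlim.isBoundedUnder_le
  rw [hlim.limsup_eq] at hls
  refine hls.trans ?_
  have hE1 : ∀ R ⊆ S, (∑ n ∈ R, ‖a n‖ ^ 2) ^ 2 ≤ E ^ 2 := by
    intro R hRS
    gcongr
    exact Finset.sum_le_sum_of_subset_of_nonneg hRS fun _ _ _ => by positivity
  set B := (8 * Real.exp 1 ^ 2 * √Real.pi) * T * M with hB
  have hB0 : 0 ≤ B := by positivity
  have hV1' : V1 ≤ B * E ^ 2 := hV1.trans (mul_le_mul_of_nonneg_left (hE1 _ (Finset.filter_subset _ _)) hB0)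
  have hV2' : V2 ≤ B * E ^ 2 := hV2.trans (mul_le_mul_of_nonneg_left (hE1 _ (Finset.filter_subset _ _)) hB0)
  have hCk : C ^ (((k + 1 : ℕ) : ℝ) - 1) = C ^ k := by
    push_cast
    rw [add_sub_cancel_right, Real.rpow_natCast]
  rw [hCk]
  have hMle : M ≤ (1 / ω 0 + 1) * 3 ^ k * (1 + r) * C ^ k := by
    have : r / ω 0 + 1 ≤ (1 / ω 0 + 1) * (1 + r) := by
      have : 0 < 1 / ω 0 := by positivity
      rw [show r / ω 0 = r * (1 / ω 0) by ring]
      nlinarith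
    calc M ≤ ((1 / ω 0 + 1) * (1 + r)) * (3 * C) ^ k := by rw [hM]; gcongr
      _ = _ := by rw [mul_pow]; ring
  have hK : c0 ≤ (1 + c0) ^ 4 :=
    le_trans (by linarith) (le_self_pow₀ (by linarith : 1 ≤ 1 + c0) (by norm_num : 4 ≠ 0))
  calc 8 * V1 + 8 * V2 ≤ 16 * (B * E ^ 2) := by linarith
    _ ≤ 16 * (((8 * Real.exp 1 ^ 2 * √Real.pi) * T * ((1 / ω 0 + 1) * 3 ^ k * (1 + r) * C ^ k)) * E ^ 2) := by
        rw [hB]; gcongr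
    _ = c0 * T * (1 + r) * C ^ k * E ^ 2 := by rw [hc0]; ring
    _ ≤ _ := by gcongr
end

section
/- Let d ∈ ℕ and p ∈ [2,∞). Fix χ ∈ C_c^∞(ℝ) with support in (−2,2), χ ≡ 1 on [−1,1], and χ even and nonincreasing on [0,∞); set χ_1(r) = χ(r) and, for N = 2^k with k ≥ 1, χ_N(r) = χ(r/N) − χ(2r/N), and for a trigonometric polynomial f(x) = ∑_{λ∈Λ₀} a_λ e^{iλ·x} define P_N f(x) = ∑_{λ∈Λ₀} χ_N(|λ|) a_λ e^{iλ·x}. Then there exists a constant C = C(d,p,χ) > 0 such that for every finite set Λ₀ ⊂ ℝ^d and every a : Λ₀ → ℂ, limsup_{L→∞} ( (1/(2L)^d) ∫_{[−L,L]^d} |f(x)|^p dx )^{1/p} ≤ C · ( ∑_{N ∈ 2^{ℕ₀}} [ limsup_{L→∞} ( (1/(2L)^d) ∫_{[−L,L]^d} |P_N f(x)|^p dx )^{1/p} ]^2 )^{1/2}. (Littlewood–Paley decomposition for mean L^p norms of almost-periodic trigonometric polynomials, Proposition 4.1.) -/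
open MeasureTheory Filter

/-- The smooth dyadic cutoff `χ_N` for `N = 2^k`: `χ_1 = χ` and
`χ_{2^k}(r) = χ(r/2^k) − χ(2r/2^k)` for `k ≥ 1`. -/
noncomputable def chiDyadic (χ : ℝ → ℝ) (k : ℕ) (r : ℝ) : ℝ :=
  if k = 0 then χ r else χ (r / 2 ^ k) - χ (2 * r / 2 ^ k)


namespace LPaux

/-- scalar bound used for the Lipschitz estimate of `z ↦ |z|^q z` -/
lemma real_pow_diff {q a b : ℝ} (hq : 0 ≤ q) (hb : 0 ≤ b) (hab : b ≤ a) :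
    (a ^ q - b ^ q) * b ≤ (1 + q) * a ^ q * (a - b) := by
  rcases hb.eq_or_lt with rfl | hb0
  · simp; positivity
  have ha : 0 < a := lt_of_lt_of_le hb0 hab
  set r := b / a with hr
  have hr0 : 0 < r := by positivity
  have hr1 : r ≤ 1 := (div_le_one ha).2 hab
  have hbr : b = a * r := by rw [hr]; field_simp
  have key : 1 - r ^ q ≤ (1 + q) * (1 - r) := by
    rcases le_total 1 q with h | h
    · have := one_add_mul_self_le_rpow_one_add (s := r - 1) (by linarith) h
      have h2 : 1 + (r - 1) = r := by ring
      rw [h2] at this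
      nlinarith
    · have : r ^ (1 : ℝ) ≤ r ^ q := Real.rpow_le_rpow_of_exponent_ge hr0 hr1 h
      rw [Real.rpow_one] at this
      nlinarith
  have hbq : b ^ q = a ^ q * r ^ q := by rw [hbr, Real.mul_rpow ha.le hr0.le]
  have hrq : r ^ q ≤ 1 := Real.rpow_le_one hr0.le hr1 hq
  have haq : 0 < a ^ q := by positivity
  rw [hbq]
  have e1 : (a ^ q - a ^ q * r ^ q) * b = (a ^ q * a) * ((1 - r ^ q) * r) := by
    rw [hbr]; ring
  have e2 : (1 + q) * a ^ q * (a - b) = (a ^ q * a) * ((1 + q) * (1 - r)) := by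
    rw [hbr]; ring
  rw [e1, e2]
  apply mul_le_mul_of_nonneg_left _ (by positivity)
  nlinarith

/-- the nonlinearity `|z|^q z` -/
noncomputable def G (q : ℝ) (z : ℂ) : ℂ := ((‖z‖ ^ q : ℝ) : ℂ) * z

lemma G_lip {q : ℝ} (hq : 0 ≤ q) (z w : ℂ) :
    ‖G q z - G q w‖ ≤ (2 + q) * (‖z‖ ^ q + ‖w‖ ^ q) * ‖z - w‖ := by
  wlog h : ‖w‖ ≤ ‖z‖ generalizing z w
  · have := this w z (le_of_not_ge h)
    rw [norm_sub_rev, norm_sub_rev z w, add_comm (‖z‖ ^ q)]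
    exact this
  have e : G q z - G q w = ((‖z‖ ^ q : ℝ) : ℂ) * (z - w) +
      ((‖z‖ ^ q - ‖w‖ ^ q : ℝ) : ℂ) * w := by
    simp only [G]; push_cast; ring
  have hm : ‖w‖ ^ q ≤ ‖z‖ ^ q := Real.rpow_le_rpow (norm_nonneg _) h hq
  have h1 := real_pow_diff hq (norm_nonneg w) h
  have h2 : ‖z‖ - ‖w‖ ≤ ‖z - w‖ := norm_sub_norm_le z w
  have hz : 0 ≤ ‖z‖ ^ q := by positivity
  have hw : 0 ≤ ‖w‖ ^ q := by positivity
  rw [e]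
  refine (norm_add_le _ _).trans ?_
  rw [norm_mul, norm_mul, Complex.norm_real, Complex.norm_real, Real.norm_of_nonneg hz,
    Real.norm_of_nonneg (by linarith : 0 ≤ ‖z‖ ^ q - ‖w‖ ^ q)]
  have h3 : (1 + q) * ‖z‖ ^ q * (‖z‖ - ‖w‖) ≤ (1 + q) * ‖z‖ ^ q * ‖z - w‖ :=
    mul_le_mul_of_nonneg_left h2 (by positivity)
  have h4 : 0 ≤ (2 + q) * ‖w‖ ^ q * ‖z - w‖ := by positivity
  nlinarith

lemma young_p {p a b : ℝ} (hp : 2 ≤ p) (ha : 0 ≤ a) (hb : 0 ≤ b) :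
    p * (a ^ (p - 1) * b) ≤ (p - 1) * a ^ p + b ^ p := by
  have hp0 : 0 < p := by linarith
  have hp1 : 0 < p - 1 := by linarith
  have h := Real.geom_mean_le_arith_mean2_weighted (w₁ := (p - 1) / p) (w₂ := 1 / p)
    (p₁ := a ^ p) (p₂ := b ^ p) (by positivity) (by positivity) (by positivity) (by positivity)
    (by field_simp; ring)
  rw [← Real.rpow_mul ha, ← Real.rpow_mul hb] at h
  have e1 : p * ((p - 1) / p) = p - 1 := by field_simp
  have e2 : p * (1 / p) = 1 := by field_simp
  rw [e1, e2, Real.rpow_one] at h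
  calc p * (a ^ (p - 1) * b) ≤ p * ((p - 1) / p * a ^ p + 1 / p * b ^ p) := by gcongr
    _ = _ := by field_simp

lemma young3 {p a b c : ℝ} (hp : 2 ≤ p) (ha : 0 ≤ a) (hb : 0 ≤ b) (hc : 0 ≤ c) :
    a ^ (p - 2) * b * c ≤ (p - 2) / p * a ^ p + 1 / p * b ^ p + 1 / p * c ^ p := by
  have hp0 : 0 < p := by linarith
  have hp1 : 0 ≤ p - 2 := by linarith
  have h := Real.geom_mean_le_arith_mean3_weighted (w₁ := (p - 2) / p) (w₂ := 1 / p) (w₃ := 1 / p)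
    (p₁ := a ^ p) (p₂ := b ^ p) (p₃ := c ^ p) (by positivity) (by positivity) (by positivity)
    (by positivity) (by positivity) (by positivity)
    (by field_simp; ring)
  rw [← Real.rpow_mul ha, ← Real.rpow_mul hb, ← Real.rpow_mul hc] at h
  have e1 : p * ((p - 2) / p) = p - 2 := by field_simp
  have e2 : p * (1 / p) = 1 := by field_simp
  rwa [e1, e2, Real.rpow_one, Real.rpow_one] at h

lemma taylor_p {p : ℝ} (hp : 2 ≤ p) (z w : ℂ) :
    ‖z + w‖ ^ p ≤ ‖z‖ ^ p + p * (starRingEnd ℂ (G (p - 2) z) * w).re +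
      p * p * (‖z + w‖ ^ (p - 2) * ‖w‖ * ‖w‖ + ‖z‖ ^ (p - 2) * ‖w‖ * ‖w‖) := by
  set u := z + w with hu
  have hq : 0 ≤ p - 2 := by linarith
  have hp0 : 0 < p := by linarith
  -- convexity
  have h1 : ‖u‖ ^ p ≤ ‖z‖ ^ p + p * (starRingEnd ℂ (G (p - 2) u) * w).re := by
    have hy := young_p hp (norm_nonneg u) (norm_nonneg z)
    have e : w = u - z := by rw [hu]; ring
    have e2 : (starRingEnd ℂ (G (p - 2) u) * w).re =
        ‖u‖ ^ (p - 2) * (‖u‖ ^ 2 - (starRingEnd ℂ u * z).re) := by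
      rw [e, G, map_mul, Complex.conj_ofReal, mul_assoc, Complex.re_ofReal_mul]
      congr 1
      rw [mul_sub, Complex.sub_re, ← Complex.normSq_eq_conj_mul_self, Complex.ofReal_re,
        Complex.normSq_eq_norm_sq]
    have h3 : (starRingEnd ℂ u * z).re ≤ ‖u‖ * ‖z‖ := by
      refine (Complex.re_le_norm _).trans ?_
      simp
    have h4 : ‖u‖ ^ (p - 2) * ‖u‖ ^ 2 = ‖u‖ ^ p := by
      rw [← Real.rpow_natCast, ← Real.rpow_add_of_nonneg (norm_nonneg u) hq (by norm_num)]
      norm_num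
    have h5 : ‖u‖ ^ (p - 2) * ‖u‖ = ‖u‖ ^ (p - 1) := by
      nth_rewrite 2 [← Real.rpow_one ‖u‖]
      rw [← Real.rpow_add_of_nonneg (norm_nonneg u) hq (by norm_num)]
      ring_nf
    have h6 : ‖u‖ ^ (p - 2) * (starRingEnd ℂ u * z).re ≤ ‖u‖ ^ (p - 1) * ‖z‖ := by
      rw [← h5, mul_assoc]
      exact mul_le_mul_of_nonneg_left h3 (by positivity)
    rw [e2, mul_sub, h4]
    nlinarith
  have h2 : (starRingEnd ℂ (G (p - 2) u) * w).re - (starRingEnd ℂ (G (p - 2) z) * w).re ≤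
      p * (‖u‖ ^ (p - 2) + ‖z‖ ^ (p - 2)) * ‖w‖ * ‖w‖ := by
    rw [← Complex.sub_re, ← sub_mul, ← map_sub]
    refine (Complex.re_le_norm _).trans ?_
    rw [norm_mul, RCLike.norm_conj]
    have := G_lip hq u z
    have e : u - z = w := by rw [hu]; ring
    rw [e] at this
    have e3 : 2 + (p - 2) = p := by ring
    rw [e3] at this
    gcongr
  nlinarith

end LPaux


namespace LPaux

/-- bounded continuous functions -/
def BC {X V : Type*} [TopologicalSpace X] [NormedAddCommGroup V] (F : X → V) : Prop :=
  Continuous F ∧ ∃ B : ℝ, ∀ x, ‖F x‖ ≤ B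

section BCsec
variable {X : Type*} [TopologicalSpace X]

lemma BC.add {V : Type*} [NormedAddCommGroup V] {F H : X → V} (hF : BC F) (hH : BC H) :
    BC (fun x => F x + H x) := by
  obtain ⟨c, B, hB⟩ := hF
  obtain ⟨c', B', hB'⟩ := hH
  exact ⟨c.add c', B + B', fun x => (norm_add_le _ _).trans (add_le_add (hB x) (hB' x))⟩

lemma BC.sub {V : Type*} [NormedAddCommGroup V] {F H : X → V} (hF : BC F) (hH : BC H) :
    BC (fun x => F x - H x) := by
  obtain ⟨c, B, hB⟩ := hF
  obtain ⟨c', B', hB'⟩ := hH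
  exact ⟨c.sub c', B + B', fun x => (norm_sub_le _ _).trans (add_le_add (hB x) (hB' x))⟩

lemma BC.mul {V : Type*} [NormedRing V] {F H : X → V} (hF : BC F) (hH : BC H) :
    BC (fun x => F x * H x) := by
  obtain ⟨c, B, hB⟩ := hF
  obtain ⟨c', B', hB'⟩ := hH
  refine ⟨c.mul c', B * B', fun x => (norm_mul_le _ _).trans ?_⟩
  exact mul_le_mul (hB x) (hB' x) (norm_nonneg _) ((norm_nonneg _).trans (hB x))

lemma BC.const {V : Type*} [NormedAddCommGroup V] (v : V) : BC (fun _ : X => v) :=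
  ⟨continuous_const, ‖v‖, fun _ => le_rfl⟩

lemma BC.sum {V ι : Type*} [NormedAddCommGroup V] (s : Finset ι) {F : ι → X → V}
    (h : ∀ i ∈ s, BC (F i)) : BC (fun x => ∑ i ∈ s, F i x) := by
  classical
  induction s using Finset.induction_on with
  | empty => simpa using BC.const (0 : V)
  | insert i s hi ih =>
    simp only [Finset.sum_insert hi]
    exact (h i (by simp)).add (ih fun j hj => h j (by simp [hj]))

lemma BC.norm {V : Type*} [NormedAddCommGroup V] {F : X → V} (hF : BC F) :
    BC (fun x => ‖F x‖) := by
  obtain ⟨c, B, hB⟩ := hF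
  exact ⟨c.norm, B, fun x => by simpa using hB x⟩

lemma BC.norm_rpow {V : Type*} [NormedAddCommGroup V] {F : X → V} (hF : BC F) {q : ℝ}
    (hq : 0 ≤ q) : BC (fun x => ‖F x‖ ^ q) := by
  obtain ⟨c, B, hB⟩ := hF
  refine ⟨c.norm.rpow_const fun x => Or.inr hq, B ^ q, fun x => ?_⟩
  rw [Real.norm_of_nonneg (by positivity)]
  exact Real.rpow_le_rpow (norm_nonneg _) (hB x) hq

lemma BC.ofReal {F : X → ℝ} (hF : BC F) : BC (fun x => (F x : ℂ)) := by
  obtain ⟨c, B, hB⟩ := hF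
  exact ⟨Complex.continuous_ofReal.comp c, B, fun x => by simpa using hB x⟩

lemma BC.re {F : X → ℂ} (hF : BC F) : BC (fun x => (F x).re) := by
  obtain ⟨c, B, hB⟩ := hF
  exact ⟨Complex.continuous_re.comp c, B, fun x => (Complex.abs_re_le_norm _).trans (hB x)⟩

lemma BC.conj {F : X → ℂ} (hF : BC F) : BC (fun x => starRingEnd ℂ (F x)) := by
  obtain ⟨c, B, hB⟩ := hF
  exact ⟨Complex.continuous_conj.comp c, B, fun x => by simpa using hB x⟩

lemma BC.G {F : X → ℂ} (hF : BC F) {q : ℝ} (hq : 0 ≤ q) : BC (fun x => G q (F x)) :=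
  (hF.norm_rpow hq).ofReal.mul hF

lemma BC.translate {V : Type*} [NormedAddCommGroup V] [AddMonoid X] [ContinuousAdd X]
    {F : X → V} (hF : BC F) (v : X) : BC (fun x => F (x + v)) := by
  obtain ⟨c, B, hB⟩ := hF
  exact ⟨c.comp (continuous_id.add continuous_const), B, fun x => hB _⟩

end BCsec

variable {d : ℕ}

/-- box average -/
noncomputable def avg (d : ℕ) (L : ℝ) (F : (Fin d → ℝ) → ℝ) : ℝ :=
  (1 / (2 * L) ^ d) * ∫ x in (Set.univ.pi fun _ : Fin d => Set.Icc (-L) L), F x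

lemma box_eq (L : ℝ) : (Set.univ.pi fun _ : Fin d => Set.Icc (-L) L) =
    Set.Icc (fun _ => -L) (fun _ => L) := by
  ext x; simp [Set.mem_pi, Pi.le_def, forall_and]

lemma box_compact (L : ℝ) : IsCompact (Set.univ.pi fun _ : Fin d => Set.Icc (-L) L) :=
  isCompact_univ_pi fun _ => isCompact_Icc

lemma box_meas (L : ℝ) : MeasurableSet (Set.univ.pi fun _ : Fin d => Set.Icc (-L) L) :=
  (box_compact L).measurableSet

lemma box_vol {L : ℝ} (hL : 0 ≤ L) :
    (volume : Measure (Fin d → ℝ)).real (Set.univ.pi fun _ : Fin d => Set.Icc (-L) L)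
      = (2 * L) ^ d := by
  rw [box_eq, Measure.real, Real.volume_Icc_pi_toReal (fun _ => by linarith)]
  simp; ring

lemma box_integrable {V : Type*} [NormedAddCommGroup V] {F : (Fin d → ℝ) → V}
    (hF : Continuous F) (L : ℝ) :
    IntegrableOn F (Set.univ.pi fun _ : Fin d => Set.Icc (-L) L) :=
  hF.continuousOn.integrableOn_compact (box_compact L)

lemma avg_add {L : ℝ} {F H : (Fin d → ℝ) → ℝ} (hF : Continuous F) (hH : Continuous H) :
    avg d L (fun x => F x + H x) = avg d L F + avg d L H := by
  simp only [avg]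
  rw [integral_add (box_integrable hF L) (box_integrable hH L), mul_add]

lemma avg_const_mul {L : ℝ} (c : ℝ) (F : (Fin d → ℝ) → ℝ) :
    avg d L (fun x => c * F x) = c * avg d L F := by
  simp only [avg]
  rw [integral_const_mul]; ring

lemma avg_mono {L : ℝ} (hL : 0 ≤ L) {F H : (Fin d → ℝ) → ℝ} (hF : Continuous F)
    (hH : Continuous H) (h : ∀ x, F x ≤ H x) : avg d L F ≤ avg d L H := by
  simp only [avg]
  exact mul_le_mul_of_nonneg_left (integral_mono (box_integrable hF L) (box_integrable hH L) h)
    (by positivity)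

lemma avg_const {L : ℝ} (hL : 0 < L) (c : ℝ) : avg d L (fun _ => c) = c := by
  simp only [avg]
  rw [setIntegral_const, box_vol hL.le, smul_eq_mul]
  field_simp

lemma avg_bound {L : ℝ} (hL : 0 < L) {F : (Fin d → ℝ) → ℝ} (hF : Continuous F) {B : ℝ}
    (hB : ∀ x, ‖F x‖ ≤ B) : avg d L F ∈ Set.Icc (-B) B := by
  constructor
  · rw [← avg_const (d := d) hL (-B)]
    exact avg_mono hL.le continuous_const hF fun x => (abs_le.1 (hB x)).1
  · rw [← avg_const (d := d) hL B]
    exact avg_mono hL.le hF continuous_const fun x => (abs_le.1 (hB x)).2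

lemma avg_translate_le {L : ℝ} (hL : 0 < L) {F : (Fin d → ℝ) → ℝ} (hF : Continuous F) {B : ℝ}
    (h0 : ∀ x, 0 ≤ F x) (hB : ∀ x, F x ≤ B) (v : Fin d → ℝ) :
    avg d L (fun x => F (x + v)) ≤ avg d L F + B * ((1 + ‖v‖ / L) ^ d - 1) := by
  set R := ‖v‖ with hR
  have hR0 : 0 ≤ R := norm_nonneg v
  set box : ℝ → Set (Fin d → ℝ) := fun L => (Set.univ.pi fun _ : Fin d => Set.Icc (-L) L)
  have hsub : box L ⊆ box (L + R) := by
    intro x hx i hi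
    have := hx i hi
    simp only [Set.mem_Icc] at this ⊢
    constructor <;> linarith
  have hsh : ∫ x in box L, F (x + v) ≤ ∫ x in box (L + R), F x := by
    have e : ∫ x in box L, F (x + v) = ∫ x in (fun x => x + v) '' box L, F x := by
      rw [(measurePreserving_add_right volume v).setIntegral_image_emb
        (measurableEmbedding_addRight v)]
    rw [e]
    refine setIntegral_mono_set (box_integrable hF _) (Eventually.of_forall h0)
      (LE.le.eventuallyLE ?_)
    rintro _ ⟨x, hx, rfl⟩ i hi
    have h1 := hx i hi
    have h2 : |v i| ≤ R := norm_le_pi_norm v i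
    have h3 := abs_le.1 h2
    simp only [Set.mem_Icc, Pi.add_apply] at h1 ⊢
    constructor <;> linarith
  have hdiff : ∫ x in box (L + R), F x ≤ (∫ x in box L, F x) +
      B * ((2 * (L + R)) ^ d - (2 * L) ^ d) := by
    have e : ∫ x in box (L + R) \ box L, F x = (∫ x in box (L + R), F x) - ∫ x in box L, F x :=
      setIntegral_sdiff (box_meas L) (box_integrable hF _) hsub
    have h1 : ∫ x in box (L + R) \ box L, F x ≤ ∫ x in box (L + R) \ box L, B := by
      refine setIntegral_mono_on ((box_integrable hF _).mono_set Set.sdiff_subset)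
        ((box_integrable continuous_const _).mono_set Set.sdiff_subset)
        ((box_meas _).diff (box_meas _)) fun x _ => hB x
    have e2 : ∫ x in box (L + R) \ box L, B = B * ((2 * (L + R)) ^ d - (2 * L) ^ d) := by
      rw [setIntegral_sdiff (box_meas L) (box_integrable continuous_const _) hsub,
        setIntegral_const, setIntegral_const]
      have v1 : volume.real (box L) = (2 * L) ^ d := box_vol hL.le
      have v2 : volume.real (box (L + R)) = (2 * (L + R)) ^ d := box_vol (by linarith)
      rw [v1, v2, smul_eq_mul, smul_eq_mul]; ring
    linarith
  have hpow : (0:ℝ) < (2 * L) ^ d := by positivity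
  have e3 : B * ((1 + R / L) ^ d - 1) = (1 / (2 * L) ^ d) *
      (B * ((2 * (L + R)) ^ d - (2 * L) ^ d)) := by
    have : 2 * (L + R) = (1 + R / L) * (2 * L) := by field_simp
    rw [this, mul_pow (1 + R / L)]
    rw [eq_comm, one_div, inv_mul_eq_iff_eq_mul₀ hpow.ne']; ring
  rw [e3]
  simp only [avg]
  rw [← mul_add]
  exact mul_le_mul_of_nonneg_left (hsh.trans hdiff) (by positivity)

lemma err_tendsto (B R : ℝ) :
    Tendsto (fun L : ℝ => B * ((1 + R / L) ^ d - 1)) atTop (nhds 0) := by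
  have h1 : Tendsto (fun L : ℝ => R / L) atTop (nhds 0) := tendsto_const_nhds.div_atTop tendsto_id
  have h2 : Tendsto (fun L : ℝ => B * ((1 + R / L) ^ d - 1)) atTop
      (nhds (B * ((1 + 0) ^ d - 1))) :=
    (((h1.const_add 1).pow d).sub_const 1).const_mul B
  simpa using h2

lemma avg_translate_tendsto {F : (Fin d → ℝ) → ℝ} (hF : BC F) (v : Fin d → ℝ) :
    Tendsto (fun L : ℝ => avg d L (fun x => F (x + v)) - avg d L F) atTop (nhds 0) := by
  obtain ⟨c, B, hB⟩ := hF
  have hB' : ∀ x, -B ≤ F x ∧ F x ≤ B := fun x => abs_le.1 (hB x)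
  set H : (Fin d → ℝ) → ℝ := fun x => F x + B with hH
  have cH : Continuous H := c.add continuous_const
  have cv : Continuous (fun x : Fin d → ℝ => x + v) := continuous_id.add continuous_const
  have hdiff : ∀ᶠ L : ℝ in atTop, |avg d L (fun x => F (x + v)) - avg d L F| ≤
      2 * B * ((1 + ‖v‖ / L) ^ d - 1) := by
    filter_upwards [eventually_gt_atTop 0] with L hL
    have e1 : avg d L H = avg d L F + B := by
      rw [hH, avg_add c continuous_const, avg_const hL]
    have e2 : avg d L (fun x => H (x + v)) = avg d L (fun x => F (x + v)) + B := by
      simp only [hH]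
      rw [avg_add (F := fun x => F (x + v)) (c.comp cv) continuous_const, avg_const hL]
    have i1 := avg_translate_le hL cH (B := 2 * B) (fun x => by have := hB' x; simp [H]; linarith)
      (fun x => by have := hB' x; simp [H]; linarith) v
    have i2 := avg_translate_le hL (F := fun x => H (x + v)) (cH.comp cv) (B := 2 * B)
      (fun x => by have := hB' (x + v); simp [H]; linarith)
      (fun x => by have := hB' (x + v); simp [H]; linarith) (-v)
    simp only [neg_add_cancel_right, norm_neg] at i2
    rw [abs_le]; constructor <;> linarith
  exact squeeze_zero_norm' hdiff (err_tendsto _ _)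

/-- limit of the averages along an ultrafilter -/
noncomputable def E (U : Ultrafilter ℝ) (F : (Fin d → ℝ) → ℝ) : ℝ :=
  limUnder (U : Filter ℝ) (fun L => avg d L F)

section Esec
variable {U : Ultrafilter ℝ}

lemma E_tendsto (hU : (U : Filter ℝ) ≤ atTop) {F : (Fin d → ℝ) → ℝ} (hF : BC F) :
    Tendsto (fun L => avg d L F) U (nhds (E U F)) := by
  obtain ⟨c, B, hB⟩ := hF
  have h1 : ∀ᶠ L in (U : Filter ℝ), avg d L F ∈ Set.Icc (-B) B := by
    filter_upwards [hU (eventually_gt_atTop 0)] with L hL using avg_bound hL c hB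
  obtain ⟨x, -, hx⟩ := (isCompact_Icc (a := -B) (b := B)).ultrafilter_le_nhds
    (U.map (fun L => avg d L F)) (by rw [Ultrafilter.coe_map]; exact le_principal_iff.2 h1)
  exact tendsto_nhds_limUnder ⟨x, hx⟩

lemma E_eq_of (_hU : (U : Filter ℝ) ≤ atTop) {F : (Fin d → ℝ) → ℝ} {x : ℝ}
    (h : Tendsto (fun L => avg d L F) U (nhds x)) : E U F = x := h.limUnder_eq

lemma E_add (hU : (U : Filter ℝ) ≤ atTop) {F H : (Fin d → ℝ) → ℝ} (hF : BC F) (hH : BC H) :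
    E U (fun x => F x + H x) = E U F + E U H := by
  apply E_eq_of hU
  simp_rw [avg_add hF.1 hH.1]
  exact (E_tendsto hU hF).add (E_tendsto hU hH)

lemma E_const_mul (hU : (U : Filter ℝ) ≤ atTop) (c : ℝ) {F : (Fin d → ℝ) → ℝ} (hF : BC F) :
    E U (fun x => c * F x) = c * E U F := by
  apply E_eq_of hU
  simp_rw [avg_const_mul]
  exact (E_tendsto hU hF).const_mul c

lemma E_sub (hU : (U : Filter ℝ) ≤ atTop) {F H : (Fin d → ℝ) → ℝ} (hF : BC F) (hH : BC H) :
    E U (fun x => F x - H x) = E U F - E U H := by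
  have h := E_add hU hF (H := fun x => (-1) * H x) ((BC.const (-1)).mul hH)
  rw [E_const_mul hU _ hH] at h
  have e : (fun x => F x - H x) = fun x => F x + (-1) * H x := by ext x; ring
  rw [e, h]; ring

lemma E_sum (hU : (U : Filter ℝ) ≤ atTop) {ι : Type*} (s : Finset ι) {F : ι → (Fin d → ℝ) → ℝ} (h : ∀ i ∈ s, BC (F i)) :
    E U (fun x => ∑ i ∈ s, F i x) = ∑ i ∈ s, E U (F i) := by
  classical
  induction s using Finset.induction_on with
  | empty =>
    simp only [Finset.sum_empty]
    have := E_const_mul hU 0 (BC.const (X := Fin d → ℝ) (0:ℝ))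
    simpa using this
  | insert i s hi ih =>
    simp only [Finset.sum_insert hi]
    rw [E_add hU (h i (by simp)) (BC.sum s fun j hj => h j (by simp [hj])),
      ih fun j hj => h j (by simp [hj])]

lemma E_mono (hU : (U : Filter ℝ) ≤ atTop) {F H : (Fin d → ℝ) → ℝ} (hF : BC F) (hH : BC H) (h : ∀ x, F x ≤ H x) :
    E U F ≤ E U H := by
  refine le_of_tendsto_of_tendsto (E_tendsto hU hF) (E_tendsto hU hH) ?_
  filter_upwards [hU (eventually_gt_atTop 0)] with L hL using avg_mono hL.le hF.1 hH.1 h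

lemma E_zero (hU : (U : Filter ℝ) ≤ atTop) : E U (fun _ : Fin d → ℝ => (0:ℝ)) = 0 := by
  have := E_const_mul hU 0 (BC.const (X := Fin d → ℝ) (0:ℝ))
  simpa using this

lemma E_nonneg (hU : (U : Filter ℝ) ≤ atTop) {F : (Fin d → ℝ) → ℝ} (hF : BC F) (h : ∀ x, 0 ≤ F x) : 0 ≤ E U F := by
  rw [← E_zero (d := d) hU]
  exact E_mono hU (BC.const 0) hF h

lemma E_translate (hU : (U : Filter ℝ) ≤ atTop) {F : (Fin d → ℝ) → ℝ} (hF : BC F) (v : Fin d → ℝ) :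
    E U (fun x => F (x + v)) = E U F := by
  have h1 := (E_tendsto hU (hF.translate v)).sub (E_tendsto hU hF)
  have h2 := (avg_translate_tendsto hF v).mono_left hU
  have := tendsto_nhds_unique h1 h2
  linarith

/-- three-function Hölder inequality -/
lemma E_holder_pos (hU : (U : Filter ℝ) ≤ atTop) {p : ℝ} (hp : 2 ≤ p) {V : Type*} [NormedAddCommGroup V]
    {a b c : (Fin d → ℝ) → V} (ha : BC a) (hb : BC b) (hc : BC c) {A B C : ℝ}
    (hA : 0 < A) (hB : 0 < B) (hC : 0 < C)
    (hEa : E U (fun x => ‖a x‖ ^ p) ≤ A ^ p) (hEb : E U (fun x => ‖b x‖ ^ p) ≤ B ^ p)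
    (hEc : E U (fun x => ‖c x‖ ^ p) ≤ C ^ p) :
    E U (fun x => ‖a x‖ ^ (p - 2) * ‖b x‖ * ‖c x‖) ≤ A ^ (p - 2) * B * C := by
  have hp0 : 0 < p := by linarith
  have hq : 0 ≤ p - 2 := by linarith
  set K := A ^ (p - 2) * B * C with hK
  have hK0 : 0 < K := by positivity
  have pt : ∀ x, ‖a x‖ ^ (p - 2) * ‖b x‖ * ‖c x‖ ≤
      (K * ((p - 2) / p) / A ^ p) * ‖a x‖ ^ p + (K * (1 / p) / B ^ p) * ‖b x‖ ^ p +
      (K * (1 / p) / C ^ p) * ‖c x‖ ^ p := by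
    intro x
    have h := young3 hp (a := ‖a x‖ / A) (b := ‖b x‖ / B) (c := ‖c x‖ / C)
      (by positivity) (by positivity) (by positivity)
    rw [Real.div_rpow (norm_nonneg _) hA.le, Real.div_rpow (norm_nonneg _) hA.le,
      Real.div_rpow (norm_nonneg _) hB.le, Real.div_rpow (norm_nonneg _) hC.le] at h
    have h2 := mul_le_mul_of_nonneg_left h hK0.le
    have hAq : A ^ (p - 2) ≠ 0 := by positivity
    calc ‖a x‖ ^ (p - 2) * ‖b x‖ * ‖c x‖ =
        K * (‖a x‖ ^ (p - 2) / A ^ (p - 2) * (‖b x‖ / B) * (‖c x‖ / C)) := by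
          rw [hK]; field_simp
      _ ≤ _ := h2
      _ = _ := by ring
  have Ba := ha.norm_rpow hp0.le
  have Bb := hb.norm_rpow hp0.le
  have Bc := hc.norm_rpow hp0.le
  refine (E_mono hU (((ha.norm_rpow hq).mul hb.norm).mul hc.norm)
    ((((BC.const _).mul Ba).add ((BC.const _).mul Bb)).add ((BC.const _).mul Bc)) pt).trans ?_
  rw [E_add hU (((BC.const _).mul Ba).add ((BC.const _).mul Bb)) ((BC.const _).mul Bc),
    E_add hU ((BC.const _).mul Ba) ((BC.const _).mul Bb), E_const_mul hU _ Ba,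
    E_const_mul hU _ Bb, E_const_mul hU _ Bc]
  have hAp : 0 < A ^ p := by positivity
  have hBp : 0 < B ^ p := by positivity
  have hCp : 0 < C ^ p := by positivity
  calc _ ≤ (K * ((p - 2) / p) / A ^ p) * A ^ p + (K * (1 / p) / B ^ p) * B ^ p +
      (K * (1 / p) / C ^ p) * C ^ p := by gcongr
    _ = K := by field_simp; ring

lemma E_holder (hU : (U : Filter ℝ) ≤ atTop) {p : ℝ} (hp : 2 ≤ p) {V : Type*} [NormedAddCommGroup V]
    {a b c : (Fin d → ℝ) → V} (ha : BC a) (hb : BC b) (hc : BC c) {A B C : ℝ}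
    (hA : 0 ≤ A) (hB : 0 ≤ B) (hC : 0 ≤ C)
    (hEa : E U (fun x => ‖a x‖ ^ p) ≤ A ^ p) (hEb : E U (fun x => ‖b x‖ ^ p) ≤ B ^ p)
    (hEc : E U (fun x => ‖c x‖ ^ p) ≤ C ^ p) :
    E U (fun x => ‖a x‖ ^ (p - 2) * ‖b x‖ * ‖c x‖) ≤ A ^ (p - 2) * B * C := by
  have hp0 : 0 < p := by linarith
  have hq : 0 ≤ p - 2 := by linarith
  have lim : Tendsto (fun ε : ℝ => (A + ε) ^ (p - 2) * (B + ε) * (C + ε)) (nhdsWithin 0 (Set.Ioi 0))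
      (nhds (A ^ (p - 2) * B * C)) := by
    have : Continuous (fun ε : ℝ => (A + ε) ^ (p - 2) * (B + ε) * (C + ε)) := by
      refine Continuous.mul (Continuous.mul (Continuous.rpow_const (by fun_prop)
        fun _ => Or.inr hq) (by fun_prop)) (by fun_prop)
    have h := this.tendsto 0
    simp only [add_zero] at h
    exact h.mono_left nhdsWithin_le_nhds
  refine ge_of_tendsto lim ?_
  filter_upwards [self_mem_nhdsWithin] with ε hε
  have hε : 0 < ε := hε
  refine E_holder_pos hU hp ha hb hc (by linarith) (by linarith) (by linarith)
    (hEa.trans ?_) (hEb.trans ?_) (hEc.trans ?_)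
  all_goals exact Real.rpow_le_rpow (by assumption) (by linarith) hp0.le

end Esec

end LPaux


namespace LPaux

variable {d : ℕ}

/-- trigonometric polynomial -/
noncomputable def T (Λ : Finset (Fin d → ℝ)) (a : (Fin d → ℝ) → ℂ) (x : Fin d → ℝ) : ℂ :=
  ∑ lam ∈ Λ, a lam * Complex.exp (Complex.I * ((∑ i, lam i * x i : ℝ) : ℂ))

lemma norm_exp_I (r : ℝ) : ‖Complex.exp (Complex.I * (r : ℂ))‖ = 1 := by
  rw [mul_comm]; exact Complex.norm_exp_ofReal_mul_I r

lemma BC_T (Λ : Finset (Fin d → ℝ)) (a : (Fin d → ℝ) → ℂ) : BC (T Λ a) := by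
  refine BC.sum Λ fun lam _ => (BC.const _).mul ⟨by fun_prop, 1, fun x => ?_⟩
  rw [norm_exp_I]

lemma T_translate (Λ : Finset (Fin d → ℝ)) (a : (Fin d → ℝ) → ℂ) (x v : Fin d → ℝ) :
    T Λ a (x + v) =
      T Λ (fun lam => a lam * Complex.exp (Complex.I * ((∑ i, lam i * v i : ℝ) : ℂ))) x := by
  simp only [T]
  refine Finset.sum_congr rfl fun lam _ => ?_
  rw [mul_assoc, ← Complex.exp_add]
  congr 2
  rw [← mul_add, ← Complex.ofReal_add, ← Finset.sum_add_distrib]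
  congr 2
  exact Finset.sum_congr rfl fun i _ => by simp; ring

lemma jensen_kernel {Y : Type*} [MeasurableSpace Y] {μ : Measure Y} {ψ : Y → ℂ}
    (hψ : Integrable ψ μ) {p : ℝ} (hp : 2 ≤ p) {g : Y → ℝ} (hg : AEStronglyMeasurable g μ)
    (h0 : ∀ y, 0 ≤ g y) {B : ℝ} (hB : ∀ y, g y ≤ B) :
    (∫ y, ‖ψ y‖ * g y ∂μ) ^ p ≤ (∫ y, ‖ψ y‖ ∂μ) ^ (p - 1) * ∫ y, ‖ψ y‖ * g y ^ p ∂μ := by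
  have hp0 : 0 < p := by linarith
  have i1 : Integrable (fun y => ‖ψ y‖ * g y) μ :=
    hψ.norm.mul_bdd (c := B) hg (Eventually.of_forall fun y => by
      rw [Real.norm_of_nonneg (h0 y)]; exact hB y)
  have i2 : Integrable (fun y => ‖ψ y‖ * g y ^ p) μ :=
    hψ.norm.mul_bdd (c := B ^ p) ((Real.continuous_rpow_const hp0.le).comp_aestronglyMeasurable hg)
      (Eventually.of_forall fun y => by
        rw [Real.norm_of_nonneg (Real.rpow_nonneg (h0 y) p)]
        exact Real.rpow_le_rpow (h0 y) (hB y) hp0.le)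
  set N := ∫ y, ‖ψ y‖ ∂μ with hN
  set I := ∫ y, ‖ψ y‖ * g y ∂μ with hI
  set J := ∫ y, ‖ψ y‖ * g y ^ p ∂μ with hJ
  have hN0 : 0 ≤ N := integral_nonneg fun y => norm_nonneg _
  have hI0 : 0 ≤ I := integral_nonneg fun y => mul_nonneg (norm_nonneg _) (h0 y)
  have hJ0 : 0 ≤ J := integral_nonneg fun y => mul_nonneg (norm_nonneg _) (Real.rpow_nonneg (h0 y) p)
  rcases hN0.eq_or_lt with hz | hNp
  · have : I ≤ N * B := by
      rw [hI, hN, ← integral_mul_const]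
      exact integral_mono i1 (hψ.norm.mul_const B)
        fun y => mul_le_mul_of_nonneg_left (hB y) (norm_nonneg _)
    have hI1 : I = 0 := by rw [← hz] at this; linarith
    rw [hI1, Real.zero_rpow hp0.ne']
    positivity
  set s := I / N with hs
  have hs0 : 0 ≤ s := by positivity
  have hIs : I = s * N := by rw [hs]; field_simp
  have key : p * (s ^ (p - 1) * I) ≤ (p - 1) * s ^ p * N + J := by
    have : ∫ y, p * s ^ (p - 1) * (‖ψ y‖ * g y) ∂μ ≤
        ∫ y, ((p - 1) * s ^ p * ‖ψ y‖ + ‖ψ y‖ * g y ^ p) ∂μ := by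
      refine integral_mono (i1.const_mul _) ((hψ.norm.const_mul _).add i2) fun y => ?_
      have h := mul_le_mul_of_nonneg_left (young_p hp hs0 (h0 y)) (norm_nonneg (ψ y))
      simp only
      nlinarith
    rw [integral_const_mul, integral_add (hψ.norm.const_mul _) i2, integral_const_mul] at this
    linarith
  have e1 : s ^ (p - 1) * s = s ^ p := by
    nth_rewrite 2 [← Real.rpow_one s]
    rw [← Real.rpow_add_of_nonneg hs0 (by linarith) (by norm_num)]
    ring_nf
  have e2 : N ^ (p - 1) * N = N ^ p := by
    nth_rewrite 2 [← Real.rpow_one N]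
    rw [← Real.rpow_add_of_nonneg hN0 (by linarith) (by norm_num)]
    ring_nf
  have h3 : s ^ p * N ≤ J := by
    have : s ^ (p - 1) * I = s ^ p * N := by rw [hIs, ← mul_assoc, e1]
    rw [this] at key
    nlinarith
  rw [hIs, Real.mul_rpow hs0 hN0, ← e2]
  have : 0 ≤ N ^ (p - 1) := by positivity
  nlinarith

lemma kernel {U : Ultrafilter ℝ} (hU : (U : Filter ℝ) ≤ atTop) {Y : Type*} [MeasurableSpace Y]
    {μ : Measure Y} [SFinite μ] {ψ : Y → ℂ} (hψ : Integrable ψ μ) {v : Y → Fin d → ℝ}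
    (hv : Measurable v) {p : ℝ} (hp : 2 ≤ p) (Λ : Finset (Fin d → ℝ)) (a b : (Fin d → ℝ) → ℂ)
    (hab : ∀ lam ∈ Λ, b lam = a lam *
      ∫ y, ψ y * Complex.exp (Complex.I * ((∑ i, lam i * v y i : ℝ) : ℂ)) ∂μ) :
    E U (fun x => ‖T Λ b x‖ ^ p) ≤ (∫ y, ‖ψ y‖ ∂μ) ^ p * E U (fun x => ‖T Λ a x‖ ^ p) := by
  have hp0 : 0 < p := by linarith
  set N := ∫ y, ‖ψ y‖ ∂μ with hN
  have hN0 : 0 ≤ N := integral_nonneg fun y => norm_nonneg _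
  obtain ⟨cT, B, hB⟩ := BC_T Λ a
  set F : (Fin d → ℝ) → ℝ := fun x => ‖T Λ a x‖ ^ p with hF
  have bcF : BC F := (BC_T Λ a).norm_rpow hp0.le
  have bcTb : BC (fun x => ‖T Λ b x‖ ^ p) := (BC_T Λ b).norm_rpow hp0.le
  have hF0 : ∀ x, 0 ≤ F x := fun x => by positivity
  have hFB : ∀ x, ‖F x‖ ≤ B ^ p := fun x => by
    rw [Real.norm_of_nonneg (hF0 x)]
    exact Real.rpow_le_rpow (norm_nonneg _) (hB x) hp0.le
  have mv : ∀ x, Measurable fun y => x + v y := fun x => measurable_const.add hv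
  -- representation
  have rep : ∀ x, T Λ b x = ∫ y, ψ y * T Λ a (x + v y) ∂μ := by
    intro x
    have ii : ∀ lam ∈ Λ, Integrable (fun y => ψ y * ((a lam * Complex.exp (Complex.I *
        ((∑ i, lam i * v y i : ℝ) : ℂ))) * Complex.exp (Complex.I * ((∑ i, lam i * x i : ℝ) : ℂ))))
        μ := by
      intro lam _
      refine hψ.mul_bdd (c := ‖a lam‖) ?_ (Eventually.of_forall fun y => ?_)
      · refine Measurable.aestronglyMeasurable ?_
        have : ∀ i, Measurable fun y => v y i := fun i => (measurable_pi_apply i).comp hv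
        fun_prop
      · rw [norm_mul, norm_mul, norm_exp_I, norm_exp_I]; simp
    simp_rw [T_translate, T, Finset.mul_sum]
    rw [integral_finsetSum _ ii]
    refine Finset.sum_congr rfl fun lam hl => ?_
    rw [hab lam hl, ← integral_const_mul, ← integral_mul_const]
    congr 1; ext y; ring
  have pt : ∀ x, ‖T Λ b x‖ ^ p ≤ N ^ (p - 1) * ∫ y, ‖ψ y‖ * F (x + v y) ∂μ := by
    intro x
    have h1 : ‖T Λ b x‖ ≤ ∫ y, ‖ψ y‖ * ‖T Λ a (x + v y)‖ ∂μ := by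
      rw [rep x]
      refine (norm_integral_le_integral_norm _).trans (le_of_eq ?_)
      congr 1; ext y; simp
    refine (Real.rpow_le_rpow (norm_nonneg _) h1 hp0.le).trans ?_
    exact jensen_kernel hψ hp
      ((cT.norm.measurable.comp (mv x)).aestronglyMeasurable) (fun y => norm_nonneg _)
      (B := B) (fun y => hB _)
  -- Fubini
  have mF2 : Measurable (fun z : (Fin d → ℝ) × Y => F (z.1 + v z.2)) :=
    bcF.1.measurable.comp (measurable_fst.add (hv.comp measurable_snd))
  have prodI : ∀ L : ℝ, Integrable (fun z : (Fin d → ℝ) × Y => ‖ψ z.2‖ * F (z.1 + v z.2))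
      ((volume.restrict (Set.univ.pi fun _ : Fin d => Set.Icc (-L) L)).prod μ) := by
    intro L
    haveI : IsFiniteMeasure (volume.restrict
      (Set.univ.pi fun _ : Fin d => Set.Icc (-L) L)) :=
      ⟨by rw [Measure.restrict_apply_univ]; exact (box_compact L).measure_lt_top⟩
    exact (hψ.norm.comp_snd _).mul_bdd (c := B ^ p) mF2.aestronglyMeasurable
      (Eventually.of_forall fun z => hFB _)
  have fub : ∀ L : ℝ, (1 / (2 * L) ^ d) *
      ∫ x in (Set.univ.pi fun _ : Fin d => Set.Icc (-L) L), (∫ y, ‖ψ y‖ * F (x + v y) ∂μ) =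
      ∫ y, ‖ψ y‖ * avg d L (fun x => F (x + v y)) ∂μ := by
    intro L
    rw [integral_integral_swap (prodI L), ← integral_const_mul]
    congr 1; ext y
    rw [integral_const_mul, avg]; ring
  have mavg : ∀ L, AEStronglyMeasurable (fun y => avg d L (fun x => F (x + v y))) μ := by
    intro L
    simp only [avg]
    refine AEStronglyMeasurable.const_mul ?_ _
    exact (mF2.stronglyMeasurable.integral_prod_left' (μ := volume.restrict
      (Set.univ.pi fun _ : Fin d => Set.Icc (-L) L))).aestronglyMeasurable
  have bavg : ∀ L, 0 < L → ∀ w : Fin d → ℝ, |avg d L (fun x => F (x + w))| ≤ B ^ p := by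
    intro L hL w
    exact abs_le.2 (avg_bound hL (bcF.translate w).1 fun x => hFB _)
  have bavg0 : ∀ L, 0 < L → |avg d L F| ≤ B ^ p := fun L hL => abs_le.2 (avg_bound hL bcF.1 hFB)
  set D : ℝ → ℝ := fun L => ∫ y, ‖ψ y‖ * (avg d L (fun x => F (x + v y)) - avg d L F) ∂μ with hD
  have Dlim : Tendsto D atTop (nhds 0) := by
    have : Tendsto D atTop (nhds (∫ _, (0:ℝ) ∂μ)) := by
      refine tendsto_integral_filter_of_dominated_convergence (fun y => ‖ψ y‖ * (2 * B ^ p)) ?_ ?_ ?_ ?_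
      · exact Eventually.of_forall fun L =>
          hψ.norm.aestronglyMeasurable.mul ((mavg L).sub aestronglyMeasurable_const)
      · filter_upwards [eventually_gt_atTop 0] with L hL
        refine Eventually.of_forall fun y => ?_
        rw [norm_mul, norm_norm]
        refine mul_le_mul_of_nonneg_left ?_ (norm_nonneg _)
        refine (norm_sub_le _ _).trans ?_
        have := bavg L hL (v y)
        have := bavg0 L hL
        simp only [Real.norm_eq_abs]; linarith
      · exact hψ.norm.mul_const _
      · refine Eventually.of_forall fun y => ?_
        simpa using (avg_translate_tendsto bcF (v y)).const_mul ‖ψ y‖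
    simpa using this
  have main : ∀ L, 0 < L → avg d L (fun x => ‖T Λ b x‖ ^ p) ≤
      N ^ (p - 1) * (D L + N * avg d L F) := by
    intro L hL
    have e : D L + N * avg d L F = ∫ y, ‖ψ y‖ * avg d L (fun x => F (x + v y)) ∂μ := by
      have i1 : Integrable (fun y => ‖ψ y‖ * avg d L (fun x => F (x + v y))) μ :=
        hψ.norm.mul_bdd (c := B ^ p) (mavg L) (Eventually.of_forall fun y => bavg L hL _)
      simp only [hD, mul_sub]
      rw [integral_sub i1 (hψ.norm.mul_const _), integral_mul_const]; ring
    rw [e, ← fub L]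
    have i2 := (prodI L).integral_prod_left
    have : ∫ x in (Set.univ.pi fun _ : Fin d => Set.Icc (-L) L), ‖T Λ b x‖ ^ p ≤
        ∫ x in (Set.univ.pi fun _ : Fin d => Set.Icc (-L) L),
          N ^ (p - 1) * (∫ y, ‖ψ y‖ * F (x + v y) ∂μ) :=
      integral_mono (box_integrable bcTb.1 L) (i2.const_mul _) pt
    rw [integral_const_mul] at this
    rw [avg, mul_left_comm]
    exact mul_le_mul_of_nonneg_left this (by positivity)
  have e2 : N ^ (p - 1) * N = N ^ p := by
    nth_rewrite 2 [← Real.rpow_one N]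
    rw [← Real.rpow_add_of_nonneg hN0 (by linarith) (by norm_num)]
    ring_nf
  have lim2 : Tendsto (fun L => N ^ (p - 1) * (D L + N * avg d L F)) U
      (nhds (N ^ (p - 1) * (0 + N * E U F))) :=
    ((Dlim.mono_left hU).add ((E_tendsto hU bcF).const_mul N)).const_mul _
  have := le_of_tendsto_of_tendsto (E_tendsto hU bcTb) lim2
    (by filter_upwards [hU (eventually_gt_atTop 0)] with L hL using main L hL)
  rwa [zero_add, ← mul_assoc, e2] at this

end LPaux


namespace LPaux

variable {d : ℕ}

open scoped FourierTransform in
lemma mult_rep {m : EuclideanSpace ℝ (Fin d) → ℂ} (hm : ContDiff ℝ (⊤ : ℕ∞) m)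
    (hc : HasCompactSupport m) : ∃ ψ : EuclideanSpace ℝ (Fin d) → ℂ, Integrable ψ ∧
      ∀ ξ : EuclideanSpace ℝ (Fin d), m ξ =
        ∫ y, ψ y * Complex.exp (Complex.I * ((2 * Real.pi * ∑ i, ξ i * y i : ℝ) : ℂ)) := by
  let f : SchwartzMap (EuclideanSpace ℝ (Fin d)) ℂ := hc.toSchwartzMap hm
  let g : SchwartzMap (EuclideanSpace ℝ (Fin d)) ℂ := 𝓕 f
  refine ⟨g, g.integrable, fun ξ => ?_⟩
  have h : (𝓕⁻ g) ξ = f ξ := by simp only [g]; rw [FourierTransform.fourierInv_fourier_eq]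
  have h2 : f ξ = m ξ := rfl
  rw [← h2, ← h, SchwartzMap.fourierInv_coe, Real.fourierInv_eq']
  congr 1; ext y
  rw [smul_eq_mul, mul_comm]
  congr 2
  rw [mul_comm]
  congr 3

lemma mult_bound {m : EuclideanSpace ℝ (Fin d) → ℂ} (hm : ContDiff ℝ (⊤ : ℕ∞) m)
    (hc : HasCompactSupport m) : ∃ C : ℝ, 0 ≤ C ∧ ∀ (U : Ultrafilter ℝ)
      (_ : (U : Filter ℝ) ≤ atTop) (p : ℝ) (_ : 2 ≤ p) (Λ : Finset (Fin d → ℝ))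
      (a b : (Fin d → ℝ) → ℂ) (s : ℝ)
      (_ : ∀ lam ∈ Λ, b lam = a lam * m (s • WithLp.toLp 2 lam)),
      E U (fun x => ‖T Λ b x‖ ^ p) ≤ C ^ p * E U (fun x => ‖T Λ a x‖ ^ p) := by
  obtain ⟨ψ, hψ, hrep⟩ := mult_rep hm hc
  refine ⟨∫ y, ‖ψ y‖, integral_nonneg fun y => norm_nonneg _, ?_⟩
  intro U hU p hp Λ a b s hab
  refine kernel hU hψ (v := fun y i => 2 * Real.pi * s * y i) (by fun_prop) hp Λ a b ?_
  intro lam hl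
  rw [hab lam hl, hrep]
  congr 1
  congr 1; ext y
  congr 5
  rw [Finset.mul_sum]
  refine Finset.sum_congr rfl fun i _ => ?_
  simp; ring

lemma norm_toLp (lam : Fin d → ℝ) :
    ‖(WithLp.toLp 2 lam : EuclideanSpace ℝ (Fin d))‖ = Real.sqrt (∑ i, lam i ^ 2) := by
  rw [EuclideanSpace.norm_eq]; simp

/-- a smooth bump: `1` on the ball of radius `r`, supported in the ball of radius `R` -/
lemma exists_bump {r R : ℝ} (hr : 0 < r) (hR : r < R) :
    ∃ η : EuclideanSpace ℝ (Fin d) → ℝ, ContDiff ℝ (⊤ : ℕ∞) η ∧ HasCompactSupport η ∧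
      (∀ x, 0 ≤ η x) ∧ (∀ x, η x ≤ 1) ∧ (∀ x, ‖x‖ ≤ r → η x = 1) ∧ (∀ x, R ≤ ‖x‖ → η x = 0) := by
  let f : ContDiffBump (0 : EuclideanSpace ℝ (Fin d)) := ⟨r, R, hr, hR⟩
  refine ⟨f, f.contDiff, f.hasCompactSupport, fun x => f.nonneg, fun x => f.le_one, ?_, ?_⟩
  · intro x hx
    exact f.one_of_mem_closedBall (by simpa using hx)
  · intro x hx
    exact f.zero_of_le_dist (by simpa using hx)

lemma bernstein_diff (i : Fin d) : ∃ C : ℝ, 0 ≤ C ∧ ∀ (U : Ultrafilter ℝ)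
      (_ : (U : Filter ℝ) ≤ atTop) (p : ℝ) (_ : 2 ≤ p) (Λ : Finset (Fin d → ℝ))
      (a : (Fin d → ℝ) → ℂ) (r t : ℝ) (_ : 0 < r) (_ : 0 ≤ t)
      (_ : ∀ lam ∈ Λ, a lam ≠ 0 → Real.sqrt (∑ i, lam i ^ 2) ≤ 2 * r),
      E U (fun x => ‖T Λ a (x + Pi.single i (-t)) - T Λ a x‖ ^ p) ≤
        (C * (t * r)) ^ p * E U (fun x => ‖T Λ a x‖ ^ p) := by
  obtain ⟨η, hη, hηc, -, -, hη1, -⟩ := exists_bump (d := d) (r := 2) (R := 3) (by norm_num)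
    (by norm_num)
  have hm : ContDiff ℝ (⊤ : ℕ∞) (fun ξ : EuclideanSpace ℝ (Fin d) => ((η ξ * ξ i : ℝ) : ℂ)) := by
    refine Complex.ofRealCLM.contDiff.comp (hη.mul ?_)
    fun_prop
  have hmc : HasCompactSupport (fun ξ : EuclideanSpace ℝ (Fin d) => ((η ξ * ξ i : ℝ) : ℂ)) := by
    refine hηc.mono ?_
    intro x hx h0
    apply hx
    simp [h0]
  obtain ⟨C, hC, hCb⟩ := mult_bound hm hmc
  refine ⟨C, hC, ?_⟩
  intro U hU p hp Λ a r t hr ht hsupp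
  have hp0 : 0 < p := by linarith
  set b : (Fin d → ℝ) → ℂ := fun lam => a lam * ((η (r⁻¹ • WithLp.toLp 2 lam) *
    (r⁻¹ • WithLp.toLp 2 lam : EuclideanSpace ℝ (Fin d)) i : ℝ) : ℂ) with hb
  have h1 := hCb U hU p hp Λ a b r⁻¹ (fun lam _ => rfl)
  have hbv : ∀ lam ∈ Λ, b lam = a lam * ((lam i / r : ℝ) : ℂ) := by
    intro lam hl
    by_cases h0 : a lam = 0
    · simp [hb, h0]
    have hn : ‖(r⁻¹ • WithLp.toLp 2 lam : EuclideanSpace ℝ (Fin d))‖ ≤ 2 := by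
      rw [norm_smul, norm_toLp, Real.norm_of_nonneg (by positivity), inv_mul_le_iff₀ hr]
      linarith [hsupp lam hl h0]
    simp only [hb]
    rw [hη1 _ hn]
    simp; left; ring
  set c : (Fin d → ℝ) → ℂ := fun lam => a lam *
    (Complex.exp (Complex.I * ((∑ k, lam k * (Pi.single i (-t) : Fin d → ℝ) k : ℝ) : ℂ)) - 1)
    with hcdef
  have hTc : ∀ x, T Λ a (x + Pi.single i (-t)) - T Λ a x = T Λ c x := by
    intro x
    rw [T_translate]
    simp only [T, hcdef]
    rw [← Finset.sum_sub_distrib]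
    exact Finset.sum_congr rfl fun lam _ => by ring
  have single_sum : ∀ (lam : Fin d → ℝ) (u : ℝ),
      ∑ k, lam k * (Pi.single i (-u) : Fin d → ℝ) k = - (lam i * u) := by
    intro lam u
    rw [Finset.sum_eq_single i]
    · simp
    · intro k _ hk; simp [hk]
    · simp
  have h2 : E U (fun x => ‖T Λ c x‖ ^ p) ≤
      (∫ _ : ℝ in Set.Ioc 0 t, ‖(-Complex.I * r : ℂ)‖) ^ p * E U (fun x => ‖T Λ b x‖ ^ p) := by
    refine kernel hU (μ := volume.restrict (Set.Ioc 0 t)) (ψ := fun _ => (-Complex.I * r : ℂ))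
      (integrable_const _) (v := fun u => Pi.single i (-u)) ?_ hp Λ b c ?_
    · refine measurable_pi_iff.2 fun k => ?_
      by_cases hk : k = i
      · subst hk; simpa using measurable_neg
      · simp [hk]
    intro lam hl
    rw [hbv lam hl, hcdef]
    simp only [single_sum]
    rw [← intervalIntegral.integral_of_le ht, intervalIntegral.integral_const_mul]
    by_cases hli : lam i = 0
    · simp [hli]
    have hne : (-Complex.I * lam i : ℂ) ≠ 0 := by simp [hli]
    have e : ∀ u : ℝ, Complex.exp (Complex.I * ((-(lam i * u) : ℝ) : ℂ)) =
        Complex.exp ((-Complex.I * lam i) * u) := by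
      intro u; congr 1; push_cast; ring
    simp_rw [e]
    rw [integral_exp_mul_complex hne]
    have hr' : (r : ℂ) ≠ 0 := by exact_mod_cast hr.ne'
    have hli' : (lam i : ℂ) ≠ 0 := by exact_mod_cast hli
    simp only [Complex.ofReal_zero, mul_zero, Complex.exp_zero]
    push_cast
    field_simp
  have e3 : ∫ _ : ℝ in Set.Ioc 0 t, ‖(-Complex.I * r : ℂ)‖ = t * r := by
    rw [setIntegral_const]; simp [ht, abs_of_pos hr]
  rw [e3] at h2
  simp_rw [hTc]
  refine h2.trans ?_
  rw [Real.mul_rpow hC (by positivity), mul_comm (C ^ p), mul_assoc]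
  exact mul_le_mul_of_nonneg_left h1 (by positivity)

lemma antidiff (d : ℕ) : ∃ C : ℝ, 0 ≤ C ∧ ∀ (U : Ultrafilter ℝ)
      (_ : (U : Filter ℝ) ≤ atTop) (p : ℝ) (_ : 2 ≤ p) (Λ : Finset (Fin d → ℝ))
      (a : (Fin d → ℝ) → ℂ) (r : ℝ) (_ : 0 < r)
      (_ : ∀ lam ∈ Λ, a lam ≠ 0 → r / 2 ≤ Real.sqrt (∑ i, lam i ^ 2) ∧
        Real.sqrt (∑ i, lam i ^ 2) ≤ 2 * r),
      ∃ b : Fin d → (Fin d → ℝ) → ℂ,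
        (∀ x, T Λ a x = ∑ i, (T Λ (b i) (x + Pi.single i (r⁻¹)) - T Λ (b i) x)) ∧
        ∀ i, E U (fun x => ‖T Λ (b i) x‖ ^ p) ≤ C ^ p * E U (fun x => ‖T Λ a x‖ ^ p) := by
  obtain ⟨η, hη, hηc, hη0, hηle, hη1, hη3⟩ := exists_bump (d := d) (r := 2) (R := 3) (by norm_num)
    (by norm_num)
  obtain ⟨β, hβ, -, hβ0, -, hβ1, hβ2⟩ := exists_bump (d := d) (r := 1 / 4) (R := 1 / 2)
    (by norm_num) (by norm_num)
  set D : EuclideanSpace ℝ (Fin d) → ℝ := fun ξ =>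
    (∑ j, (2 - 2 * Real.cos (ξ j))) + β ξ + (1 - η ξ) with hD
  have hs0 : ∀ ξ : EuclideanSpace ℝ (Fin d), ∀ j, 0 ≤ 2 - 2 * Real.cos (ξ j) := fun ξ j => by
    linarith [Real.cos_le_one (ξ j)]
  have hsum0 : ∀ ξ : EuclideanSpace ℝ (Fin d), 0 ≤ ∑ j, (2 - 2 * Real.cos (ξ j)) :=
    fun ξ => Finset.sum_nonneg fun j _ => hs0 ξ j
  have hDpos : ∀ ξ, 0 < D ξ := by
    intro ξ
    have a1 := hsum0 ξ
    have a2 := hβ0 ξ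
    have a3 := hηle ξ
    by_cases h3 : 3 ≤ ‖ξ‖
    · have := hη3 ξ h3
      simp only [hD]; linarith
    by_cases h0 : ξ = 0
    · have := hβ1 ξ (by rw [h0]; simp)
      simp only [hD]; linarith
    obtain ⟨j, hj⟩ : ∃ j, ξ j ≠ 0 := by
      by_contra hcon
      push Not at hcon
      exact h0 (by ext j; simp [hcon j])
    have hj3 : |ξ j| < 3 := lt_of_le_of_lt (PiLp.norm_apply_le ξ j) (not_le.1 h3)
    have hcos : Real.cos (ξ j) < 1 := by
      refine lt_of_le_of_ne (Real.cos_le_one _) fun hc => hj ?_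
      have := abs_lt.1 hj3
      have hpi := Real.pi_gt_three
      exact (Real.cos_eq_one_iff_of_lt_of_lt (by linarith) (by linarith)).1 hc
    have : 2 - 2 * Real.cos (ξ j) ≤ ∑ j, (2 - 2 * Real.cos (ξ j)) :=
      Finset.single_le_sum (f := fun j => 2 - 2 * Real.cos (ξ j)) (fun j _ => hs0 ξ j)
        (Finset.mem_univ j)
    simp only [hD]; linarith
  have hDs : ContDiff ℝ (⊤ : ℕ∞) D := by
    refine ((ContDiff.sum fun j _ => ?_).add hβ).add (contDiff_const.sub hη)
    refine contDiff_const.sub (contDiff_const.mul (Real.contDiff_cos.comp ?_))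
    fun_prop
  let m : Fin d → EuclideanSpace ℝ (Fin d) → ℂ := fun i ξ =>
    ((η ξ / D ξ : ℝ) : ℂ) * (Complex.exp (-Complex.I * (ξ i : ℂ)) - 1)
  have hm : ∀ i, ContDiff ℝ (⊤ : ℕ∞) (m i) := by
    intro i
    refine (Complex.ofRealCLM.contDiff.comp (hη.div hDs fun ξ => (hDpos ξ).ne')).mul ?_
    refine ContDiff.sub (ContDiff.cexp (contDiff_const.mul
      (Complex.ofRealCLM.contDiff.comp ?_))) contDiff_const
    fun_prop
  have hmc : ∀ i, HasCompactSupport (m i) := by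
    intro i
    refine hηc.mono ?_
    intro x hx h0
    apply hx
    simp [m, h0]
  choose C hC hCb using fun i => mult_bound (hm i) (hmc i)
  refine ⟨∑ i, C i, Finset.sum_nonneg fun i _ => hC i, ?_⟩
  intro U hU p hp Λ a r hr hsupp
  have hp0 : 0 < p := by linarith
  refine ⟨fun i lam => a lam * m i (r⁻¹ • WithLp.toLp 2 lam), ?_, ?_⟩
  · intro x
    simp_rw [T_translate]
    simp only [T]
    simp_rw [← Finset.sum_sub_distrib]
    rw [Finset.sum_comm]
    refine Finset.sum_congr rfl fun lam hl => ?_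
    by_cases h0 : a lam = 0
    · simp [h0]
    obtain ⟨hs1, hs2⟩ := hsupp lam hl h0
    set ξ : EuclideanSpace ℝ (Fin d) := r⁻¹ • WithLp.toLp 2 lam with hξ
    have hξi : ∀ i, ξ i = r⁻¹ * lam i := fun i => by simp [hξ]
    have hn : ‖ξ‖ = r⁻¹ * Real.sqrt (∑ i, lam i ^ 2) := by
      rw [hξ, norm_smul, norm_toLp, Real.norm_of_nonneg (by positivity)]
    have hn1 : 1 / 2 ≤ ‖ξ‖ := by
      rw [hn, le_inv_mul_iff₀ hr]; linarith
    have hn2 : ‖ξ‖ ≤ 2 := by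
      rw [hn, inv_mul_le_iff₀ hr]; linarith
    have single_sum : ∀ i, ∑ k, lam k * (Pi.single i (r⁻¹) : Fin d → ℝ) k = ξ i := by
      intro i
      rw [Finset.sum_eq_single i]
      · rw [hξi]; simp; ring
      · intro k _ hk; simp [hk]
      · simp
    simp_rw [single_sum]
    have hDv : D ξ = ∑ j, (2 - 2 * Real.cos (ξ j)) := by
      simp only [hD]; rw [hβ2 ξ hn1, hη1 ξ hn2]; ring
    have cross : ∀ i, (Complex.exp (-Complex.I * (ξ i : ℂ)) - 1) *
        (Complex.exp (Complex.I * (ξ i : ℂ)) - 1) = ((2 - 2 * Real.cos (ξ i) : ℝ) : ℂ) := by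
      intro i
      have e1 : Complex.exp (-Complex.I * (ξ i : ℂ)) * Complex.exp (Complex.I * (ξ i : ℂ)) = 1 := by
        rw [← Complex.exp_add]; simp
      have e2 : Complex.exp (-Complex.I * (ξ i : ℂ)) + Complex.exp (Complex.I * (ξ i : ℂ)) =
          2 * Complex.cos (ξ i) := by
        rw [Complex.two_cos]; rw [add_comm]; congr 2 <;> ring
      push_cast
      linear_combination e1 - e2
    have tot : ∑ i, m i ξ * (Complex.exp (Complex.I * (ξ i : ℂ)) - 1) = 1 := by
      simp only [m, mul_assoc, cross]
      rw [← Finset.mul_sum, ← Complex.ofReal_sum, ← hDv, hη1 ξ hn2, ← Complex.ofReal_mul]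
      rw [one_div, inv_mul_cancel₀ (hDpos ξ).ne']; simp
    calc a lam * Complex.exp (Complex.I * ((∑ i, lam i * x i : ℝ) : ℂ)) =
        (∑ i, m i ξ * (Complex.exp (Complex.I * (ξ i : ℂ)) - 1)) *
          (a lam * Complex.exp (Complex.I * ((∑ i, lam i * x i : ℝ) : ℂ))) := by rw [tot, one_mul]
      _ = _ := by
        rw [Finset.sum_mul]
        exact Finset.sum_congr rfl fun i _ => by ring
  · intro i
    refine (hCb i U hU p hp Λ a _ r⁻¹ (fun lam _ => rfl)).trans ?_
    have hE : 0 ≤ E U (fun x => ‖T Λ a x‖ ^ p) :=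
      E_nonneg hU ((BC_T Λ a).norm_rpow hp0.le) fun x => by positivity
    refine mul_le_mul_of_nonneg_right (Real.rpow_le_rpow (hC i) ?_ hp0.le) hE
    exact Finset.single_le_sum (fun j _ => hC j) (Finset.mem_univ i)

end LPaux


namespace LPaux

variable {d : ℕ}

/-- one-step linear term -/
lemma linear_term (d : ℕ) : ∃ C : ℝ, 0 ≤ C ∧ ∀ (U : Ultrafilter ℝ)
      (_ : (U : Filter ℝ) ≤ atTop) (p : ℝ) (_ : 2 ≤ p) (Λ : Finset (Fin d → ℝ))
      (a : ℕ → (Fin d → ℝ) → ℂ) (n : ℕ → ℝ) (_ : ∀ k, 0 ≤ n k)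
      (_ : ∀ k, E U (fun x => ‖T Λ (a k) x‖ ^ p) ≤ n k ^ p)
      (_ : ∀ k, ∀ lam ∈ Λ, a k lam ≠ 0 → Real.sqrt (∑ i, lam i ^ 2) ≤ 2 * 2 ^ k)
      (k : ℕ) (_ : ∀ lam ∈ Λ, a k lam ≠ 0 → 2 ^ k / 2 ≤ Real.sqrt (∑ i, lam i ^ 2))
      (M : ℝ) (_ : 0 ≤ M)
      (_ : E U (fun x => ‖∑ j ∈ Finset.range k, T Λ (a j) x‖ ^ p) ≤ M ^ p),
      E U (fun x => (starRingEnd ℂ (G (p - 2) (∑ j ∈ Finset.range k, T Λ (a j) x)) *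
        T Λ (a k) x).re) ≤
        C * p * M ^ (p - 2) * ((∑ j ∈ Finset.range k, 2 ^ j / 2 ^ k * n j) * n k) := by
  choose C1 hC1 hb1 using fun i : Fin d => bernstein_diff i
  obtain ⟨C2, hC2, hb2⟩ := antidiff d
  refine ⟨∑ i, 2 * C1 i * C2, Finset.sum_nonneg fun i _ => by have := hC1 i; positivity, ?_⟩
  intro U hU p hp Λ a n hn hEn hup k hlo M hM hSM
  have hp0 : 0 < p := by linarith
  have hq : 0 ≤ p - 2 := by linarith
  have h2k : (0:ℝ) < 2 ^ k := by positivity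
  obtain ⟨b, hrep, hbE⟩ := hb2 U hU p hp Λ (a k) (2 ^ k) h2k
    (fun lam hl h0 => ⟨hlo lam hl h0, hup k lam hl h0⟩)
  set S : (Fin d → ℝ) → ℂ := fun x => ∑ j ∈ Finset.range k, T Λ (a j) x with hS
  have bS : BC S := BC.sum _ fun j _ => BC_T Λ (a j)
  have bGS : BC (fun x => starRingEnd ℂ (G (p - 2) (S x))) := (bS.G hq).conj
  have bh : ∀ i, BC (T Λ (b i)) := fun i => BC_T Λ (b i)
  have hbE' : ∀ i, E U (fun x => ‖T Λ (b i) x‖ ^ p) ≤ (C2 * n k) ^ p := by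
    intro i
    refine (hbE i).trans ?_
    rw [Real.mul_rpow hC2 (hn k)]
    exact mul_le_mul_of_nonneg_left (hEn k) (by positivity)
  set t : ℝ := (2 ^ k)⁻¹ with ht
  have ht0 : 0 ≤ t := by positivity
  -- decomposition
  have e1 : (fun x => (starRingEnd ℂ (G (p - 2) (S x)) * T Λ (a k) x).re) = fun x =>
      ∑ i, ((starRingEnd ℂ (G (p - 2) (S x)) * T Λ (b i) (x + Pi.single i t)).re -
        (starRingEnd ℂ (G (p - 2) (S x)) * T Λ (b i) x).re) := by
    ext x
    rw [hrep x, Finset.mul_sum, Complex.re_sum]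
    exact Finset.sum_congr rfl fun i _ => by rw [mul_sub, Complex.sub_re]
  have bA : ∀ i, BC (fun x => (starRingEnd ℂ (G (p - 2) (S x)) *
      T Λ (b i) (x + Pi.single i t)).re) := fun i => (bGS.mul ((bh i).translate _)).re
  have bB : ∀ i, BC (fun x => (starRingEnd ℂ (G (p - 2) (S x)) *
      T Λ (b i) x).re) := fun i => (bGS.mul (bh i)).re
  rw [e1, E_sum hU _ fun i _ => (bA i).sub (bB i)]
  rw [Finset.sum_mul, Finset.sum_mul, Finset.sum_mul]
  refine Finset.sum_le_sum fun i _ => ?_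
  rw [E_sub hU (bA i) (bB i)]
  set e' : Fin d → ℝ := Pi.single i (-t) with he'
  have hcancel : ∀ x : Fin d → ℝ, x + Pi.single i t + e' = x := by
    intro x
    rw [he', add_assoc, ← Pi.single_add]; simp
  have bA' : BC (fun x => (starRingEnd ℂ (G (p - 2) (S (x + e'))) * T Λ (b i) x).re) :=
    ((bGS.translate e').mul (bh i)).re
  have e2 : E U (fun x => (starRingEnd ℂ (G (p - 2) (S x)) * T Λ (b i) (x + Pi.single i t)).re) =
      E U (fun x => (starRingEnd ℂ (G (p - 2) (S (x + e'))) * T Λ (b i) x).re) := by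
    rw [← E_translate hU bA' (Pi.single i t)]
    simp only [hcancel]
  rw [e2, ← E_sub hU bA' (bB i)]
  set Δ : ℕ → (Fin d → ℝ) → ℂ := fun j x => T Λ (a j) (x + e') - T Λ (a j) x with hΔ
  have bΔ : ∀ j, BC (Δ j) := fun j => ((BC_T Λ (a j)).translate e').sub (BC_T Λ (a j))
  have bSe : BC (fun x => S (x + e')) := bS.translate e'
  have pt : ∀ x, (starRingEnd ℂ (G (p - 2) (S (x + e'))) * T Λ (b i) x).re -
      (starRingEnd ℂ (G (p - 2) (S x)) * T Λ (b i) x).re ≤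
      ∑ j ∈ Finset.range k, p * (‖S (x + e')‖ ^ (p - 2) * ‖Δ j x‖ * ‖T Λ (b i) x‖ +
        ‖S x‖ ^ (p - 2) * ‖Δ j x‖ * ‖T Λ (b i) x‖) := by
    intro x
    rw [← Complex.sub_re, ← sub_mul, ← map_sub]
    refine (Complex.re_le_norm _).trans ?_
    rw [norm_mul, RCLike.norm_conj]
    have h1 := G_lip hq (S (x + e')) (S x)
    have e3 : 2 + (p - 2) = p := by ring
    rw [e3] at h1
    have h2 : ‖S (x + e') - S x‖ ≤ ∑ j ∈ Finset.range k, ‖Δ j x‖ := by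
      simp only [hS, hΔ]
      rw [← Finset.sum_sub_distrib]
      exact norm_sum_le _ _
    have h3 : 0 ≤ p * (‖S (x + e')‖ ^ (p - 2) + ‖S x‖ ^ (p - 2)) := by positivity
    calc ‖G (p - 2) (S (x + e')) - G (p - 2) (S x)‖ * ‖T Λ (b i) x‖
        ≤ p * (‖S (x + e')‖ ^ (p - 2) + ‖S x‖ ^ (p - 2)) * (∑ j ∈ Finset.range k, ‖Δ j x‖) *
          ‖T Λ (b i) x‖ := by
          refine mul_le_mul_of_nonneg_right (h1.trans ?_) (norm_nonneg _)
          exact mul_le_mul_of_nonneg_left h2 h3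
      _ = _ := by
          rw [Finset.mul_sum, Finset.sum_mul]
          exact Finset.sum_congr rfl fun j _ => by ring
  have b1 : ∀ j, BC (fun x => ‖S (x + e')‖ ^ (p - 2) * ‖Δ j x‖ * ‖T Λ (b i) x‖) := fun j =>
    ((bSe.norm_rpow hq).mul (bΔ j).norm).mul (bh i).norm
  have b2 : ∀ j, BC (fun x => ‖S x‖ ^ (p - 2) * ‖Δ j x‖ * ‖T Λ (b i) x‖) := fun j =>
    ((bS.norm_rpow hq).mul (bΔ j).norm).mul (bh i).norm
  have b3 : ∀ j, BC (fun x => p * (‖S (x + e')‖ ^ (p - 2) * ‖Δ j x‖ * ‖T Λ (b i) x‖ +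
        ‖S x‖ ^ (p - 2) * ‖Δ j x‖ * ‖T Λ (b i) x‖)) := fun j =>
    (BC.const p).mul ((b1 j).add (b2 j))
  refine (E_mono hU (bA'.sub (bB i)) (BC.sum (Finset.range k) fun j _ => b3 j) pt).trans ?_
  rw [E_sum hU _ fun j _ => b3 j, Finset.sum_mul, Finset.mul_sum]
  refine Finset.sum_le_sum fun j _ => ?_
  rw [E_const_mul hU _ ((b1 j).add (b2 j)), E_add hU (b1 j) (b2 j)]
  have hC1i := hC1 i
  have hnj := hn j
  have hnk := hn k
  have hEΔ : E U (fun x => ‖Δ j x‖ ^ p) ≤ (C1 i * (t * 2 ^ j) * n j) ^ p := by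
    refine (hb1 i U hU p hp Λ (a j) (2 ^ j) t (by positivity) ht0 (hup j)).trans ?_
    rw [Real.mul_rpow (by positivity) (hn j)]
    exact mul_le_mul_of_nonneg_left (hEn j) (by positivity)
  have hSM' : E U (fun x => ‖S (x + e')‖ ^ p) ≤ M ^ p := by
    rw [E_translate hU (bS.norm_rpow hp0.le) e']; exact hSM
  have H1 := E_holder hU hp bSe (bΔ j) (bh i) hM (by positivity) (by positivity) hSM' hEΔ (hbE' i)
  have H2 := E_holder hU hp bS (bΔ j) (bh i) hM (by positivity) (by positivity) hSM hEΔ (hbE' i)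
  calc _ ≤ p * (M ^ (p - 2) * (C1 i * (t * 2 ^ j) * n j) * (C2 * n k) +
        M ^ (p - 2) * (C1 i * (t * 2 ^ j) * n j) * (C2 * n k)) := by gcongr
    _ = _ := by rw [ht]; ring

lemma schur (n : ℕ → ℝ) (K : ℕ) :
    ∑ k ∈ Finset.range K, (∑ j ∈ Finset.range k, 2 ^ j / 2 ^ k * n j) * n k ≤
      ∑ k ∈ Finset.range K, n k ^ 2 := by
  set b : ℕ → ℝ := fun k => ∑ j ∈ Finset.range k, 2 ^ j / 2 ^ k * n j with hb
  have hrec : ∀ k, b (k + 1) = (b k + n k) / 2 := by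
    intro k
    simp only [hb]
    rw [Finset.sum_range_succ, add_div, Finset.sum_div]
    congr 1
    · exact Finset.sum_congr rfl fun j _ => by rw [pow_succ]; field_simp
    · rw [pow_succ]; field_simp
  have : ∑ k ∈ Finset.range K, b k * n k + b K ^ 2 ≤ ∑ k ∈ Finset.range K, n k ^ 2 := by
    induction K with
    | zero => simp [hb]
    | succ K ih =>
      rw [Finset.sum_range_succ, Finset.sum_range_succ, hrec]
      nlinarith [sq_nonneg (b K - n K)]
  nlinarith [sq_nonneg (b K)]

theorem core (d : ℕ) (p : ℝ) (hp : 2 ≤ p) : ∃ C : ℝ, 0 < C ∧ ∀ (U : Ultrafilter ℝ)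
      (_ : (U : Filter ℝ) ≤ atTop) (Λ : Finset (Fin d → ℝ))
      (a : ℕ → (Fin d → ℝ) → ℂ) (n : ℕ → ℝ) (_ : ∀ k, 0 ≤ n k)
      (_ : ∀ k, E U (fun x => ‖T Λ (a k) x‖ ^ p) ≤ n k ^ p)
      (_ : ∀ k, ∀ lam ∈ Λ, a k lam ≠ 0 → Real.sqrt (∑ i, lam i ^ 2) ≤ 2 * 2 ^ k)
      (_ : ∀ k, k ≠ 0 → ∀ lam ∈ Λ, a k lam ≠ 0 → 2 ^ k / 2 ≤ Real.sqrt (∑ i, lam i ^ 2))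
      (K : ℕ),
      E U (fun x => ‖∑ j ∈ Finset.range K, T Λ (a j) x‖ ^ p) ≤
        (C * Real.sqrt (∑ k ∈ Finset.range K, n k ^ 2)) ^ p := by
  obtain ⟨C0, hC0, hlin⟩ := linear_term d
  have hp0 : 0 < p := by linarith
  have hq : 0 ≤ p - 2 := by linarith
  set Q : ℝ := p * p * (2 + C0) with hQ
  have hQ0 : 0 < Q := by positivity
  refine ⟨Real.sqrt Q, Real.sqrt_pos.2 hQ0, ?_⟩
  intro U hU Λ a n hn hEn hup hlo K
  set S : ℕ → (Fin d → ℝ) → ℂ := fun k x => ∑ j ∈ Finset.range k, T Λ (a j) x with hS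
  have bS : ∀ k, BC (S k) := fun k => BC.sum _ fun j _ => BC_T Λ (a j)
  have bSp : ∀ k, BC (fun x => ‖S k x‖ ^ p) := fun k => (bS k).norm_rpow hp0.le
  have hE0 : ∀ k, 0 ≤ E U (fun x => ‖S k x‖ ^ p) := fun k => E_nonneg hU (bSp k)
    fun x => by positivity
  obtain ⟨k0, hk0, hmax⟩ := Finset.exists_max_image (Finset.range (K + 1))
    (fun k => E U (fun x => ‖S k x‖ ^ p)) ⟨0, by simp⟩
  set M : ℝ := (E U (fun x => ‖S k0 x‖ ^ p)) ^ (1 / p) with hM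
  have hM0 : 0 ≤ M := Real.rpow_nonneg (hE0 k0) _
  have hMp : M ^ p = E U (fun x => ‖S k0 x‖ ^ p) := by
    rw [hM, ← Real.rpow_mul (hE0 k0), one_div, inv_mul_cancel₀ hp0.ne', Real.rpow_one]
  have hSM : ∀ k ≤ K, E U (fun x => ‖S k x‖ ^ p) ≤ M ^ p := by
    intro k hk
    rw [hMp]; exact hmax k (by simp; omega)
  set β : ℕ → ℝ := fun k => ∑ j ∈ Finset.range k, 2 ^ j / 2 ^ k * n j with hβ
  have hβ0 : ∀ k, 0 ≤ β k := fun k => Finset.sum_nonneg fun j _ => by have := hn j; positivity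
  have lin : ∀ k < K, E U (fun x => (starRingEnd ℂ (G (p - 2) (S k x)) * T Λ (a k) x).re) ≤
      C0 * p * M ^ (p - 2) * (β k * n k) := by
    intro k hk
    rcases Nat.eq_zero_or_pos k with rfl | hkp
    · have : (fun x => (starRingEnd ℂ (G (p - 2) (S 0 x)) * T Λ (a 0) x).re) = fun _ => 0 := by
        ext x; simp [hS, G]
      rw [this, E_zero hU]
      have := hβ0 0
      have := hn 0
      positivity
    · exact hlin U hU p hp Λ a n hn hEn hup k (hlo k (by omega)) M hM0 (hSM k hk.le)
  have step : ∀ k < K, E U (fun x => ‖S (k + 1) x‖ ^ p) ≤ E U (fun x => ‖S k x‖ ^ p) +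
      M ^ (p - 2) * (p * p * (2 * n k ^ 2 + C0 * (β k * n k))) := by
    intro k hk
    have hsucc : ∀ x, S (k + 1) x = S k x + T Λ (a k) x := fun x => by
      simp only [hS]; rw [Finset.sum_range_succ]
    have bT := BC_T Λ (a k)
    have bL : BC (fun x => (starRingEnd ℂ (G (p - 2) (S k x)) * T Λ (a k) x).re) :=
      ((((bS k).G hq).conj).mul bT).re
    have bR1 : BC (fun x => ‖S (k + 1) x‖ ^ (p - 2) * ‖T Λ (a k) x‖ * ‖T Λ (a k) x‖) :=
      (((bS (k + 1)).norm_rpow hq).mul bT.norm).mul bT.norm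
    have bR2 : BC (fun x => ‖S k x‖ ^ (p - 2) * ‖T Λ (a k) x‖ * ‖T Λ (a k) x‖) :=
      (((bS k).norm_rpow hq).mul bT.norm).mul bT.norm
    have pt : ∀ x, ‖S (k + 1) x‖ ^ p ≤ ‖S k x‖ ^ p +
        p * (starRingEnd ℂ (G (p - 2) (S k x)) * T Λ (a k) x).re +
        p * p * (‖S (k + 1) x‖ ^ (p - 2) * ‖T Λ (a k) x‖ * ‖T Λ (a k) x‖ +
          ‖S k x‖ ^ (p - 2) * ‖T Λ (a k) x‖ * ‖T Λ (a k) x‖) := by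
      intro x
      rw [hsucc]; exact taylor_p hp _ _
    have h1 := E_mono hU (bSp (k + 1)) (((bSp k).add ((BC.const p).mul bL)).add
      ((BC.const (p * p)).mul (bR1.add bR2))) pt
    rw [E_add hU ((bSp k).add ((BC.const p).mul bL)) ((BC.const (p * p)).mul (bR1.add bR2)),
      E_add hU (bSp k) ((BC.const p).mul bL), E_const_mul hU _ bL,
      E_const_mul hU _ (bR1.add bR2), E_add hU bR1 bR2] at h1
    have H1 := E_holder hU hp (bS (k + 1)) bT bT hM0 (hn k) (hn k) (hSM (k + 1) hk) (hEn k) (hEn k)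
    have H2 := E_holder hU hp (bS k) bT bT hM0 (hn k) (hn k) (hSM k hk.le) (hEn k) (hEn k)
    have H3 := lin k hk
    refine h1.trans ?_
    calc _ ≤ E U (fun x => ‖S k x‖ ^ p) + p * (C0 * p * M ^ (p - 2) * (β k * n k)) +
          p * p * (M ^ (p - 2) * n k * n k + M ^ (p - 2) * n k * n k) := by gcongr
      _ = _ := by ring
  have sumup : ∀ k ≤ K, E U (fun x => ‖S k x‖ ^ p) ≤
      M ^ (p - 2) * (p * p * (2 * ∑ j ∈ Finset.range k, n j ^ 2 +
        C0 * ∑ j ∈ Finset.range k, β j * n j)) := by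
    intro k
    induction k with
    | zero =>
      intro _
      have : (fun x => ‖S 0 x‖ ^ p) = fun _ => 0 := by
        ext x; simp [hS, Real.zero_rpow hp0.ne']
      rw [this, E_zero hU]; simp
    | succ k ih =>
      intro hk
      rw [Finset.sum_range_succ, Finset.sum_range_succ]
      have := ih (by omega)
      have := step k (by omega)
      nlinarith
  set A2 : ℝ := ∑ k ∈ Finset.range K, n k ^ 2 with hA2
  have hA20 : 0 ≤ A2 := Finset.sum_nonneg fun k _ => sq_nonneg _
  have hk0K : k0 ≤ K := by simp at hk0; omega
  have fin : M ^ p ≤ M ^ (p - 2) * (Q * A2) := by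
    rw [hMp]
    refine (sumup k0 hk0K).trans ?_
    have hMq : 0 ≤ M ^ (p - 2) := by positivity
    have s1 := schur n k0
    have s2 : ∑ j ∈ Finset.range k0, n j ^ 2 ≤ A2 :=
      Finset.sum_le_sum_of_subset_of_nonneg (Finset.range_mono hk0K) fun _ _ _ => sq_nonneg _
    have s3 : ∑ j ∈ Finset.range k0, β j * n j ≤ A2 := s1.trans s2
    refine mul_le_mul_of_nonneg_left ?_ hMq
    calc p * p * (2 * ∑ j ∈ Finset.range k0, n j ^ 2 + C0 * ∑ j ∈ Finset.range k0, β j * n j)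
        ≤ p * p * (2 * A2 + C0 * A2) := by gcongr
      _ = _ := by rw [hQ]; ring
  have hMle : M ≤ Real.sqrt Q * Real.sqrt A2 := by
    rw [← Real.sqrt_mul hQ0.le]
    apply Real.le_sqrt_of_sq_le
    rcases hM0.eq_or_lt with h | h
    · rw [← h]; simp; positivity
    have hMq : 0 < M ^ (p - 2) := by positivity
    have : M ^ p = M ^ (p - 2) * M ^ 2 := by
      rw [← Real.rpow_natCast, ← Real.rpow_add h]; norm_num
    rw [this] at fin
    exact le_of_mul_le_mul_left fin hMq
  exact (hSM K le_rfl).trans (Real.rpow_le_rpow hM0 hMle hp0.le)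

end LPaux


namespace LPaux

variable {d : ℕ}

lemma chi_sum (χ : ℝ → ℝ) (K : ℕ) (r : ℝ) :
    ∑ k ∈ Finset.range (K + 1), chiDyadic χ k r = χ (r / 2 ^ K) := by
  induction K with
  | zero => simp [chiDyadic]
  | succ K ih =>
    rw [Finset.sum_range_succ, ih, chiDyadic, if_neg (by omega)]
    have : 2 * r / 2 ^ (K + 1) = r / 2 ^ K := by rw [pow_succ]; field_simp
    rw [this]; ring

lemma chi_upper {χ : ℝ → ℝ} (hχsupp : Function.support χ ⊆ Set.Ioo (-2 : ℝ) 2) {k : ℕ} {r : ℝ}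
    (h : chiDyadic χ k r ≠ 0) : r ≤ 2 * 2 ^ k := by
  by_contra hcon
  push Not at hcon
  have hk : (0:ℝ) < 2 ^ k := by positivity
  have h0 : ∀ s : ℝ, 2 ≤ s → χ s = 0 := by
    intro s hs
    by_contra hne
    have := (hχsupp hne).2
    linarith
  have h1 : 2 ≤ r / 2 ^ k := by rw [le_div_iff₀ hk]; linarith
  have h2 : 2 ≤ 2 * r / 2 ^ k := by rw [mul_div_assoc]; linarith
  apply h
  unfold chiDyadic
  split_ifs with hk0
  · subst hk0; exact h0 _ (by simpa using h1)
  · rw [h0 _ h1, h0 _ h2, sub_zero]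

lemma chi_lower {χ : ℝ → ℝ} (hχone : ∀ r ∈ Set.Icc (-1 : ℝ) 1, χ r = 1) {k : ℕ} (hk0 : k ≠ 0)
    {r : ℝ} (hr : 0 ≤ r) (h : chiDyadic χ k r ≠ 0) : 2 ^ k / 2 ≤ r := by
  by_contra hcon
  push Not at hcon
  have hk : (0:ℝ) < 2 ^ k := by positivity
  apply h
  rw [chiDyadic, if_neg hk0]
  have p1 : 0 ≤ r / 2 ^ k := by positivity
  have p2 : 0 ≤ 2 * r / 2 ^ k := by positivity
  have h2 : 2 * r / 2 ^ k ≤ 1 := by rw [div_le_iff₀ hk]; linarith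
  have h1 : r / 2 ^ k ≤ 1 := by rw [mul_div_assoc] at h2 p2; linarith
  rw [hχone _ ⟨by linarith, h1⟩, hχone _ ⟨by linarith, h2⟩, sub_self]

/-- the mean norm at scale `L` -/
noncomputable def mn (p : ℝ) (Λ : Finset (Fin d → ℝ)) (a : (Fin d → ℝ) → ℂ) (L : ℝ) : ℝ :=
  (avg d L (fun x => ‖T Λ a x‖ ^ p)) ^ (1 / p)

lemma mn_bdd {p : ℝ} (hp : 2 ≤ p) (Λ : Finset (Fin d → ℝ)) (a : (Fin d → ℝ) → ℂ) :
    ∃ B : ℝ, ∀ᶠ L in atTop, 0 ≤ mn p Λ a L ∧ mn p Λ a L ≤ B := by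
  have hp0 : 0 < p := by linarith
  obtain ⟨c, B, hB⟩ := (BC_T Λ a).norm_rpow hp0.le
  refine ⟨B ^ (1 / p), ?_⟩
  filter_upwards [eventually_gt_atTop 0] with L hL
  have h0 : 0 ≤ avg d L (fun x => ‖T Λ a x‖ ^ p) := by
    rw [← avg_const (d := d) hL 0]
    exact avg_mono hL.le continuous_const c fun x => by positivity
  exact ⟨Real.rpow_nonneg h0 _, Real.rpow_le_rpow h0 (avg_bound hL c hB).2 (by positivity)⟩

lemma mn_tendsto {p : ℝ} (hp : 2 ≤ p) (Λ : Finset (Fin d → ℝ)) (a : (Fin d → ℝ) → ℂ)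
    {U : Ultrafilter ℝ} (hU : (U : Filter ℝ) ≤ atTop) :
    Tendsto (mn p Λ a) U (nhds ((E U (fun x => ‖T Λ a x‖ ^ p)) ^ (1 / p))) := by
  have hp0 : 0 < p := by linarith
  exact ((Real.continuous_rpow_const (by positivity)).tendsto _).comp
    (E_tendsto hU ((BC_T Λ a).norm_rpow hp0.le))

lemma E_le_limsup {p : ℝ} (hp : 2 ≤ p) (Λ : Finset (Fin d → ℝ)) (a : (Fin d → ℝ) → ℂ)
    {U : Ultrafilter ℝ} (hU : (U : Filter ℝ) ≤ atTop) :
    (E U (fun x => ‖T Λ a x‖ ^ p)) ^ (1 / p) ≤ limsup (mn p Λ a) atTop := by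
  obtain ⟨B, hB⟩ := mn_bdd hp Λ a
  have ht := mn_tendsto hp Λ a hU
  rw [← ht.limsup_eq]
  exact limsup_le_limsup_of_le hU ht.isCoboundedUnder_le
    ⟨B, eventually_map.2 (hB.mono fun L h => h.2)⟩

lemma limsup_nonneg {p : ℝ} (hp : 2 ≤ p) (Λ : Finset (Fin d → ℝ)) (a : (Fin d → ℝ) → ℂ) :
    0 ≤ limsup (mn p Λ a) atTop := by
  have hp0 : 0 < p := by linarith
  have hU : ((Ultrafilter.of atTop : Ultrafilter ℝ) : Filter ℝ) ≤ atTop := Ultrafilter.of_le _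
  refine le_trans (Real.rpow_nonneg ?_ _) (E_le_limsup hp Λ a hU)
  exact E_nonneg hU ((BC_T Λ a).norm_rpow hp0.le) fun x => by positivity

lemma limsup_le_of_ultra {p : ℝ} (hp : 2 ≤ p) (Λ : Finset (Fin d → ℝ)) (a : (Fin d → ℝ) → ℂ)
    {R : ℝ} (h : ∀ U : Ultrafilter ℝ, (U : Filter ℝ) ≤ atTop →
      (E U (fun x => ‖T Λ a x‖ ^ p)) ^ (1 / p) ≤ R) : limsup (mn p Λ a) atTop ≤ R := by
  obtain ⟨B, hB⟩ := mn_bdd hp Λ a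
  by_contra hcon
  push Not at hcon
  obtain ⟨R', h1, h2⟩ := exists_between hcon
  have hco : IsCoboundedUnder (· ≤ ·) atTop (mn p Λ a) :=
    IsBoundedUnder.isCoboundedUnder_le ⟨0, eventually_map.2 (hB.mono fun L h => h.1)⟩
  have hf : ∃ᶠ L in atTop, R' < mn p Λ a L := frequently_lt_of_lt_limsup hco h2
  have hne : (atTop ⊓ 𝓟 {L : ℝ | R' < mn p Λ a L}).NeBot := frequently_iff_neBot.1 hf
  have hle := Ultrafilter.of_le (atTop ⊓ 𝓟 {L : ℝ | R' < mn p Λ a L})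
  have hU := hle.trans inf_le_left
  have hev : ∀ᶠ L in ((Ultrafilter.of (atTop ⊓ 𝓟 {L : ℝ | R' < mn p Λ a L}) :
      Ultrafilter ℝ) : Filter ℝ), R' ≤ mn p Λ a L := by
    have := le_principal_iff.1 (hle.trans inf_le_right)
    filter_upwards [this] with L hL using le_of_lt hL
  have := ge_of_tendsto (mn_tendsto hp Λ a hU) hev
  have := h _ hU
  linarith

end LPaux

/-- Littlewood–Paley decomposition for mean `L^p` norms of almost-periodic
trigonometric polynomials (Proposition 4.1). -/
theorem littlewood_paley_mean_Lp
    (d : ℕ) (p : ℝ) (hp : 2 ≤ p)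
    (χ : ℝ → ℝ)
    (hχsmooth : ContDiff ℝ (⊤ : ℕ∞) χ)
    (hχsupp : Function.support χ ⊆ Set.Ioo (-2 : ℝ) 2)
    (hχone : ∀ r ∈ Set.Icc (-1 : ℝ) 1, χ r = 1)
    (hχeven : ∀ r : ℝ, χ (-r) = χ r)
    (hχmono : AntitoneOn χ (Set.Ici (0 : ℝ))) :
    ∃ C : ℝ, 0 < C ∧
      ∀ (Λ₀ : Finset (Fin d → ℝ)) (a : (Fin d → ℝ) → ℂ),
      limsup (fun L : ℝ =>
          ((1 / (2 * L) ^ d) *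
            ∫ x in (Set.univ.pi fun _ : Fin d => Set.Icc (-L) L),
              ‖∑ lam ∈ Λ₀, a lam *
                Complex.exp (Complex.I * ((∑ i, lam i * x i : ℝ) : ℂ))‖ ^ p)
            ^ (1 / p)) atTop
        ≤ C * (∑' k : ℕ,
            (limsup (fun L : ℝ =>
              ((1 / (2 * L) ^ d) *
                ∫ x in (Set.univ.pi fun _ : Fin d => Set.Icc (-L) L),
                  ‖∑ lam ∈ Λ₀,
                    (chiDyadic χ k (Real.sqrt (∑ i, lam i ^ 2)) : ℂ) * a lam *
                      Complex.exp (Complex.I * ((∑ i, lam i * x i : ℝ) : ℂ))‖ ^ p)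
                ^ (1 / p)) atTop) ^ 2) ^ ((1 : ℝ) / 2) := by
  obtain ⟨C, hC, hcore⟩ := LPaux.core d p hp
  refine ⟨C, hC, fun Λ a => ?_⟩
  have hp0 : 0 < p := by linarith
  set ak : ℕ → (Fin d → ℝ) → ℂ := fun k lam =>
    (chiDyadic χ k (Real.sqrt (∑ i, lam i ^ 2)) : ℂ) * a lam with hak
  set n : ℕ → ℝ := fun k => limsup (LPaux.mn p Λ (ak k)) atTop with hn
  change limsup (LPaux.mn p Λ a) atTop ≤ C * (∑' k : ℕ, n k ^ 2) ^ ((1 : ℝ) / 2)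
  have hn0 : ∀ k, 0 ≤ n k := fun k => LPaux.limsup_nonneg hp Λ (ak k)
  -- a large scale
  obtain ⟨K, hK⟩ : ∃ K : ℕ, ∀ lam ∈ Λ, Real.sqrt (∑ i, lam i ^ 2) ≤ 2 ^ K := by
    obtain ⟨K, hK⟩ := pow_unbounded_of_one_lt
      (∑ lam ∈ Λ, Real.sqrt (∑ i, lam i ^ 2)) (one_lt_two (α := ℝ))
    refine ⟨K, fun lam hl => le_trans ?_ hK.le⟩
    exact Finset.single_le_sum (f := fun lam : Fin d → ℝ => Real.sqrt (∑ i, lam i ^ 2))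
      (fun _ _ => Real.sqrt_nonneg _) hl
  have hsum : ∀ x, ∑ k ∈ Finset.range (K + 1), LPaux.T Λ (ak k) x = LPaux.T Λ a x := by
    intro x
    simp only [LPaux.T]
    rw [Finset.sum_comm]
    refine Finset.sum_congr rfl fun lam hl => ?_
    rw [← Finset.sum_mul]
    congr 1
    simp only [hak]
    rw [← Finset.sum_mul, ← Complex.ofReal_sum, LPaux.chi_sum, hχone, Complex.ofReal_one, one_mul]
    have h0 : 0 ≤ Real.sqrt (∑ i, lam i ^ 2) / 2 ^ K := by positivity
    exact ⟨by linarith, (div_le_one (by positivity)).2 (hK lam hl)⟩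
  have hzero : ∀ k, k ∉ Finset.range (K + 1) → n k ^ 2 = 0 := by
    intro k hk
    have hk' : K + 1 ≤ k := by simpa using hk
    have hT : ∀ x, LPaux.T Λ (ak k) x = 0 := by
      intro x
      refine Finset.sum_eq_zero fun lam hl => ?_
      have : chiDyadic χ k (Real.sqrt (∑ i, lam i ^ 2)) = 0 := by
        have e1 := LPaux.chi_sum χ k (Real.sqrt (∑ i, lam i ^ 2))
        obtain ⟨j, rfl⟩ : ∃ j, k = j + 1 := ⟨k - 1, by omega⟩
        rw [Finset.sum_range_succ, LPaux.chi_sum] at e1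
        have hle : ∀ m : ℕ, K ≤ m → χ (Real.sqrt (∑ i, lam i ^ 2) / 2 ^ m) = 1 := by
          intro m hm
          have h0 : 0 ≤ Real.sqrt (∑ i, lam i ^ 2) / 2 ^ m := by positivity
          refine hχone _ ⟨by linarith, (div_le_one (by positivity)).2 ((hK lam hl).trans ?_)⟩
          exact pow_le_pow_right₀ (by norm_num) hm
        rw [hle j (by omega), hle (j + 1) (by omega)] at e1
        linarith
      simp [hak, this]
    have hmn : LPaux.mn p Λ (ak k) = fun _ => 0 := by
      ext L
      have hp1 : (1 / p) ≠ 0 := by positivity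
      simp only [LPaux.mn, hT, LPaux.avg, norm_zero, Real.zero_rpow hp0.ne', integral_zero,
        mul_zero, Real.zero_rpow hp1]
    simp only [hn]
    rw [hmn]; simp
  rw [tsum_eq_sum hzero, ← Real.sqrt_eq_rpow]
  refine LPaux.limsup_le_of_ultra hp Λ a fun U hU => ?_
  have hEn : ∀ k, LPaux.E U (fun x => ‖LPaux.T Λ (ak k) x‖ ^ p) ≤ n k ^ p := by
    intro k
    have h0 : 0 ≤ LPaux.E U (fun x => ‖LPaux.T Λ (ak k) x‖ ^ p) :=
      LPaux.E_nonneg hU ((LPaux.BC_T Λ (ak k)).norm_rpow hp0.le) fun x => by positivity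
    have h1 := Real.rpow_le_rpow (Real.rpow_nonneg h0 _) (LPaux.E_le_limsup hp Λ (ak k) hU) hp0.le
    rwa [← Real.rpow_mul h0, one_div, inv_mul_cancel₀ hp0.ne', Real.rpow_one] at h1
  have hne : ∀ k lam, ak k lam ≠ 0 → chiDyadic χ k (Real.sqrt (∑ i, lam i ^ 2)) ≠ 0 := by
    intro k lam h h0
    apply h; simp [hak, h0]
  have key := hcore U hU Λ ak n hn0 hEn
    (fun k lam _ h => LPaux.chi_upper hχsupp (hne k lam h))
    (fun k hk lam _ h => LPaux.chi_lower hχone hk (Real.sqrt_nonneg _) (hne k lam h)) (K + 1)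
  simp only [hsum] at key
  have h0 : 0 ≤ LPaux.E U (fun x => ‖LPaux.T Λ a x‖ ^ p) :=
    LPaux.E_nonneg hU ((LPaux.BC_T Λ a).norm_rpow hp0.le) fun x => by positivity
  have h2 := Real.rpow_le_rpow h0 key (by positivity : 0 ≤ 1 / p)
  rwa [← Real.rpow_mul (by positivity), mul_one_div_cancel hp0.ne', Real.rpow_one] at h2
end

section
/- There exists an absolute constant C > 0 such that the following holds for every δ ∈ (0, 1/2). Let (F_k)_{k ∈ ℤ} be a family of Schwartz functions on ℝ², all but finitely many identically zero, such that for each k the Fourier transform of F_k is supported in the set {(ξ,η) ∈ ℝ² : |ξ| ≤ 1, k δ^{1/3} ≤ ξ ≤ (k+1) δ^{1/3}, |η − ξ³| ≤ δ}. Then ‖ ∑_k F_k ‖_{L⁴(ℝ²)} ≤ C ‖ ( ∑_k |F_k|² )^{1/2} ‖_{L⁴(ℝ²)}. (Córdoba–Fefferman square function estimate for the cubic curve, Theorem 2.2.) -/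
open MeasureTheory Filter
open scoped FourierTransform

/-- A Schur-test type bound for finite double sums. -/
lemma cf_schur {ι : Type*} [DecidableEq ι] (T : Finset ι) (a : ι → ℝ) (c : ι → ι → ℝ)
    (R : ι → ι → Prop) [∀ i j, Decidable (R i j)] (N : ℕ)
    (ha : ∀ i, 0 ≤ a i) (hsymm : ∀ i j, R i j → R j i)
    (hc : ∀ i ∈ T, ∀ j ∈ T, R i j → c i j ≤ (a i + a j) / 2)
    (hc0 : ∀ i ∈ T, ∀ j ∈ T, ¬ R i j → c i j ≤ 0)
    (hN : ∀ i ∈ T, (T.filter (fun j => R i j)).card ≤ N) :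
    ∑ i ∈ T, ∑ j ∈ T, c i j ≤ N * ∑ i ∈ T, a i := by
  have h1 : ∑ i ∈ T, ∑ j ∈ T, (if R i j then a i else 0) ≤ N * ∑ i ∈ T, a i := by
    rw [Finset.mul_sum]
    refine Finset.sum_le_sum fun i hi => ?_
    rw [← Finset.sum_filter, Finset.sum_const, nsmul_eq_mul]
    have : ((T.filter (fun j => R i j)).card : ℝ) ≤ N := by exact_mod_cast hN i hi
    exact mul_le_mul_of_nonneg_right this (ha i)
  have h2 : ∑ i ∈ T, ∑ j ∈ T, (if R i j then a j else 0)
      = ∑ i ∈ T, ∑ j ∈ T, (if R i j then a i else 0) := by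
    rw [Finset.sum_comm]
    refine Finset.sum_congr rfl fun i _ => Finset.sum_congr rfl fun j _ => ?_
    have : R i j ↔ R j i := ⟨hsymm i j, hsymm j i⟩
    simp only [this]
  have h3 : ∑ i ∈ T, ∑ j ∈ T, c i j ≤
      ∑ i ∈ T, ∑ j ∈ T, ((if R i j then a i else 0) + (if R i j then a j else 0)) / 2 := by
    refine Finset.sum_le_sum fun i hi => Finset.sum_le_sum fun j hj => ?_
    by_cases h : R i j
    · simpa [h] using hc i hi j hj h
    · simpa [h] using hc0 i hi j hj h
  simp only [add_div, Finset.sum_add_distrib, ← Finset.sum_div] at h3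
  rw [h2] at h3
  linarith

/-- The space-frequency plane. -/
abbrev CFPlane := EuclideanSpace ℝ (Fin 2)

/-- Pointwise product of Schwartz functions. -/
noncomputable def cfMul (f g : SchwartzMap CFPlane ℂ) : SchwartzMap CFPlane ℂ :=
  SchwartzMap.pairing (ContinuousLinearMap.mul ℂ ℂ) f g

lemma cfMul_apply (f g : SchwartzMap CFPlane ℂ) (x : CFPlane) : cfMul f g x = f x * g x := by
  simp [cfMul]

open Convolution in
lemma cf_fourier_mul (f g : SchwartzMap CFPlane ℂ) (w : CFPlane) :
    𝓕 ⇑(cfMul f g) w = ((𝓕 ⇑f) ⋆[ContinuousLinearMap.mul ℂ ℂ] (𝓕 ⇑g)) w := by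
  have h0 := SchwartzMap.convolution_apply (ContinuousLinearMap.mul ℂ ℂ) (𝓕 f) (𝓕 g) w
  rw [SchwartzMap.fourier_coe, SchwartzMap.fourier_coe] at h0
  rw [← h0]
  have h1 : SchwartzMap.convolution (ContinuousLinearMap.mul ℂ ℂ) (𝓕 f) (𝓕 g)
      = 𝓕⁻ (SchwartzMap.pairing (ContinuousLinearMap.mul ℂ ℂ) (𝓕 (𝓕 f)) (𝓕 (𝓕 g))) := by
    rw [← SchwartzMap.fourier_convolution]; simp
  rw [h1, SchwartzMap.fourierInv_coe, Real.fourierInv_eq_fourier_comp_neg]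
  refine congrArg (fun u : CFPlane → ℂ => 𝓕 u w) ?_
  funext x
  have key : ∀ u : SchwartzMap CFPlane ℂ, (𝓕 (𝓕 u)) (-x) = u x := by
    intro u
    rw [SchwartzMap.fourier_coe, ← Real.fourierInv_eq_fourier_neg, ← SchwartzMap.fourierInv_coe]
    simp
  rw [cfMul_apply]
  simp [key]

lemma cf_fourier_mul_support (f g : SchwartzMap CFPlane ℂ) (w : CFPlane)
    (h : 𝓕 ⇑(cfMul f g) w ≠ 0) :
    ∃ t s : CFPlane, 𝓕 ⇑f t ≠ 0 ∧ 𝓕 ⇑g s ≠ 0 ∧ t + s = w := by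
  rw [cf_fourier_mul] at h
  by_contra! hcon
  apply h
  rw [MeasureTheory.convolution_def]
  have : ∀ t, (ContinuousLinearMap.mul ℂ ℂ (𝓕 ⇑f t)) (𝓕 ⇑g (w - t)) = 0 := by
    intro t
    by_cases h1 : 𝓕 ⇑f t = 0
    · simp [h1]
    · by_cases h2 : 𝓕 ⇑g (w - t) = 0
      · simp [h2]
      · exact absurd (by abel) (hcon t (w - t) h1 h2)
  simp [this]

lemma cf_orth (f g : SchwartzMap CFPlane ℂ)
    (h : ∀ w, 𝓕 ⇑f w ≠ 0 → 𝓕 ⇑g w ≠ 0 → False) :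
    ∫ x, inner ℂ (f x) (g x) = 0 := by
  rw [← SchwartzMap.integral_inner_fourier_fourier]
  have : ∀ x, inner ℂ ((𝓕 f) x) ((𝓕 g) x) = 0 := by
    intro x
    rw [SchwartzMap.fourier_coe, SchwartzMap.fourier_coe]
    by_cases h1 : 𝓕 ⇑f x = 0
    · simp [h1]
    · by_cases h2 : 𝓕 ⇑g x = 0
      · simp [h2]
      · exact (h x h1 h2).elim
  simp_rw [this]
  exact integral_zero _ _

/-- Nearness of pairs of indices up to swap. -/
def cfNear (P Q : ℤ × ℤ) : Prop :=
  (|P.1 - Q.1| ≤ 2 ∧ |P.2 - Q.2| ≤ 2) ∨ (|P.1 - Q.2| ≤ 2 ∧ |P.2 - Q.1| ≤ 2)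

instance (P Q : ℤ × ℤ) : Decidable (cfNear P Q) := by unfold cfNear; infer_instance

lemma cfNear_symm (P Q : ℤ × ℤ) (h : cfNear P Q) : cfNear Q P := by
  unfold cfNear at *
  simp only [abs_le] at *
  omega

lemma cfNear_card (T : Finset (ℤ × ℤ)) (P : ℤ × ℤ) :
    (T.filter (fun Q => cfNear P Q)).card ≤ 50 := by
  have hsub : T.filter (fun Q => cfNear P Q) ⊆
      (Finset.Icc (P.1 - 2) (P.1 + 2) ×ˢ Finset.Icc (P.2 - 2) (P.2 + 2)) ∪
      (Finset.Icc (P.2 - 2) (P.2 + 2) ×ˢ Finset.Icc (P.1 - 2) (P.1 + 2)) := by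
    intro Q hQ
    have h := (Finset.mem_filter.1 hQ).2
    unfold cfNear at h
    simp only [Finset.mem_union, Finset.mem_product, Finset.mem_Icc]
    simp only [abs_le] at h
    omega
  refine (Finset.card_le_card hsub).trans ((Finset.card_union_le _ _).trans ?_)
  simp only [Finset.card_product, Int.card_Icc]
  have h1 : (P.1 + 2 + 1 - (P.1 - 2)).toNat = 5 := by omega
  have h2 : (P.2 + 2 + 1 - (P.2 - 2)).toNat = 5 := by omega
  rw [h1, h2]

lemma cf_int_near {j j' : ℤ} {s x x' : ℝ} (hs : 0 < s) (h1 : j * s ≤ x) (h2 : x ≤ (j + 1) * s)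
    (h1' : j' * s ≤ x') (h2' : x' ≤ (j' + 1) * s) (h : |x - x'| < 2 * s) : |j - j'| ≤ 2 := by
  rw [abs_lt] at h
  have a1 : ((j - j' : ℤ) : ℝ) < 3 := by
    push_cast
    by_contra! hh
    nlinarith
  have a2 : (-3 : ℝ) < ((j - j' : ℤ) : ℝ) := by
    push_cast
    by_contra! hh
    nlinarith
  have b1 : j - j' < 3 := by exact_mod_cast a1
  have b2 : -3 < j - j' := by exact_mod_cast a2
  rw [abs_le]; omega

/-- The geometric transversality lemma. -/
lemma cf_geom {δ s : ℝ} (hs : 0 < s) (hδ : δ = s ^ 3) {P Q : ℤ × ℤ}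
    (hP : 2 ≤ |P.1 + P.2 + 1|) {x1 x2 y1 y2 a1 a2 b1 b2 : ℝ}
    (hx1 : P.1 * s ≤ x1) (hx1' : x1 ≤ (P.1 + 1) * s)
    (hx2 : P.2 * s ≤ x2) (hx2' : x2 ≤ (P.2 + 1) * s)
    (hy1 : Q.1 * s ≤ y1) (hy1' : y1 ≤ (Q.1 + 1) * s)
    (hy2 : Q.2 * s ≤ y2) (hy2' : y2 ≤ (Q.2 + 1) * s)
    (ha1 : |a1 - x1 ^ 3| ≤ δ) (ha2 : |a2 - x2 ^ 3| ≤ δ)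
    (hb1 : |b1 - y1 ^ 3| ≤ δ) (hb2 : |b2 - y2 ^ 3| ≤ δ)
    (hsum : x1 + x2 = y1 + y2) (hsum' : a1 + a2 = b1 + b2) : cfNear P Q := by
  have hA : s ≤ |x1 + x2| := by
    rcases le_abs.1 hP with h | h
    · have h' : (2 : ℝ) ≤ P.1 + P.2 + 1 := by exact_mod_cast h
      exact le_abs.2 (Or.inl (by nlinarith))
    · have h' : (2 : ℝ) ≤ -(P.1 + P.2 + 1) := by exact_mod_cast h
      exact le_abs.2 (Or.inr (by nlinarith))
  have hy : y2 = x1 + x2 - y1 := by linarith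
  have hprod : |3 * ((x1 + x2) * ((x1 - y1) * (x1 - y2)))| ≤ 4 * s ^ 3 := by
    have e : 3 * ((x1 + x2) * ((x1 - y1) * (x1 - y2))) = x1 ^ 3 + x2 ^ 3 - y1 ^ 3 - y2 ^ 3 := by
      rw [hy]; ring
    rw [e, ← hδ]
    rw [abs_le] at *
    constructor <;> linarith
  have hor : |x1 - y1| < 2 * s ∨ |x1 - y2| < 2 * s := by
    by_contra! hcon
    obtain ⟨c1, c2⟩ := hcon
    rw [abs_mul, abs_mul, abs_mul, abs_of_pos (by norm_num : (0:ℝ) < 3)] at hprod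
    have d1 : (2 * s) * (2 * s) ≤ |x1 - y1| * |x1 - y2| :=
      mul_le_mul c1 c2 (by positivity) (abs_nonneg _)
    have d2 : s * ((2 * s) * (2 * s)) ≤ |x1 + x2| * (|x1 - y1| * |x1 - y2|) :=
      mul_le_mul hA d1 (by positivity) (abs_nonneg _)
    have : 0 < s ^ 3 := by positivity
    nlinarith
  rcases hor with h | h
  · left
    refine ⟨cf_int_near hs hx1 hx1' hy1 hy1' h, cf_int_near hs hx2 hx2' hy2 hy2' ?_⟩
    have : x2 - y2 = -(x1 - y1) := by linarith
    rwa [this, abs_neg]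
  · right
    refine ⟨cf_int_near hs hx1 hx1' hy2 hy2' h, cf_int_near hs hx2 hx2' hy1 hy1' ?_⟩
    have : x2 - y1 = -(x1 - y2) := by linarith
    rwa [this, abs_neg]

lemma cf_integrable_sq (f : SchwartzMap CFPlane ℂ) : Integrable (fun x => ‖f x‖ ^ 2) := by
  have := (f.memLp 2 (volume : Measure CFPlane)).integrable_norm_pow (p := 2) (by norm_num)
  simpa using this

lemma cf_integrable_inner (f g : SchwartzMap CFPlane ℂ) :
    Integrable (fun x => inner ℂ (f x) (g x)) :=
  by
  refine ((cf_integrable_sq f).add (cf_integrable_sq g)).mono'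
    (f.continuous.inner g.continuous).aestronglyMeasurable (Eventually.of_forall fun x => ?_)
  have h1 := norm_inner_le_norm (𝕜 := ℂ) (f x) (g x)
  simp only [Pi.add_apply]
  nlinarith [sq_nonneg (‖f x‖ - ‖g x‖), sq_nonneg (‖f x‖ + ‖g x‖)]

/-- Almost orthogonality. -/
lemma cf_almost_orth (T : Finset (ℤ × ℤ)) (G : ℤ × ℤ → SchwartzMap CFPlane ℂ)
    (h : ∀ P ∈ T, ∀ Q ∈ T, ¬ cfNear P Q → ∫ x, inner ℂ (G P x) (G Q x) = 0) :
    ∫ x, ‖∑ P ∈ T, G P x‖ ^ 2 ≤ 50 * ∑ P ∈ T, ∫ x, ‖G P x‖ ^ 2 := by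
  have e : ∫ x, ‖∑ P ∈ T, G P x‖ ^ 2
      = ∑ P ∈ T, ∑ Q ∈ T, ∫ x, RCLike.re (inner ℂ (G P x) (G Q x)) := by
    have : ∀ x, ‖∑ P ∈ T, G P x‖ ^ 2
        = ∑ P ∈ T, ∑ Q ∈ T, RCLike.re (inner ℂ (G P x) (G Q x)) := by
      intro x
      rw [← inner_self_eq_norm_sq (𝕜 := ℂ), sum_inner, map_sum]
      refine Finset.sum_congr rfl fun P _ => ?_
      rw [inner_sum, map_sum]
    simp_rw [this]
    rw [integral_finsetSum]
    · refine Finset.sum_congr rfl fun P _ => ?_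
      rw [integral_finsetSum]
      intro Q _
      exact (cf_integrable_inner _ _).re
    · intro P _
      refine integrable_finsetSum _ fun Q _ => (cf_integrable_inner _ _).re
  rw [e]
  refine (cf_schur T (fun P => ∫ x, ‖G P x‖ ^ 2) _ cfNear 50 ?_ cfNear_symm ?_ ?_
    (fun P _ => cfNear_card T P)).trans (by norm_num)
  · intro P; positivity
  · intro P _ Q _ _
    rw [← integral_add (cf_integrable_sq _) (cf_integrable_sq _), ← integral_div]
    refine integral_mono (cf_integrable_inner _ _).re
      (((cf_integrable_sq _).add (cf_integrable_sq _)).div_const 2) fun x => ?_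
    have h1 := re_inner_le_norm (𝕜 := ℂ) (G P x) (G Q x)
    nlinarith [sq_nonneg (‖G P x‖ - ‖G Q x‖)]
  · intro P hP Q hQ hn
    rw [integral_re (cf_integrable_inner _ _), h P hP Q hQ hn]
    simp

/-- Near-antidiagonal relation. -/
lemma cf_antidiag (K : Finset ℤ) (v : ℤ → ℂ) :
    ‖∑ P ∈ (K ×ˢ K).filter (fun P => ¬ 2 ≤ |P.1 + P.2 + 1|), v P.1 * v P.2‖
      ≤ 3 * ∑ k ∈ K, ‖v k‖ ^ 2 := by
  refine (norm_sum_le _ _).trans ?_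
  rw [Finset.sum_filter, Finset.sum_product]
  refine (cf_schur K (fun k => ‖v k‖ ^ 2) _ (fun i j => ¬ 2 ≤ |i + j + 1|) 3 ?_ ?_ ?_ ?_ ?_).trans
    (by norm_num)
  · intro i; positivity
  · intro i j h; rwa [add_comm j i]
  · intro i _ j _ h
    simp only [h, not_false_eq_true, if_true, norm_mul]
    nlinarith [sq_nonneg (‖v i‖ - ‖v j‖)]
  · intro i _ j _ h
    simp only [h, if_false, le_refl]
  · intro i _
    have hsub : K.filter (fun j => ¬ 2 ≤ |i + j + 1|) ⊆ Finset.Icc (-i - 2) (-i) := by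
      intro j hj
      have h := (Finset.mem_filter.1 hj).2
      rw [not_le, abs_lt] at h
      rw [Finset.mem_Icc]; omega
    refine (Finset.card_le_card hsub).trans ?_
    rw [Int.card_Icc]; omega

/-- Córdoba–Fefferman square function estimate for the cubic curve (Theorem 2.2):
an `L⁴` square function bound for a decomposition of the `δ`-neighborhood of
`{(ξ, ξ³) : |ξ| ≤ 1}` into blocks of length `δ^{1/3}`. -/
theorem cordoba_fefferman_square_function_cubic :
    ∃ C : ℝ, 0 < C ∧
      ∀ δ : ℝ, δ ∈ Set.Ioo (0 : ℝ) (1 / 2) →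
      ∀ F : ℤ → SchwartzMap (EuclideanSpace ℝ (Fin 2)) ℂ,
        (Function.support F).Finite →
        (∀ k : ℤ, Function.support (𝓕 ⇑(F k)) ⊆
          {p : EuclideanSpace ℝ (Fin 2) |
            |p 0| ≤ 1 ∧ (k : ℝ) * δ ^ ((1 : ℝ) / 3) ≤ p 0 ∧
            p 0 ≤ ((k : ℝ) + 1) * δ ^ ((1 : ℝ) / 3) ∧
            |p 1 - (p 0) ^ 3| ≤ δ}) →
        (∫ x : EuclideanSpace ℝ (Fin 2), ‖∑' k : ℤ, F k x‖ ^ 4)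
          ≤ C ^ 4 * ∫ x : EuclideanSpace ℝ (Fin 2), (∑' k : ℤ, ‖F k x‖ ^ 2) ^ 2 := by
  refine ⟨4, by norm_num, ?_⟩
  intro δ hδ F hF hsupp
  obtain ⟨s, hs⟩ : ∃ s, s = δ ^ ((1 : ℝ) / 3) := ⟨_, rfl⟩
  have hs0 : 0 < s := by rw [hs]; exact Real.rpow_pos_of_pos hδ.1 _
  have hs3 : δ = s ^ 3 := by
    rw [hs, ← Real.rpow_natCast, ← Real.rpow_mul hδ.1.le]; norm_num
  rw [← hs] at hsupp
  set K : Finset ℤ := hF.toFinset with hK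
  have hz : ∀ k, k ∉ K → F k = 0 := by
    intro k hk
    simpa [hK] using hk
  have t1 : ∀ x, ∑' k, F k x = ∑ k ∈ K, F k x := fun x =>
    tsum_eq_sum fun k hk => by simp [hz k hk]
  have t2 : ∀ x, ∑' k, ‖F k x‖ ^ 2 = ∑ k ∈ K, ‖F k x‖ ^ 2 := fun x =>
    tsum_eq_sum fun k hk => by simp [hz k hk]
  simp_rw [t1, t2]
  set G : ℤ × ℤ → SchwartzMap CFPlane ℂ := fun P => cfMul (F P.1) (F P.2) with hG
  set T := (K ×ˢ K).filter (fun P => 2 ≤ |P.1 + P.2 + 1|) with hT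
  have hSq : ∀ x, (∑ k ∈ K, ‖F k x‖ ^ 2) ^ 2 = ∑ P ∈ K ×ˢ K, ‖G P x‖ ^ 2 := by
    intro x
    rw [sq, Finset.sum_mul_sum, Finset.sum_product]
    simp only [hG, cfMul_apply, norm_mul, mul_pow]
  have hSqI : Integrable (fun x => (∑ k ∈ K, ‖F k x‖ ^ 2) ^ 2) := by
    simp_rw [hSq]
    exact integrable_finsetSum _ fun P _ => cf_integrable_sq _
  have horth : ∀ P ∈ T, ∀ Q ∈ T, ¬ cfNear P Q → ∫ x, inner ℂ (G P x) (G Q x) = 0 := by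
    intro P hP Q _ hn
    refine cf_orth _ _ fun w h1 h2 => hn ?_
    obtain ⟨p1, p2, hp1, hp2, hp⟩ := cf_fourier_mul_support _ _ _ h1
    obtain ⟨q1, q2, hq1, hq2, hq⟩ := cf_fourier_mul_support _ _ _ h2
    obtain ⟨-, m1, m2, m3⟩ := hsupp _ hp1
    obtain ⟨-, m4, m5, m6⟩ := hsupp _ hp2
    obtain ⟨-, m7, m8, m9⟩ := hsupp _ hq1
    obtain ⟨-, n1, n2, n3⟩ := hsupp _ hq2
    have e : p1 + p2 = q1 + q2 := hp.trans hq.symm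
    exact cf_geom hs0 hs3 (Finset.mem_filter.1 hP).2 m1 m2 m4 m5 m7 m8 n1 n2 m3 m6 m9 n3
      (by simpa using congrArg (fun v : CFPlane => v 0) e)
      (by simpa using congrArg (fun v : CFPlane => v 1) e)
  have hB := cf_almost_orth T G horth
  have hB2 : ∑ P ∈ T, ∫ x, ‖G P x‖ ^ 2 ≤ ∫ x, (∑ k ∈ K, ‖F k x‖ ^ 2) ^ 2 := by
    simp_rw [hSq]
    rw [integral_finsetSum _ fun P _ => cf_integrable_sq _]
    exact Finset.sum_le_sum_of_subset_of_nonneg (Finset.filter_subset _ _)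
      fun P _ _ => by positivity
  have hBI : Integrable (fun x => ‖∑ P ∈ T, G P x‖ ^ 2) := by
    have := cf_integrable_sq (∑ P ∈ T, G P)
    simpa [sum_apply] using this
  have hpt : ∀ x, ‖∑ k ∈ K, F k x‖ ^ 4 ≤
      18 * (∑ k ∈ K, ‖F k x‖ ^ 2) ^ 2 + 2 * ‖∑ P ∈ T, G P x‖ ^ 2 := by
    intro x
    have hA := cf_antidiag K (fun k => F k x)
    set A := ∑ P ∈ (K ×ˢ K).filter (fun P => ¬ 2 ≤ |P.1 + P.2 + 1|), F P.1 x * F P.2 x with hAdef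
    have hsplit : (∑ k ∈ K, F k x) ^ 2 = (∑ P ∈ T, G P x) + A := by
      rw [sq, Finset.sum_mul_sum, ← Finset.sum_product', hAdef, hT]
      simp only [hG, cfMul_apply]
      rw [Finset.sum_filter_add_sum_filter_not]
    have e4 : ‖∑ k ∈ K, F k x‖ ^ 4 = ‖(∑ P ∈ T, G P x) + A‖ ^ 2 := by
      rw [← hsplit, norm_pow]; ring
    rw [e4]
    have h1 := norm_add_le (∑ P ∈ T, G P x) A
    have h2 : ‖(∑ P ∈ T, G P x) + A‖ ^ 2 ≤ (‖∑ P ∈ T, G P x‖ + ‖A‖) ^ 2 :=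
      pow_le_pow_left₀ (norm_nonneg _) h1 2
    have h3 : ‖A‖ ^ 2 ≤ (3 * ∑ k ∈ K, ‖F k x‖ ^ 2) ^ 2 :=
      pow_le_pow_left₀ (norm_nonneg _) hA 2
    nlinarith [sq_nonneg (‖∑ P ∈ T, G P x‖ - ‖A‖)]
  have hmain : ∫ x, ‖∑ k ∈ K, F k x‖ ^ 4 ≤
      ∫ x, (18 * (∑ k ∈ K, ‖F k x‖ ^ 2) ^ 2 + 2 * ‖∑ P ∈ T, G P x‖ ^ 2) :=
    integral_mono_of_nonneg (Eventually.of_forall fun x => by positivity)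
      ((hSqI.const_mul 18).add (hBI.const_mul 2)) (Eventually.of_forall hpt)
  rw [integral_add (hSqI.const_mul 18) (hBI.const_mul 2), integral_const_mul,
    integral_const_mul] at hmain
  have hnn : 0 ≤ ∫ x, (∑ k ∈ K, ‖F k x‖ ^ 2) ^ 2 := by positivity
  linarith
end
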